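/- Assume the Riemann Hypothesis. Let x = T^β with 0 < β < 1/2 fixed, and let R(T) = ∫_1^T Z_x(t+y₁)·Z_x(t+y₂) dt. Then uniformly for |y₁|, |y₂| ≤ log T, R(T) = (2T/(2π²β)²)·∫_0^{∞} k(u/(2πβ))·F(u,T)·cos(u(y₁−y₂)·log T) du + O(T·(y₁−y₂)²/(1+(y₁−y₂)²)) + O((log T)^4) + O(T/log T). -/

import Mathlib

open MeasureTheory Filter Finset

/-- Pairs of nontrivial zeros of the Riemann zeta function whose ordinates lie in `(0, T]`. -/
def zeroPairs (T : ℝ) : Set (ℂ × ℂ) :=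
  {p | riemannZeta p.1 = 0 ∧ 0 < p.1.re ∧ p.1.re < 1 ∧ p.1.im ∈ Set.Ioc 0 T ∧
       riemannZeta p.2 = 0 ∧ 0 < p.2.re ∧ p.2.re < 1 ∧ p.2.im ∈ Set.Ioc 0 T}

/-- Montgomery's pair correlation function
`F(u,T) = (2π/(T log T)) ∑_{0<γ₁,γ₂≤T} T^{-iu(γ₁-γ₂)} w(γ₁-γ₂)`, `w(u) = 4/(4+u²)`. -/
noncomputable def Fpair (u T : ℝ) : ℝ :=
  (2 * Real.pi / (T * Real.log T)) *
    (∑' p : zeroPairs T,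
      ((T : ℂ) ^ (-(Complex.I * (u : ℂ) * ((p.val.1.im - p.val.2.im : ℝ) : ℂ))) *
        (((4 / (4 + (p.val.1.im - p.val.2.im) ^ 2) : ℝ)) : ℂ))).re

/-- `h(v) = sin(v) ∫_0^∞ (u/(u²+v²)) du/sinh(u)`. -/
noncomputable def hfun (v : ℝ) : ℝ :=
  Real.sin v * ∫ u in Set.Ioi (0 : ℝ), u / ((u ^ 2 + v ^ 2) * Real.sinh u)

/-- `Z_x(t) = (1/π) ∑_γ h((t-γ) log x)`, summed over ordinates of nontrivial zeros of `ζ`. -/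
noncomputable def Zx (x t : ℝ) : ℝ :=
  (1 / Real.pi) *
    ∑' ρ : {z : ℂ // riemannZeta z = 0 ∧ 0 < z.re ∧ z.re < 1},
      hfun ((t - ρ.val.im) * Real.log x)

/-- The kernel `k(u)`: `(1/(2u) - (π²/2)cot(π²u))²` for `|u| ≤ 1/(2π)`, and `1/(4u²)` else. -/
noncomputable def kker (u : ℝ) : ℝ :=
  if |u| ≤ 1 / (2 * Real.pi) then
    (1 / (2 * u) - Real.pi ^ 2 / 2 * Real.cot (Real.pi ^ 2 * u)) ^ 2
  else 1 / (4 * u ^ 2)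

/-- The fractional part, cut off to `(1, ∞)`. -/
noncomputable def fractTail (t : ℝ) : ℂ := Set.indicator (Set.Ioi (1 : ℝ)) (fun t => ((Int.fract t : ℝ) : ℂ)) t

lemma norm_fractTail_le (t : ℝ) : ‖fractTail t‖ ≤ 1 := by
  unfold fractTail
  by_cases h : t ∈ Set.Ioi (1 : ℝ)
  · rw [Set.indicator_of_mem h, Complex.norm_real, Real.norm_eq_abs, abs_of_nonneg (Int.fract_nonneg t)]
    exact (Int.fract_lt_one t).le
  · rw [Set.indicator_of_notMem h]; simp

lemma measurable_fractTail : Measurable fractTail := by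
  unfold fractTail
  exact (Complex.measurable_ofReal.comp measurable_fract).indicator measurableSet_Ioi

lemma mellin_fractTail (s : ℂ) :
    mellin fractTail (-s) = ∫ t in Set.Ioi (1 : ℝ), (t : ℂ) ^ (-(s + 1)) * ((Int.fract t : ℝ) : ℂ) := by
  unfold mellin fractTail
  have : ∀ t : ℝ, (t : ℂ) ^ (-s - 1) • Set.indicator (Set.Ioi (1 : ℝ)) (fun t => ((Int.fract t : ℝ) : ℂ)) t
      = Set.indicator (Set.Ioi (1 : ℝ)) (fun t : ℝ => (t : ℂ) ^ (-(s + 1)) * ((Int.fract t : ℝ) : ℂ)) t := by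
    intro t
    by_cases h : t ∈ Set.Ioi (1 : ℝ)
    · simp only [Set.indicator_of_mem h, smul_eq_mul]; congr 2; ring
    · simp only [Set.indicator_of_notMem h, smul_zero]
  simp_rw [this]
  rw [setIntegral_indicator measurableSet_Ioi]
  congr 2
  ext x; simp

lemma differentiableAt_mellin_fractTail {s : ℂ} (hs : 0 < s.re) :
    DifferentiableAt ℂ (mellin fractTail) (-s) := by
  have hloc : LocallyIntegrableOn fractTail (Set.Ioi 0) := by
    apply LocallyIntegrable.locallyIntegrableOn
    refine (locallyIntegrable_const (1 : ℝ)).mono measurable_fractTail.aestronglyMeasurable ?_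
    exact Eventually.of_forall fun t => by simpa using norm_fractTail_le t
  refine mellin_differentiableAt_of_isBigO_rpow (a := 0) (b := -s.re - 1) hloc ?_ ?_ ?_ ?_
  · simp only [neg_zero, Real.rpow_zero]
    exact Asymptotics.isBigO_of_le _ fun t => by simpa using norm_fractTail_le t
  · simp [hs]
  · refine Asymptotics.IsBigO.of_bound 0 ?_
    filter_upwards [mem_nhdsWithin_of_mem_nhds (Iio_mem_nhds (zero_lt_one (α := ℝ)))] with t ht
    have : t ∉ Set.Ioi (1 : ℝ) := by simp at ht ⊢; linarith
    simp [fractTail, this]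
  · simp

lemma norm_mellin_fractTail_le {s : ℂ} (hs : 0 < s.re) :
    ‖mellin fractTail (-s)‖ ≤ 1 / s.re := by
  rw [mellin_fractTail]
  have h2 : ∫ t in Set.Ioi (1 : ℝ), t ^ (-(s.re + 1)) = 1 / s.re := by
    rw [integral_Ioi_rpow_of_lt (by linarith) one_pos]
    simp
  rw [← h2]
  refine norm_integral_le_of_norm_le (integrableOn_Ioi_rpow_of_lt (by linarith) one_pos) ?_
  filter_upwards [ae_restrict_mem measurableSet_Ioi] with t ht
  have ht0 : (0 : ℝ) < t := lt_trans one_pos ht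
  rw [norm_mul, Complex.norm_cpow_eq_rpow_re_of_pos ht0, Complex.norm_real, Real.norm_eq_abs,
    abs_of_nonneg (Int.fract_nonneg t)]
  have h1 := (Int.fract_lt_one t).le
  have h3 : 0 ≤ t ^ (-(s.re + 1)) := by positivity
  have : (-(s + 1)).re = -(s.re + 1) := by simp
  rw [this]
  nlinarith

lemma riemannZeta_eq_mul_integral {s : ℂ} (hs : 1 < s.re) :
    riemannZeta s = s / (s - 1) - s * mellin fractTail (-s) := by
  have h1 : LSeries (fun n => ((1 : ℝ) : ℂ)) s = _ :=
    LSeries_eq_mul_integral_of_nonneg (fun _ => (1 : ℝ)) (r := 1) zero_le_one hs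
      (by simpa using Asymptotics.isBigO_refl _ _) (fun _ => zero_le_one)
  have h2 : LSeries (fun n => ((1 : ℝ) : ℂ)) s = riemannZeta s := by
    have := LSeries_one_eq_riemannZeta hs
    rw [← this]; congr 1
  rw [← h2, h1, mellin_fractTail]
  have hs0 : s ≠ 0 := by rintro rfl; simp at hs; linarith
  have hs1 : s - 1 ≠ 0 := by
    intro h
    have := congrArg Complex.re h; simp at this; linarith
  have hA : IntegrableOn (fun t : ℝ => (t : ℂ) ^ (-s)) (Set.Ioi 1) :=
    integrableOn_Ioi_cpow_of_lt (by simp; linarith) one_pos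
  have hB : IntegrableOn (fun t : ℝ => (t : ℂ) ^ (-(s + 1)) * ((Int.fract t : ℝ) : ℂ)) (Set.Ioi 1) := by
    have hC : IntegrableOn (fun t : ℝ => (t : ℂ) ^ (-(s + 1))) (Set.Ioi 1) :=
      integrableOn_Ioi_cpow_of_lt (by simp; linarith) one_pos
    refine hC.mul_bdd (c := 1) (Complex.measurable_ofReal.comp measurable_fract).aestronglyMeasurable ?_
    refine Eventually.of_forall fun t => ?_
    simp only [Complex.norm_real, Real.norm_eq_abs]
    rw [abs_of_nonneg (Int.fract_nonneg t)]
    exact (Int.fract_lt_one t).le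
  have h3 : ∫ t in Set.Ioi (1 : ℝ), (∑ k ∈ Icc 1 ⌊t⌋₊, ((1 : ℝ) : ℂ)) * (t : ℂ) ^ (-(s + 1))
      = (∫ t in Set.Ioi (1 : ℝ), (t : ℂ) ^ (-s)) -
        ∫ t in Set.Ioi (1 : ℝ), (t : ℂ) ^ (-(s + 1)) * ((Int.fract t : ℝ) : ℂ) := by
    rw [← integral_sub hA hB]
    refine setIntegral_congr_fun measurableSet_Ioi fun t ht => ?_
    have ht0 : (0 : ℝ) < t := lt_trans one_pos ht
    have htc : (t : ℂ) ≠ 0 := by exact_mod_cast ht0.ne'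
    have e1 : (t : ℂ) ^ (-s) = t * (t : ℂ) ^ (-(s + 1)) := by
      rw [show -s = 1 + (-(s + 1)) by ring, Complex.cpow_add _ _ htc, Complex.cpow_one]
    have e2 : (Int.fract t : ℝ) = t - (⌊t⌋₊ : ℝ) := by
      rw [Int.fract]; congr 1
      exact_mod_cast (natCast_floor_eq_intCast_floor ht0.le).symm
    simp only [e1, e2]
    simp
    ring
  rw [h3, mul_sub]
  congr 1
  rw [integral_Ioi_cpow_of_lt (by simp; linarith) one_pos]
  simp
  rw [show (-s + 1) = -(s-1) by ring]
  field_simp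

lemma riemannZeta₁_eq_integral {s : ℂ} (hs : 0 < s.re) :
    riemannZeta₁ s = s - s * (s - 1) * mellin fractTail (-s) := by
  have hopen : IsOpen {s : ℂ | 0 < s.re} := isOpen_lt continuous_const Complex.continuous_re
  have hconn : IsPreconnected {s : ℂ | 0 < s.re} :=
    (convex_halfSpace_re_gt 0).isPreconnected
  have hg : DifferentiableOn ℂ (fun s => s - s * (s - 1) * mellin fractTail (-s)) {s : ℂ | 0 < s.re} := by
    intro z hz
    have h := (differentiableAt_mellin_fractTail hz)
    have h' : DifferentiableAt ℂ (fun z => mellin fractTail (-z)) z :=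
      DifferentiableAt.comp (g := mellin fractTail) z h (differentiable_neg.differentiableAt)
    exact (differentiableAt_id.sub ((differentiableAt_id.mul (differentiableAt_id.sub_const 1)).mul h')).differentiableWithinAt
  have := (differentiable_riemannZeta₁.differentiableOn.analyticOnNhd hopen).eqOn_of_preconnected_of_eventuallyEq
    (hg.analyticOnNhd hopen) hconn (z₀ := 2) (by simp) ?_
  · exact this hs
  · have h1 : ∀ᶠ z : ℂ in nhds 2, 1 < z.re :=
      (isOpen_lt continuous_const Complex.continuous_re).mem_nhds (by simp)
    filter_upwards [h1] with z hz
    have hz1 : z - 1 ≠ 0 := by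
      intro h
      have := congrArg Complex.re h; simp at this; linarith
    have e := riemannZeta_eq_inv_sub_mul (s := z) (sub_ne_zero.mp hz1)
    have e2 := riemannZeta_eq_mul_integral hz
    have : riemannZeta₁ z = (z - 1) * riemannZeta z := by
      rw [e]; field_simp
    rw [this, e2]; field_simp

lemma norm_riemannZeta₁_le {s : ℂ} (hs : 1 / 20 ≤ s.re) :
    ‖riemannZeta₁ s‖ ≤ 21 * (1 + ‖s‖) ^ 2 := by
  have h0 : 0 < s.re := by linarith
  rw [riemannZeta₁_eq_integral h0]
  have h1 := norm_mellin_fractTail_le h0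
  have h2 : 1 / s.re ≤ 20 := by
    rw [div_le_iff₀ h0]; linarith
  have h3 : ‖s - 1‖ ≤ ‖s‖ + 1 := by simpa using norm_sub_le s 1
  calc _ ≤ ‖s‖ + ‖s‖ * ‖s - 1‖ * ‖mellin fractTail (-s)‖ := by
        refine (norm_sub_le _ _).trans ?_
        rw [norm_mul, norm_mul]
    _ ≤ ‖s‖ + ‖s‖ * (‖s‖ + 1) * 20 := by
        gcongr; linarith
    _ ≤ _ := by nlinarith [norm_nonneg s]

lemma Gamma_le_exp {x A : ℝ} (hx : 19 / 20 ≤ x) (hxA : x ≤ A) (hA : 1 ≤ A) :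
    Real.Gamma x ≤ 2 * Real.exp (12 * A ^ (3 / 2 : ℝ)) := by
  have h0 : 0 < x := by linarith
  set n : ℕ := ⌈x⌉₊ + 1 with hn
  have hn1 : x + 1 ≤ n := by
    have := Nat.le_ceil x
    push_cast [hn]; linarith
  have hn2 : (n : ℝ) ≤ 3 * A := by
    have := (Nat.ceil_lt_add_one h0.le).le
    push_cast [hn]; linarith
  have e1 : Real.Gamma (x + 2) = (x + 1) * (x * Real.Gamma x) := by
    rw [show x + 2 = (x + 1) + 1 by ring, Real.Gamma_add_one (by linarith), Real.Gamma_add_one h0.ne']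
  have hG : 0 < Real.Gamma x := Real.Gamma_pos_of_pos h0
  have e2 : Real.Gamma x ≤ 2 * Real.Gamma (x + 2) := by
    rw [e1]
    have : 1 ≤ 2 * ((x + 1) * x) := by nlinarith
    nlinarith
  have e3 : Real.Gamma (x + 2) ≤ Real.Gamma (n + 1) :=
    Real.Gamma_strictMonoOn_Ici.monotoneOn (by simp; linarith) (by simp; linarith) (by linarith)
  rw [Real.Gamma_nat_eq_factorial] at e3
  have e4 : (n.factorial : ℝ) ≤ (n : ℝ) ^ n := by exact_mod_cast Nat.factorial_le_pow n
  have hnpos : (0 : ℝ) < n := by linarith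
  have e5 : (n : ℝ) ^ n = Real.exp (n * Real.log n) := by
    rw [← Real.rpow_natCast, Real.rpow_def_of_pos hnpos, mul_comm]
  have e6 : Real.log n ≤ 2 * (n : ℝ) ^ (1 / 2 : ℝ) := by
    have := Real.log_le_rpow_div hnpos.le (ε := 1 / 2) (by norm_num)
    linarith
  have e7 : n * Real.log n ≤ 12 * A ^ (3 / 2 : ℝ) := by
    calc n * Real.log n ≤ n * (2 * (n : ℝ) ^ (1 / 2 : ℝ)) := by gcongr
      _ = 2 * (n : ℝ) ^ (3 / 2 : ℝ) := by
          rw [show (3 / 2 : ℝ) = 1 + 1 / 2 by norm_num, Real.rpow_add hnpos, Real.rpow_one]; ring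
      _ ≤ 2 * (3 * A) ^ (3 / 2 : ℝ) := by gcongr
      _ = 2 * (3 : ℝ) ^ (3 / 2 : ℝ) * A ^ (3 / 2 : ℝ) := by
          rw [Real.mul_rpow (by norm_num) (by linarith)]; ring
      _ ≤ _ := by
          have : (3 : ℝ) ^ (3 / 2 : ℝ) ≤ 6 := by
            have h9 : ((3 : ℝ) ^ (3 / 2 : ℝ)) ^ 2 = 27 := by
              rw [← Real.rpow_natCast, ← Real.rpow_mul (by norm_num)]; norm_num
            nlinarith [Real.rpow_nonneg (show (0:ℝ) ≤ 3 by norm_num) (3 / 2 : ℝ)]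
          have hA' : 0 ≤ A ^ (3 / 2 : ℝ) := by positivity
          nlinarith
  calc Real.Gamma x ≤ 2 * (n.factorial : ℝ) := by linarith
    _ ≤ 2 * Real.exp (n * Real.log n) := by rw [← e5]; gcongr
    _ ≤ _ := by gcongr

lemma norm_cos_le_exp_norm (z : ℂ) : ‖Complex.cos z‖ ≤ Real.exp ‖z‖ := by
  rw [Complex.cos, norm_div, Complex.norm_ofNat]
  have h1 : ‖Complex.exp (z * Complex.I)‖ ≤ Real.exp ‖z‖ := by
    simpa using Complex.norm_exp_le_exp_norm (z * Complex.I)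
  have h2 : ‖Complex.exp (-z * Complex.I)‖ ≤ Real.exp ‖z‖ := by
    simpa using Complex.norm_exp_le_exp_norm (-z * Complex.I)
  have := norm_add_le (Complex.exp (z * Complex.I)) (Complex.exp (-z * Complex.I))
  linarith

lemma riemannZeta₁_growth : ∃ C > 0, ∀ z : ℂ,
    ‖riemannZeta₁ z‖ ≤ Real.exp (C * (1 + ‖z‖) ^ (3 / 2 : ℝ)) := by
  obtain ⟨M, hM⟩ := (isCompact_closedBall (0 : ℂ) 1).exists_bound_of_continuousOn
    differentiable_riemannZeta₁.continuous.continuousOn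
  refine ⟨23 + |M|, by positivity, fun w => ?_⟩
  set A := 1 + ‖w‖ with hAdef
  have hA : 1 ≤ A := by have := norm_nonneg w; linarith
  set B := A ^ (3 / 2 : ℝ) with hB
  have hAB : A ≤ B := by
    simpa using Real.rpow_le_rpow_of_exponent_le hA (show (1 : ℝ) ≤ 3 / 2 by norm_num)
  have hpow : A ^ 3 ≤ Real.exp (3 * B) := by
    have : A ≤ Real.exp B := by linarith [Real.add_one_le_exp B]
    calc A ^ 3 ≤ (Real.exp B) ^ 3 := by gcongr
      _ = _ := by rw [← Real.exp_nat_mul]; norm_num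
  have h336 : (336 : ℝ) ≤ Real.exp (6 * B) := by
    have : (2.7 : ℝ) ≤ Real.exp B := by
      have := Real.exp_one_gt_d9
      have h2 : Real.exp 1 ≤ Real.exp B := Real.exp_le_exp.mpr (by linarith)
      linarith
    calc (336 : ℝ) ≤ 2.7 ^ 6 := by norm_num
      _ ≤ (Real.exp B) ^ 6 := by gcongr
      _ = _ := by rw [← Real.exp_nat_mul]; norm_num
  by_cases h1 : ‖w‖ ≤ 1
  · have := hM w (by simpa using h1)
    have h3 : M ≤ |M| := le_abs_self M
    have h4 := Real.add_one_le_exp ((23 + |M|) * B)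
    have h5 : |M| ≤ (23 + |M|) * B := by nlinarith [abs_nonneg M]
    linarith
  push Not at h1
  by_cases h2 : 1 / 20 ≤ w.re
  · have h3 := norm_riemannZeta₁_le h2
    have h4 : (1 : ℝ) ≤ A := hA
    calc _ ≤ 21 * A ^ 2 := h3
      _ ≤ 336 * A ^ 3 := by nlinarith [pow_pos (lt_of_lt_of_le one_pos hA) 2]
      _ ≤ Real.exp (6 * B) * Real.exp (3 * B) := by gcongr
      _ = Real.exp (9 * B) := by rw [← Real.exp_add]; congr 1; ring
      _ ≤ _ := by
        apply Real.exp_le_exp.mpr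
        nlinarith [abs_nonneg M]
  push Not at h2
  set s := 1 - w with hs
  have hsre : 19 / 20 ≤ s.re := by simp [hs]; linarith
  have hs1 : s ≠ 1 := by
    intro h; rw [hs] at h; simp at h; rw [h] at h1; simp at h1; linarith
  have hw1 : w ≠ 1 := by rintro rfl; simp at h2; linarith
  have hsn : ∀ n : ℕ, s ≠ -n := by
    intro n h
    have := congrArg Complex.re h
    simp at this
    have hn : (0 : ℝ) ≤ n := Nat.cast_nonneg n
    have h' : s.re = -n := by rw [h]; simp
    linarith
  have hsA : ‖s‖ ≤ A := by simpa [hs, hAdef] using norm_sub_le 1 w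
  have key := riemannZeta_one_sub hsn hs1
  have hws : 1 - s = w := by simp [hs]
  rw [hws, riemannZeta_eq_inv_sub_mul hw1, riemannZeta_eq_inv_sub_mul hs1] at key
  have hw1' : w - 1 ≠ 0 := sub_ne_zero.mpr hw1
  have key2 : riemannZeta₁ w = (w - 1) * (2 * (2 * Real.pi) ^ (-s) * Complex.Gamma s *
      Complex.cos (Real.pi * s / 2) * ((s - 1)⁻¹ * riemannZeta₁ s)) := by
    rw [← key]; field_simp
  rw [key2]
  have b1 : ‖w - 1‖ ≤ A := by rw [show w - 1 = -s by simp [hs], norm_neg]; exact hsA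
  have b2 : ‖((2 : ℂ) * Real.pi) ^ (-s)‖ ≤ 1 := by
    have : (2 * Real.pi : ℂ) = ((2 * Real.pi : ℝ) : ℂ) := by push_cast; ring
    rw [this, Complex.norm_cpow_eq_rpow_re_of_pos (by positivity)]
    apply Real.rpow_le_one_of_one_le_of_nonpos
    · nlinarith [Real.pi_gt_three]
    · simp; linarith
  have b3 : ‖Complex.Gamma s‖ ≤ 2 * Real.exp (12 * B) := by
    refine (?_ : _ ≤ Real.Gamma s.re).trans
      (Gamma_le_exp hsre ((Complex.re_le_norm s).trans hsA) hA)
    have hsp : 0 < s.re := by linarith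
    rw [Complex.Gamma_eq_integral hsp, Real.Gamma_eq_integral hsp, Complex.GammaIntegral]
    refine norm_integral_le_of_norm_le (Real.GammaIntegral_convergent hsp) ?_
    filter_upwards [ae_restrict_mem measurableSet_Ioi] with t ht
    rw [norm_mul, Complex.norm_cpow_eq_rpow_re_of_pos ht, Complex.norm_real, Real.norm_eq_abs,
      abs_of_pos (Real.exp_pos _)]
    simp
  have b4 : ‖Complex.cos (Real.pi * s / 2)‖ ≤ Real.exp (2 * B) := by
    refine (norm_cos_le_exp_norm _).trans (Real.exp_le_exp.mpr ?_)
    rw [norm_div, norm_mul, Complex.norm_real, Real.norm_eq_abs, abs_of_pos Real.pi_pos,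
      Complex.norm_ofNat]
    nlinarith [Real.pi_lt_four, Real.pi_pos, norm_nonneg s]
  have b5 : ‖(s - 1)⁻¹‖ ≤ 1 := by
    rw [show s - 1 = -w by simp [hs], norm_inv, norm_neg]
    exact inv_le_one_of_one_le₀ h1.le
  have b6 : ‖riemannZeta₁ s‖ ≤ 84 * A ^ 2 := by
    refine (norm_riemannZeta₁_le (by linarith)).trans ?_
    have : 1 + ‖s‖ ≤ 2 * A := by linarith
    calc 21 * (1 + ‖s‖) ^ 2 ≤ 21 * (2 * A) ^ 2 := by gcongr
      _ = _ := by ring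
  calc ‖(w - 1) * (2 * (2 * Real.pi) ^ (-s) * Complex.Gamma s *
      Complex.cos (Real.pi * s / 2) * ((s - 1)⁻¹ * riemannZeta₁ s))‖
      = ‖w - 1‖ * (2 * ‖((2 : ℂ) * Real.pi) ^ (-s)‖ * ‖Complex.Gamma s‖ *
        ‖Complex.cos (Real.pi * s / 2)‖ * (‖(s - 1)⁻¹‖ * ‖riemannZeta₁ s‖)) := by
        simp only [norm_mul, Complex.norm_ofNat]
    _ ≤ A * (2 * 1 * (2 * Real.exp (12 * B)) * Real.exp (2 * B) * (1 * (84 * A ^ 2))) := by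
        gcongr
    _ = 336 * A ^ 3 * Real.exp (14 * B) := by
        rw [show 14 * B = 12 * B + 2 * B by ring, Real.exp_add]; ring
    _ ≤ Real.exp (6 * B) * Real.exp (3 * B) * Real.exp (14 * B) := by gcongr
    _ = Real.exp (23 * B) := by rw [← Real.exp_add, ← Real.exp_add]; congr 1; ring
    _ ≤ _ := by
        apply Real.exp_le_exp.mpr
        nlinarith [abs_nonneg M]

lemma exists_eq_pow_mul_of_analyticOrderAt_eq (n : ℕ) : ∀ {f : ℂ → ℂ}, Differentiable ℂ f →
    ∀ {ρ : ℂ}, analyticOrderAt f ρ = n →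
    ∃ g : ℂ → ℂ, Differentiable ℂ g ∧ g ρ ≠ 0 ∧ ∀ z, f z = (z - ρ) ^ n * g z := by
  induction n with
  | zero =>
    intro f hf ρ h
    exact ⟨f, hf, by simpa using (hf.analyticAt ρ).analyticOrderAt_eq_zero.1 (by simpa using h),
      by simp⟩
  | succ n ih =>
    intro f hf ρ h
    have h0 : f ρ = 0 := by
      apply apply_eq_zero_of_analyticOrderAt_ne_zero
      rw [h]; simp
    have hg : Differentiable ℂ (dslope f ρ) :=
      differentiableOn_univ.1 ((Complex.differentiableOn_dslope Filter.univ_mem).2 hf.differentiableOn)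
    have hfg : ∀ z, f z = (z - ρ) * dslope f ρ z := by
      intro z
      have := sub_smul_dslope f ρ z
      rw [h0, sub_zero] at this
      rw [← this, smul_eq_mul]
    have hord : analyticOrderAt (dslope f ρ) ρ = n := by
      have h1 : f = (fun z => z - ρ) * dslope f ρ := by ext z; exact hfg z
      have h2 : analyticOrderAt (fun z : ℂ => z - ρ) ρ = 1 := by
        rw [show (1 : ℕ∞) = ((1 : ℕ) : ℕ∞) by rfl,
          AnalyticAt.analyticOrderAt_eq_natCast (by fun_prop)]
        exact ⟨fun _ => 1, by fun_prop, one_ne_zero, by simp⟩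
      have h3 := analyticOrderAt_mul (f := fun z : ℂ => z - ρ) (by fun_prop) (hg.analyticAt ρ)
      rw [← h1, h, h2, Nat.cast_add, Nat.cast_one, add_comm] at h3
      exact (ENat.add_right_injective_of_ne_top (n := 1) (by simp) h3.symm)
    obtain ⟨g, h1, h2, h3⟩ := ih hg hord
    exact ⟨g, h1, h2, fun z => by rw [hfg, h3]; ring⟩

lemma exists_eq_prod_mul {f : ℂ → ℂ} (hf : Differentiable ℂ f) (hf0 : ∃ z, f z ≠ 0) (Z : Finset ℂ) :
    ∃ g : ℂ → ℂ, Differentiable ℂ g ∧ (∀ ρ ∈ Z, g ρ ≠ 0) ∧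
      ∀ z, f z = (∏ ρ ∈ Z, (z - ρ) ^ analyticOrderNatAt f ρ) * g z := by
  classical
  have htop : ∀ ρ, analyticOrderAt f ρ ≠ ⊤ := by
    obtain ⟨z₀, hz₀⟩ := hf0
    intro ρ
    have hA : AnalyticOnNhd ℂ f Set.univ := fun z _ => hf.analyticAt z
    have := (hA.exists_analyticOrderAt_ne_top_iff_forall isConnected_univ).1
      ⟨⟨z₀, trivial⟩, by
        rw [(hf.analyticAt z₀).analyticOrderAt_eq_zero.2 hz₀]; simp⟩
    exact this ⟨ρ, trivial⟩
  induction Z using Finset.induction_on with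
  | empty => exact ⟨f, hf, by simp, by simp⟩
  | insert ρ Z hρ ih =>
    obtain ⟨g, h1, h2, h3⟩ := ih
    set P : ℂ → ℂ := fun z => ∏ σ ∈ Z, (z - σ) ^ analyticOrderNatAt f σ with hP
    have hPd : Differentiable ℂ P := by
      intro z; simp only [hP]; fun_prop
    have hord : analyticOrderAt g ρ = analyticOrderNatAt f ρ := by
      have e : f = P * g := by ext z; exact h3 z
      have hP0 : analyticOrderAt P ρ = 0 := by
        rw [(hPd.analyticAt ρ).analyticOrderAt_eq_zero]
        simp only [hP]
        refine Finset.prod_ne_zero_iff.2 fun σ hσ => pow_ne_zero _ (sub_ne_zero.2 ?_)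
        rintro rfl; exact hρ hσ
      have := analyticOrderAt_mul (hPd.analyticAt ρ) (h1.analyticAt ρ)
      rw [← e, hP0, zero_add] at this
      rw [← this, Nat.cast_analyticOrderNatAt (htop ρ)]
    obtain ⟨g', a1, a2, a3⟩ := exists_eq_pow_mul_of_analyticOrderAt_eq _ h1 hord
    refine ⟨g', a1, ?_, fun z => ?_⟩
    · intro σ hσ
      rcases Finset.mem_insert.1 hσ with rfl | hσ
      · exact a2
      · have := h2 σ hσ
        rw [a3] at this
        exact right_ne_zero_of_mul this
    · rw [Finset.prod_insert hρ, h3, a3]; ring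

/-- A Jensen-type inequality bounding the number of zeros in a disc. -/
lemma pow_sum_order_mul_norm_le {f : ℂ → ℂ} (hf : Differentiable ℂ f) {c : ℂ} (hc : f c ≠ 0)
    {r R M : ℝ} (hr : 0 < r) (hrR : r < R) (Z : Finset ℂ) (hZ : ∀ ρ ∈ Z, ‖ρ - c‖ ≤ r)
    (hM : ∀ z, ‖z - c‖ = R → ‖f z‖ ≤ M) :
    (R / r) ^ (∑ ρ ∈ Z, analyticOrderNatAt f ρ) * ‖f c‖ ≤ M := by
  obtain ⟨g, h1, -, h3⟩ := exists_eq_prod_mul hf ⟨c, hc⟩ Z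
  have hR : 0 < R := hr.trans hrR
  set m := analyticOrderNatAt f
  let B : ℂ → ℂ := fun z =>
    ∏ ρ ∈ Z, ((R ^ 2 - (starRingEnd ℂ) (ρ - c) * (z - c)) / R) ^ m ρ
  have hBd : Differentiable ℂ B := by intro z; simp only [B]; fun_prop
  have hG : Differentiable ℂ (fun z => B z * g z) := hBd.mul h1
  have hsph : ∀ z, ‖z - c‖ = R → ‖B z * g z‖ ≤ M := by
    intro z hz
    refine le_trans (le_of_eq ?_) (hM z hz)
    rw [h3, norm_mul, norm_mul]
    congr 1
    simp only [B, norm_prod, norm_pow]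
    refine Finset.prod_congr rfl fun ρ _ => ?_
    congr 1
    rw [norm_div, Complex.norm_real, Real.norm_of_nonneg hR.le, div_eq_iff hR.ne']
    have e : ((R : ℂ) ^ 2 - (starRingEnd ℂ) (ρ - c) * (z - c)) =
        (starRingEnd ℂ) (z - ρ) * (z - c) := by
      have : (R : ℂ) ^ 2 = (starRingEnd ℂ) (z - c) * (z - c) := by
        rw [mul_comm, Complex.mul_conj, Complex.normSq_eq_norm_sq, hz]; push_cast; ring
      rw [this, ← sub_mul, ← map_sub]; congr 2; ring
    rw [e, norm_mul, hz, RCLike.norm_conj]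
  have hmax : ‖B c * g c‖ ≤ M := by
    refine Complex.norm_le_of_forall_mem_frontier_norm_le (U := Metric.ball c R)
      Metric.isBounded_ball hG.diffContOnCl ?_ (subset_closure (Metric.mem_ball_self hR))
    intro z hz
    rw [frontier_ball _ hR.ne', mem_sphere_iff_norm] at hz
    exact hsph z hz
  refine le_trans ?_ hmax
  rw [h3 c, norm_mul, norm_mul, ← mul_assoc]
  gcongr
  simp only [B, norm_prod, norm_pow]
  rw [← Finset.prod_pow_eq_pow_sum, ← Finset.prod_mul_distrib]
  refine Finset.prod_le_prod (fun _ _ => by positivity) fun ρ hρ => ?_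
  rw [← mul_pow]
  gcongr
  have : ‖((R:ℂ) ^ 2 - (starRingEnd ℂ) (ρ - c) * (c - c)) / R‖ = R := by
    rw [sub_self, mul_zero, sub_zero, pow_two, mul_div_assoc, div_self (by exact_mod_cast hR.ne'),
      mul_one, Complex.norm_real, Real.norm_of_nonneg hR.le]
  rw [this, div_mul_eq_mul_div, div_le_iff₀ hr, norm_sub_rev]
  gcongr
  exact hZ ρ hρ

lemma norm_logDeriv_sub_le {g : ℂ → ℂ} (hg : Differentiable ℂ g) {R M : ℝ} (hR : 0 < R) (hM : 0 < M)
    (h0 : ∀ z, ‖z‖ < R → g z ≠ 0) (hb : ∀ z, ‖z‖ < R → ‖g z‖ ≤ Real.exp M * ‖g 0‖)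
    {z s : ℂ} (hz : ‖z‖ ≤ R / 8) (hs : ‖s‖ ≤ R / 8) :
    ‖logDeriv g z - logDeriv g s‖ ≤ 64 * M / R ^ 2 * ‖z - s‖ := by
  have hball : ∀ {w : ℂ}, w ∈ Metric.ball (0 : ℂ) R ↔ ‖w‖ < R := by simp
  have hld : DifferentiableOn ℂ (logDeriv g) (Metric.ball 0 R) := by
    intro w hw
    have : DifferentiableAt ℂ (deriv g) w := (hg.analyticAt w).deriv.differentiableAt
    exact (this.div (hg w) (h0 w (hball.1 hw))).differentiableWithinAt
  obtain ⟨l, hl0, hl⟩ := hld.isExactOn_ball.with_val_at 0 0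
  have hld' : ∀ w, ‖w‖ < R → HasDerivAt l (logDeriv g w) w := fun w hw => hl w (hball.2 hw)
  have hlD : DifferentiableOn ℂ l (Metric.ball 0 R) := fun w hw =>
    (hl w hw).differentiableAt.differentiableWithinAt
  -- the exponential of `l` recovers `g`
  have hexp : ∀ w, ‖w‖ < R → g w = g 0 * Complex.exp (l w) := by
    intro w hw
    have hk : ∀ w ∈ Metric.ball (0 : ℂ) R,
        HasDerivAt (fun w => g w * Complex.exp (-l w)) 0 w := by
      intro w hw
      have h1 := (hg w).hasDerivAt
      have h2 := (hl w hw).neg.cexp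
      refine (h1.mul h2).congr_deriv ?_
      have := h0 w (hball.1 hw)
      rw [logDeriv_apply]
      simp only [Pi.neg_apply]
      field_simp
      ring
    have hconst : (fun w => g w * Complex.exp (-l w)) w = (fun w => g w * Complex.exp (-l w)) 0 := by
      refine (convex_ball (0 : ℂ) R).is_const_of_fderivWithin_eq_zero (𝕜 := ℂ)
        (fun w hw => (hk w hw).differentiableAt.differentiableWithinAt) ?_
        (hball.2 hw) (by simpa using hR)
      intro w hw
      rw [fderivWithin_of_isOpen Metric.isOpen_ball hw]
      have := (hk w hw).hasFDerivAt.fderiv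
      rw [this]; ext; simp
    simp only [hl0, neg_zero, Complex.exp_zero, mul_one] at hconst
    rw [← hconst, mul_assoc, ← Complex.exp_add]; simp
  have hre : Set.MapsTo l (Metric.ball 0 R) {z | z.re ≤ M} := by
    intro w hw
    have h1 := hb w (hball.1 hw)
    rw [hexp w (hball.1 hw), norm_mul, Complex.norm_exp, mul_comm] at h1
    have h2 : 0 < ‖g 0‖ := norm_pos_iff.2 (h0 0 (by simpa using hR))
    exact Real.exp_le_exp.1 (le_of_mul_le_mul_right h1 h2)
  have hlb : ∀ w, ‖w‖ ≤ R / 2 → ‖l w‖ ≤ 2 * M := by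
    intro w hw
    refine (Complex.borelCaratheodory_zero hM hlD hre hR (hball.2 (by linarith)) hl0).trans ?_
    rw [div_le_iff₀ (by linarith)]
    nlinarith
  have hld1 : ∀ w, ‖w‖ ≤ R / 4 → ‖logDeriv g w‖ ≤ 8 * M / R := by
    intro w hw
    have hsub : Metric.closedBall w (R / 4) ⊆ Metric.ball 0 R := by
      intro u hu
      rw [mem_closedBall_iff_norm] at hu
      rw [hball]
      have := norm_add_le (u - w) w
      rw [sub_add_cancel] at this
      linarith
    have := Complex.norm_deriv_le_of_forall_mem_sphere_norm_le (c := w) (R := R / 4) (C := 2 * M)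
      (by linarith) (f := l) (hlD.diffContOnCl_ball hsub) ?_
    · rw [(hld' w (by linarith)).deriv] at this
      refine this.trans (le_of_eq ?_)
      field_simp; ring
    · intro u hu
      rw [mem_sphere_iff_norm] at hu
      apply hlb
      have := norm_add_le (u - w) w
      rw [sub_add_cancel] at this
      linarith
  have hld2 : ∀ w ∈ Metric.closedBall (0 : ℂ) (R / 8), ‖deriv (logDeriv g) w‖ ≤ 64 * M / R ^ 2 := by
    intro w hw
    rw [mem_closedBall_zero_iff] at hw
    have hsub : Metric.closedBall w (R / 8) ⊆ Metric.ball 0 R := by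
      intro u hu
      rw [mem_closedBall_iff_norm] at hu
      rw [hball]
      have := norm_add_le (u - w) w
      rw [sub_add_cancel] at this
      linarith
    have := Complex.norm_deriv_le_of_forall_mem_sphere_norm_le (c := w) (R := R / 8) (C := 8 * M / R)
      (by linarith) (f := logDeriv g) (hld.diffContOnCl_ball hsub) ?_
    · refine this.trans (le_of_eq ?_)
      field_simp; ring
    · intro u hu
      rw [mem_sphere_iff_norm] at hu
      apply hld1
      have := norm_add_le (u - w) w
      rw [sub_add_cancel] at this
      linarith
  refine (convex_closedBall (0 : ℂ) (R / 8)).norm_image_sub_le_of_norm_deriv_le ?_ hld2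
    (by simpa using hs) (by simpa using hz)
  intro w hw
  rw [mem_closedBall_zero_iff] at hw
  exact (hld w (hball.2 (by linarith))).differentiableAt (Metric.isOpen_ball.mem_nhds (hball.2 (by linarith)))

/-- The number of zeros (with multiplicity) of an entire function of order at most `3/2`. -/
lemma exists_sum_order_le {f : ℂ → ℂ} (hf : Differentiable ℂ f) (hf0 : f 0 ≠ 0) {C : ℝ} (hC : 0 < C)
    (hgr : ∀ z, ‖f z‖ ≤ Real.exp (C * (1 + ‖z‖) ^ (3 / 2 : ℝ))) :
    ∃ A > 0, ∀ R : ℝ, 1 ≤ R → ∀ Z : Finset ℂ, (∀ ρ ∈ Z, ‖ρ‖ ≤ R) →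
      ((∑ ρ ∈ Z, analyticOrderNatAt f ρ : ℕ) : ℝ) ≤ A * R ^ (3 / 2 : ℝ) := by
  refine ⟨8 * C + |Real.log ‖f 0‖|, by positivity, fun R hR Z hZ => ?_⟩
  have hR0 : 0 < R := by linarith
  have h := pow_sum_order_mul_norm_le hf hf0 (r := R) (R := 3 * R) hR0 (by linarith) Z
    (by simpa using hZ) (M := Real.exp (C * (1 + 3 * R) ^ (3 / 2 : ℝ))) (by
      intro z hz
      rw [sub_zero] at hz
      simpa [hz] using hgr z)
  rw [mul_div_assoc, div_self hR0.ne', mul_one] at h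
  set N := ∑ ρ ∈ Z, analyticOrderNatAt f ρ
  have hf0' : 0 < ‖f 0‖ := norm_pos_iff.2 hf0
  have h1 := Real.log_le_log (by positivity) h
  rw [Real.log_exp, Real.log_mul (by positivity) hf0'.ne', Real.log_pow] at h1
  have h3 : (1 : ℝ) ≤ Real.log 3 := by
    rw [Real.le_log_iff_exp_le (by norm_num)]
    exact Real.exp_one_lt_three.le
  have h4 : (1 + 3 * R) ^ (3 / 2 : ℝ) ≤ 8 * R ^ (3 / 2 : ℝ) := by
    calc (1 + 3 * R) ^ (3 / 2 : ℝ) ≤ (4 * R) ^ (3 / 2 : ℝ) :=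
          Real.rpow_le_rpow (by positivity) (by linarith) (by norm_num)
      _ = 8 * R ^ (3 / 2 : ℝ) := by
          rw [Real.mul_rpow (by norm_num) hR0.le]
          congr 1
          rw [show (4 : ℝ) = 2 ^ (2 : ℝ) by norm_num, ← Real.rpow_mul (by norm_num)]
          norm_num
  have h5 : (1 : ℝ) ≤ R ^ (3 / 2 : ℝ) := Real.one_le_rpow hR (by norm_num)
  have h6 := neg_abs_le (Real.log ‖f 0‖)
  have h7 := abs_nonneg (Real.log ‖f 0‖)
  have h8 : (N : ℝ) ≤ N * Real.log 3 := le_mul_of_one_le_right (by positivity) h3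
  nlinarith

lemma summable_order_div {f : ℂ → ℂ} (hf : Differentiable ℂ f) (hf0 : f 0 ≠ 0) {C : ℝ} (hC : 0 < C)
    (hgr : ∀ z, ‖f z‖ ≤ Real.exp (C * (1 + ‖z‖) ^ (3 / 2 : ℝ))) :
    Summable fun ρ : {ρ : ℂ // f ρ = 0} => (analyticOrderNatAt f ρ : ℝ) / (1 + ‖ρ.1‖ ^ 2) := by
  classical
  obtain ⟨A, hA, hcount⟩ := exists_sum_order_le hf hf0 hC hgr
  have hgeo : Summable fun k : ℕ => 4 * A * ((2 : ℝ) ^ (-(1 / 2) : ℝ)) ^ k :=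
    (summable_geometric_of_lt_one (by positivity)
      (Real.rpow_lt_one_of_one_lt_of_neg (by norm_num) (by norm_num))).mul_left _
  refine summable_of_sum_le (c := ∑' k : ℕ, 4 * A * ((2 : ℝ) ^ (-(1 / 2) : ℝ)) ^ k)
    (fun _ => by positivity) fun u => ?_
  let w : {ρ : ℂ // f ρ = 0} → ℕ → ℝ := fun ρ k =>
    if ‖ρ.1‖ ≤ 2 ^ k then 4 * ((4 : ℝ)⁻¹) ^ k else 0
  have hw0 : ∀ ρ k, 0 ≤ w ρ k := fun ρ k => by simp only [w]; split_ifs <;> positivity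
  have hws : ∀ ρ, Summable (w ρ) := fun ρ => by
    refine Summable.of_nonneg_of_le (hw0 ρ) (fun k => ?_)
      ((summable_geometric_of_lt_one (r := (4 : ℝ)⁻¹) (by norm_num) (by norm_num)).mul_left 4)
    simp only [w]; split_ifs
    · exact le_rfl
    · positivity
  have hw1 : ∀ ρ, 1 / (1 + ‖ρ.1‖ ^ 2) ≤ ∑' k, w ρ k := by
    intro ρ
    have hex : ∃ k : ℕ, ‖ρ.1‖ ≤ 2 ^ k := (pow_unbounded_of_one_lt _ one_lt_two).imp fun _ h => h.le
    refine le_trans ?_ ((hws ρ).le_tsum (Nat.find hex) (fun k _ => hw0 ρ k))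
    simp only [w]
    rw [if_pos (Nat.find_spec hex)]
    rcases hk : Nat.find hex with _ | k
    · have : 1 / (1 + ‖ρ.1‖ ^ 2) ≤ 1 := by
        rw [div_le_one (by positivity)]; nlinarith [norm_nonneg ρ.1]
      simpa using this.trans (by norm_num : (1:ℝ) ≤ 4)
    · have h1 : ¬ ‖ρ.1‖ ≤ 2 ^ k := Nat.find_min hex (by omega)
      push Not at h1
      have h2 : (4 : ℝ) ^ k ≤ 1 + ‖ρ.1‖ ^ 2 := by
        have : (4 : ℝ) ^ k = (2 ^ k) ^ 2 := by rw [← pow_mul, mul_comm, pow_mul]; norm_num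
        rw [this]
        have : ((2 : ℝ) ^ k) ^ 2 ≤ ‖ρ.1‖ ^ 2 := by gcongr
        linarith
      calc 1 / (1 + ‖ρ.1‖ ^ 2) ≤ 1 / 4 ^ k := by gcongr
        _ = _ := by rw [pow_succ, inv_pow]; field_simp
  calc ∑ ρ ∈ u, (analyticOrderNatAt f ρ : ℝ) / (1 + ‖ρ.1‖ ^ 2)
      ≤ ∑ ρ ∈ u, (analyticOrderNatAt f ρ : ℝ) * ∑' k, w ρ k := by
        refine Finset.sum_le_sum fun ρ _ => ?_
        rw [div_eq_mul_one_div]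
        gcongr
        exact hw1 ρ
    _ = ∑' k, ∑ ρ ∈ u, (analyticOrderNatAt f ρ : ℝ) * w ρ k := by
        rw [Summable.tsum_finsetSum fun ρ _ => (hws ρ).mul_left _]
        simp_rw [tsum_mul_left]
    _ ≤ _ := by
        refine Summable.tsum_le_tsum (fun k => ?_) (summable_sum fun ρ _ => (hws ρ).mul_left _) hgeo
        have h1 : ∑ ρ ∈ u, (analyticOrderNatAt f ρ : ℝ) * w ρ k =
            4 * ((4 : ℝ)⁻¹) ^ k *
              ((∑ ρ ∈ (u.filter fun ρ => ‖ρ.1‖ ≤ 2 ^ k).image Subtype.val,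
                analyticOrderNatAt f ρ : ℕ) : ℝ) := by
          rw [Finset.sum_image Subtype.val_injective.injOn, Nat.cast_sum, Finset.mul_sum,
            Finset.sum_filter]
          refine Finset.sum_congr rfl fun ρ _ => ?_
          simp only [w]
          split_ifs <;> ring
        rw [h1]
        have h2 := hcount (2 ^ k) (one_le_pow₀ one_le_two)
          ((u.filter fun ρ => ‖ρ.1‖ ≤ 2 ^ k).image Subtype.val) (by
            intro ρ hρ
            simp only [Finset.mem_image, Finset.mem_filter] at hρ
            obtain ⟨σ, ⟨-, h⟩, rfl⟩ := hρ
            exact h)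
        calc _ ≤ 4 * ((4 : ℝ)⁻¹) ^ k * (A * ((2 : ℝ) ^ k) ^ (3 / 2 : ℝ)) := by gcongr
          _ = _ := by
            have : ((2 : ℝ) ^ k) ^ (3 / 2 : ℝ) * ((4 : ℝ)⁻¹) ^ k = ((2 : ℝ) ^ (-(1 / 2) : ℝ)) ^ k := by
              rw [← Real.rpow_natCast 2 k, ← Real.rpow_mul (by norm_num), ← Real.rpow_natCast _ k,
                ← Real.rpow_natCast _ k, ← Real.rpow_mul (by norm_num),
                show (4 : ℝ)⁻¹ = 2 ^ (-2 : ℝ) by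
                  rw [Real.rpow_neg (by norm_num)]; norm_num,
                ← Real.rpow_mul (by norm_num), ← Real.rpow_add (by norm_num)]
              congr 1; ring
            rw [← this]; ring

lemma finite_zeros_norm_le {f : ℂ → ℂ} (hf : Differentiable ℂ f) (hf0 : f 0 ≠ 0) (R : ℝ) :
    {ρ : {ρ : ℂ // f ρ = 0} | ‖ρ.1‖ ≤ R}.Finite := by
  have hA : AnalyticOnNhd ℂ f Set.univ := fun z _ => hf.analyticAt z
  have h1 : (Metric.closedBall (0 : ℂ) R ∩ f ⁻¹' {0}).Finite := by
    by_contra hinf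
    obtain ⟨z, -, hz⟩ := Set.Infinite.exists_accPt_of_subset_isCompact hinf
      (isCompact_closedBall (0 : ℂ) R) Set.inter_subset_left
    have h2 := hA.eqOn_zero_of_preconnected_of_frequently_eq_zero isPreconnected_univ
      (Set.mem_univ z) (by
        refine (accPt_iff_frequently_nhdsNE.1 hz).mono fun y hy => hy.2)
    exact hf0 (h2 (Set.mem_univ 0))
  refine Set.Finite.of_finite_image (f := Subtype.val) (h1.subset ?_) Subtype.val_injective.injOn
  rintro _ ⟨ρ, hρ, rfl⟩
  exact ⟨by simpa using hρ, ρ.2⟩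

lemma logDeriv_eq_sum_add {f g : ℂ → ℂ} (hg : Differentiable ℂ g) (Z : Finset ℂ) (m : ℂ → ℕ)
    (h : ∀ z, f z = (∏ ρ ∈ Z, (z - ρ) ^ m ρ) * g z) {z : ℂ} (hz : f z ≠ 0) (hZ : ∀ ρ ∈ Z, z ≠ ρ) :
    logDeriv f z = ∑ ρ ∈ Z, (m ρ : ℂ) / (z - ρ) + logDeriv g z := by
  have e : f = fun z => (∏ ρ ∈ Z, (z - ρ) ^ m ρ) * g z := funext h
  have hgz : g z ≠ 0 := by
    intro h0; rw [h, h0, mul_zero] at hz; exact hz rfl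
  have hp : ∀ ρ ∈ Z, (z - ρ) ^ m ρ ≠ 0 := fun ρ hρ => pow_ne_zero _ (sub_ne_zero.2 (hZ ρ hρ))
  rw [e, logDeriv_mul z (Finset.prod_ne_zero_iff.2 hp) hgz (by fun_prop) (hg z),
    logDeriv_prod (f := fun ρ z => (z - ρ) ^ m ρ) hp (fun _ _ => by fun_prop)]
  congr 1
  refine Finset.sum_congr rfl fun ρ _ => ?_
  rw [logDeriv_fun_pow (by fun_prop), logDeriv_apply]
  simp [div_eq_mul_inv]

lemma summable_order_mul_sub {f : ℂ → ℂ} (hf : Differentiable ℂ f) (hf0 : f 0 ≠ 0)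
    (hs : Summable fun ρ : {ρ : ℂ // f ρ = 0} => (analyticOrderNatAt f ρ : ℝ) / (1 + ‖ρ.1‖ ^ 2))
    (z s : ℂ) (hz : f z ≠ 0) (hs' : f s ≠ 0) :
    Summable fun ρ : {ρ : ℂ // f ρ = 0} =>
      (analyticOrderNatAt f ρ : ℂ) * (1 / (z - ρ) - 1 / (s - ρ)) := by
  refine Summable.of_norm_bounded_eventually (hs.mul_left (8 * ‖s - z‖)) ?_
  have hfin := finite_zeros_norm_le hf hf0 (2 * (‖z‖ + ‖s‖) + 1)
  filter_upwards [hfin.compl_mem_cofinite] with ρ hρ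
  simp only [Set.mem_compl_iff, Set.mem_ofPred_eq, not_le] at hρ
  have hzρ : z - ρ ≠ 0 := sub_ne_zero.2 (by rintro rfl; exact hz ρ.2)
  have hsρ : s - ρ ≠ 0 := sub_ne_zero.2 (by rintro rfl; exact hs' ρ.2)
  have e : 1 / (z - ρ.1) - 1 / (s - ρ) = (s - z) / ((z - ρ) * (s - ρ)) := by
    field_simp; ring
  have h1 : ‖ρ.1‖ / 2 ≤ ‖z - ρ‖ := by
    have := norm_sub_norm_le ρ.1 z
    rw [norm_sub_rev] at this
    linarith [norm_nonneg s, norm_nonneg z]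
  have h2 : ‖ρ.1‖ / 2 ≤ ‖s - ρ‖ := by
    have := norm_sub_norm_le ρ.1 s
    rw [norm_sub_rev] at this
    linarith [norm_nonneg s, norm_nonneg z]
  have h3 : 1 ≤ ‖ρ.1‖ := by linarith [norm_nonneg s, norm_nonneg z]
  rw [e, norm_mul, norm_div, norm_mul, Complex.norm_natCast]
  have h4 : 1 / (‖z - ρ.1‖ * ‖s - ρ‖) ≤ 8 / (1 + ‖ρ.1‖ ^ 2) := by
    rw [div_le_div_iff₀ (by positivity) (by positivity)]
    nlinarith [mul_le_mul h1 h2 (by positivity) (by positivity)]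
  calc _ = (analyticOrderNatAt f ρ * ‖s - z‖) * (1 / (‖z - ρ.1‖ * ‖s - ρ‖)) := by ring
    _ ≤ (analyticOrderNatAt f ρ * ‖s - z‖) * (8 / (1 + ‖ρ.1‖ ^ 2)) := by gcongr
    _ = _ := by ring

/-- The partial fraction expansion of the logarithmic derivative (Hadamard) of an entire function
of order at most `3/2`. -/
lemma hasSum_logDeriv_sub {f : ℂ → ℂ} (hf : Differentiable ℂ f) (hf0 : f 0 ≠ 0) {C : ℝ} (hC : 0 < C)
    (hgr : ∀ z, ‖f z‖ ≤ Real.exp (C * (1 + ‖z‖) ^ (3 / 2 : ℝ))) {z s : ℂ}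
    (hz : f z ≠ 0) (hs : f s ≠ 0) :
    HasSum (fun ρ : {ρ : ℂ // f ρ = 0} =>
      (analyticOrderNatAt f ρ : ℂ) * (1 / (z - ρ) - 1 / (s - ρ))) (logDeriv f z - logDeriv f s) := by
  classical
  have hsum := summable_order_mul_sub hf hf0 (summable_order_div hf hf0 hC hgr) z s hz hs
  let Z : ℕ → Finset {ρ : ℂ // f ρ = 0} := fun n => (finite_zeros_norm_le hf hf0 n).toFinset
  have hZmem : ∀ n ρ, ρ ∈ Z n ↔ ‖ρ.1‖ ≤ n := fun n ρ => by simp [Z]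
  have hZ : Tendsto Z atTop atTop := by
    refine tendsto_atTop_finset_of_monotone (fun a b hab ρ hρ => ?_) fun ρ => ?_
    · rw [hZmem] at hρ ⊢
      exact hρ.trans (by exact_mod_cast hab)
    · obtain ⟨n, hn⟩ := exists_nat_ge ‖ρ.1‖
      exact ⟨n, (hZmem n ρ).2 hn⟩
  have hlim := hsum.hasSum.comp hZ
  suffices h : Tendsto (fun n => ∑ ρ ∈ Z n,
      (analyticOrderNatAt f ρ : ℂ) * (1 / (z - ρ) - 1 / (s - ρ))) atTop
      (nhds (logDeriv f z - logDeriv f s)) by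
    rw [tendsto_nhds_unique h hlim]
    exact hsum.hasSum
  rw [tendsto_iff_norm_sub_tendsto_zero]
  set c := |Real.log ‖f 0‖|
  have hbound : ∀ᶠ n : ℕ in atTop, ‖∑ ρ ∈ Z n,
      (analyticOrderNatAt f ρ : ℂ) * (1 / (z - ρ) - 1 / (s - ρ)) -
        (logDeriv f z - logDeriv f s)‖ ≤
        (64 * (27 * C + c) * ‖z - s‖) * (n : ℝ) ^ (-(1 / 2) : ℝ) := by
    filter_upwards [eventually_ge_atTop (max 1 ⌈8 * (‖z‖ + ‖s‖)⌉₊)] with n hn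
    have hn1 : (1 : ℝ) ≤ n := by exact_mod_cast (le_max_left _ _).trans hn
    have hn2 : 8 * (‖z‖ + ‖s‖) ≤ n :=
      (Nat.le_ceil _).trans (by exact_mod_cast (le_max_right _ _).trans hn)
    have hn0 : (0 : ℝ) < n := by linarith
    set Y : Finset ℂ := (Z n).image Subtype.val with hY
    have hYmem : ∀ ρ, ρ ∈ Y ↔ f ρ = 0 ∧ ‖ρ‖ ≤ n := by
      intro ρ
      simp [hY, hZmem, and_comm]
    obtain ⟨g, hg, hgZ, hfg⟩ := exists_eq_prod_mul hf ⟨0, hf0⟩ Y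
    have hg0 : ∀ w, ‖w‖ < n → g w ≠ 0 := by
      intro w hw h0
      have : f w = 0 := by rw [hfg, h0, mul_zero]
      exact hgZ w ((hYmem w).2 ⟨this, hw.le⟩) h0
    have hf0' : 0 < ‖f 0‖ := norm_pos_iff.2 hf0
    set M := C * (1 + 4 * n) ^ (3 / 2 : ℝ) + c with hMdef
    have hM : 0 < M := by positivity
    have hexpM : ∀ w, ‖w‖ = 4 * n → ‖f w‖ ≤ Real.exp M * ‖f 0‖ := by
      intro w hw
      refine (hgr w).trans ?_
      rw [hw, hMdef, Real.exp_add, mul_assoc]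
      refine le_mul_of_one_le_right (by positivity) ?_
      rw [← Real.exp_log hf0', ← Real.exp_add, Real.one_le_exp_iff]
      linarith [neg_abs_le (Real.log ‖f 0‖)]
    have hgb : ∀ w, ‖w‖ < n → ‖g w‖ ≤ Real.exp M * ‖g 0‖ := by
      intro w hw
      refine Complex.norm_le_of_forall_mem_frontier_norm_le (U := Metric.ball 0 (4 * n))
        Metric.isBounded_ball hg.diffContOnCl ?_ (subset_closure (by simp; linarith))
      intro u hu
      rw [frontier_ball _ (by positivity), mem_sphere_zero_iff_norm] at hu
      have h1 := hexpM u hu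
      rw [hfg u, hfg 0, norm_mul, norm_mul, norm_prod, norm_prod] at h1
      set P0 := ∏ ρ ∈ Y, ‖(0 - ρ) ^ analyticOrderNatAt f ρ‖
      set Pu := ∏ ρ ∈ Y, ‖(u - ρ) ^ analyticOrderNatAt f ρ‖
      have hP : P0 ≤ Pu := by
        refine Finset.prod_le_prod (fun _ _ => norm_nonneg _) fun ρ hρ => ?_
        rw [norm_pow, norm_pow]
        gcongr 1
        have h2 := ((hYmem ρ).1 hρ).2
        have h3 := norm_sub_norm_le u ρ
        rw [zero_sub, norm_neg]
        linarith
      have hP0 : 0 < P0 := by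
        refine Finset.prod_pos fun ρ hρ => norm_pos_iff.2 (pow_ne_zero _ ?_)
        rw [zero_sub, neg_ne_zero]
        rintro rfl
        exact hf0 ((hYmem 0).1 hρ).1
      have h4 : P0 * ‖g u‖ ≤ P0 * (Real.exp M * ‖g 0‖) :=
        (mul_le_mul_of_nonneg_right hP (norm_nonneg _)).trans (h1.trans (le_of_eq (by ring)))
      exact le_of_mul_le_mul_left h4 hP0
    have hmain := norm_logDeriv_sub_le hg hn0 hM hg0 hgb (z := z) (s := s)
      (by linarith [norm_nonneg s]) (by linarith [norm_nonneg z])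
    have hneY : ∀ w, f w ≠ 0 → ∀ ρ ∈ Y, w ≠ ρ := by
      rintro w hw ρ hρ rfl
      exact hw ((hYmem w).1 hρ).1
    have hsumY : ∑ ρ ∈ Z n, (analyticOrderNatAt f ρ : ℂ) * (1 / (z - ρ) - 1 / (s - ρ)) =
        ∑ ρ ∈ Y, (analyticOrderNatAt f ρ : ℂ) / (z - ρ) -
          ∑ ρ ∈ Y, (analyticOrderNatAt f ρ : ℂ) / (s - ρ) := by
      rw [hY, Finset.sum_image Subtype.val_injective.injOn,
        Finset.sum_image Subtype.val_injective.injOn, ← Finset.sum_sub_distrib]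
      refine Finset.sum_congr rfl fun ρ _ => by ring
    rw [hsumY, logDeriv_eq_sum_add hg Y _ hfg hz (hneY z hz),
      logDeriv_eq_sum_add hg Y _ hfg hs (hneY s hs)]
    calc _ = ‖logDeriv g z - logDeriv g s‖ := by rw [← norm_neg]; congr 1; ring
      _ ≤ 64 * M / n ^ 2 * ‖z - s‖ := hmain
      _ ≤ 64 * ((27 * C + c) * (n : ℝ) ^ (3 / 2 : ℝ)) / n ^ 2 * ‖z - s‖ := by
        gcongr
        have h1 : (1 + 4 * (n : ℝ)) ^ (3 / 2 : ℝ) ≤ 27 * (n : ℝ) ^ (3 / 2 : ℝ) := by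
          calc (1 + 4 * (n : ℝ)) ^ (3 / 2 : ℝ) ≤ (9 * n) ^ (3 / 2 : ℝ) :=
                Real.rpow_le_rpow (by positivity) (by linarith) (by norm_num)
            _ = 27 * (n : ℝ) ^ (3 / 2 : ℝ) := by
                rw [Real.mul_rpow (by norm_num) hn0.le]
                congr 1
                rw [show (9 : ℝ) = 3 ^ (2 : ℝ) by norm_num, ← Real.rpow_mul (by norm_num)]
                norm_num
        have h2 : (1 : ℝ) ≤ (n : ℝ) ^ (3 / 2 : ℝ) := Real.one_le_rpow hn1 (by norm_num)
        have h3 : 0 ≤ c := abs_nonneg _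
        rw [hMdef]
        nlinarith
      _ = _ := by
        have : (n : ℝ) ^ (3 / 2 : ℝ) / n ^ 2 = (n : ℝ) ^ (-(1 / 2) : ℝ) := by
          rw [← Real.rpow_natCast (n : ℝ) 2, ← Real.rpow_sub hn0]; norm_num
        rw [← this]; ring
  refine squeeze_zero' (Eventually.of_forall fun _ => norm_nonneg _) hbound ?_
  have := ((tendsto_rpow_neg_atTop (y := 1 / 2) (by norm_num)).comp
    tendsto_natCast_atTop_atTop).const_mul (64 * (27 * C + c) * ‖z - s‖)
  simpa using this

lemma norm_riemannZeta_two_add_ge (t : ℝ) : 1 / 4 ≤ ‖riemannZeta (2 + t * Complex.I)‖ := by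
  have hre : (2 + t * Complex.I : ℂ).re = 2 := by simp
  have hs : 1 < (2 + t * Complex.I : ℂ).re := by rw [hre]; norm_num
  have hz := zeta_eq_tsum_one_div_nat_add_one_cpow hs
  have hnorm : ∀ n : ℕ, ‖1 / ((n : ℂ) + 1) ^ (2 + t * Complex.I : ℂ)‖ = 1 / ((n : ℝ) + 1) ^ 2 := by
    intro n
    have : ((n : ℂ) + 1) = (((n : ℝ) + 1 : ℝ) : ℂ) := by push_cast; rfl
    rw [norm_div, norm_one, this, Complex.norm_cpow_eq_rpow_re_of_pos (by positivity), hre]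
    norm_num
  have hb : HasSum (fun n : ℕ => 1 / ((n : ℝ) + 1) ^ 2) (Real.pi ^ 2 / 6) := by
    have := (hasSum_nat_add_iff' (f := fun n : ℕ => 1 / (n : ℝ) ^ 2) 1).2 hasSum_zeta_two
    simpa using this
  have hsum : Summable fun n : ℕ => 1 / ((n : ℂ) + 1) ^ (2 + t * Complex.I : ℂ) :=
    Summable.of_norm (by simpa only [hnorm] using hb.summable)
  rw [hz, hsum.tsum_eq_zero_add]
  have h1 : ‖∑' n : ℕ, 1 / (((n + 1 : ℕ) : ℂ) + 1) ^ (2 + t * Complex.I : ℂ)‖ ≤ Real.pi ^ 2 / 6 - 1 := by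
    have h2 := (hasSum_nat_add_iff' (f := fun n : ℕ => 1 / ((n : ℝ) + 1) ^ 2) 1).2 hb
    refine tsum_of_norm_bounded (by simpa using h2) fun n => ?_
    rw [hnorm]; simp
  have h3 : Real.pi ^ 2 / 6 - 1 ≤ 3 / 4 := by nlinarith [Real.pi_lt_d2, Real.pi_pos]
  have h4 := norm_sub_norm_le (1 : ℂ)
    (-∑' n : ℕ, 1 / (((n + 1 : ℕ) : ℂ) + 1) ^ (2 + t * Complex.I : ℂ))
  rw [norm_neg, norm_one, sub_neg_eq_add] at h4
  simp only [Nat.cast_zero, zero_add, Complex.one_cpow, div_one]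
  linarith

/-- The number of zeros on the critical line in an interval of length one. -/
lemma exists_sum_order_Icc_le : ∃ C > 0, ∀ (t : ℝ) (u : Finset ℂ),
    (∀ ρ ∈ u, ρ.re = 1 / 2 ∧ |ρ.im - t| ≤ 1 / 2) →
    ((∑ ρ ∈ u, analyticOrderNatAt riemannZeta₁ ρ : ℕ) : ℝ) ≤ C * Real.log (|t| + 2) := by
  refine ⟨100, by norm_num, fun t u hu => ?_⟩
  set c : ℂ := 2 + t * Complex.I with hc
  have hcr : c.re = 2 := by simp [hc]
  have hci : c.im = t := by simp [hc]
  have hc1 : c - 1 ≠ 0 := by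
    intro h
    have := congrArg Complex.re h
    rw [Complex.sub_re, hcr] at this
    norm_num at this
  have hnc : 1 / 4 ≤ ‖riemannZeta₁ c‖ := by
    have h1 := riemannZeta_eq_inv_sub_mul (s := c) (sub_ne_zero.1 hc1)
    have h2 : riemannZeta₁ c = (c - 1) * riemannZeta c := by rw [h1]; field_simp
    have h3 : 1 ≤ ‖c - 1‖ := by
      have := Complex.abs_re_le_norm (c - 1)
      rw [Complex.sub_re, hcr] at this
      norm_num at this
      exact this
    rw [h2, norm_mul]
    nlinarith [norm_riemannZeta_two_add_ge t]
  have hcn : ‖c‖ ≤ 2 + |t| := by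
    refine (norm_add_le _ _).trans ?_
    simp
  have hne : riemannZeta₁ c ≠ 0 := by
    intro h; rw [h, norm_zero] at hnc; norm_num at hnc
  have h := pow_sum_order_mul_norm_le differentiable_riemannZeta₁ hne (r := 8 / 5) (R := 19 / 10)
    (by norm_num) (by norm_num) u (by
      intro ρ hρ
      obtain ⟨h1, h2⟩ := hu ρ hρ
      rw [Complex.norm_eq_sqrt_sq_add_sq]
      apply Real.sqrt_le_iff.2 ⟨by norm_num, ?_⟩
      rw [Complex.sub_re, Complex.sub_im, h1, hcr, hci]
      nlinarith [abs_le.1 h2]) (M := 21 * (5 + |t|) ^ 2) (by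
      intro z hz
      have h1 := Complex.abs_re_le_norm (z - c)
      rw [hz, Complex.sub_re, hcr] at h1
      have h2 : ‖z‖ ≤ 4 + |t| := by
        have := norm_add_le (z - c) c
        rw [sub_add_cancel, hz] at this
        linarith
      refine (norm_riemannZeta₁_le (by linarith [(abs_le.1 h1).1])).trans ?_
      have h3 : 1 + ‖z‖ ≤ 5 + |t| := by linarith
      gcongr)
  set N := ∑ ρ ∈ u, analyticOrderNatAt riemannZeta₁ ρ
  have h1 : (19 / 16 : ℝ) ^ N ≤ 84 * (5 + |t|) ^ 2 := by
    have : (19 / 10 / (8 / 5) : ℝ) = 19 / 16 := by norm_num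
    rw [this] at h
    have h2 : (19 / 16 : ℝ) ^ N * (1 / 4) ≤ 21 * (5 + |t|) ^ 2 := le_trans (by gcongr) h
    linarith
  have h2 : (84 * (5 + |t|) ^ 2 : ℝ) ≤ (|t| + 2) ^ 12 := by
    have ht := abs_nonneg t
    have e : (|t| + 2) ^ 12 = (|t| + 2) ^ 10 * (|t| + 2) ^ 2 := by ring
    have h5 : (2 : ℝ) ^ 10 ≤ (|t| + 2) ^ 10 := by gcongr; linarith
    rw [e]
    calc (84 * (5 + |t|) ^ 2 : ℝ) ≤ 84 * (5 / 2 * (|t| + 2)) ^ 2 := by gcongr; linarith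
      _ ≤ 2 ^ 10 * (|t| + 2) ^ 2 := by nlinarith [sq_nonneg (|t| + 2)]
      _ ≤ _ := by gcongr
  have h3 := Real.log_le_log (by positivity) (h1.trans h2)
  rw [Real.log_pow, Real.log_pow] at h3
  have h4 : (1 / 8 : ℝ) ≤ Real.log (19 / 16) := by
    have := Real.one_sub_inv_le_log_of_pos (x := 19 / 16) (by norm_num)
    norm_num at this ⊢
    linarith
  have h5 : (0 : ℝ) ≤ N := by positivity
  push_cast at h3
  nlinarith

lemma exists_sum_order_rpow_le : ∃ C > 0, ∀ (t : ℝ) (u : Finset ℂ),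
    (∀ ρ ∈ u, ρ.re = 1 / 2) →
    ∑ ρ ∈ u, (analyticOrderNatAt riemannZeta₁ ρ : ℝ) * (1 + |t - ρ.im|) ^ (-(5 / 4) : ℝ)
      ≤ C * Real.log (|t| + 2) := by
  classical
  obtain ⟨C, hC, hcount⟩ := exists_sum_order_Icc_le
  have hsummable : Summable fun k : ℤ => (1 + |(k : ℝ)|) ^ (-(9 / 8) : ℝ) := by
    have h := (Real.summable_one_div_int_add_rpow (1 / 2) (9 / 8)).2 (by norm_num)
    refine Summable.of_nonneg_of_le (fun k => by positivity) (fun k => ?_) h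
    rw [Real.rpow_neg (by positivity), ← one_div]
    have hk : (0 : ℝ) < |(k : ℝ) + 1 / 2| := by
      rw [abs_pos]
      intro h0
      have : (2 * k + 1 : ℝ) = 0 := by linarith
      have : (2 * k + 1 : ℤ) = 0 := by exact_mod_cast this
      omega
    refine one_div_le_one_div_of_le (Real.rpow_pos_of_pos hk _)
      (Real.rpow_le_rpow hk.le ?_ (by norm_num))
    refine (abs_add_le _ _).trans ?_
    rw [abs_of_pos (by norm_num : (0 : ℝ) < 1 / 2)]
    linarith
  set A := ∑' k : ℤ, (1 + |(k : ℝ)|) ^ (-(9 / 8) : ℝ)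
  have hA : 0 ≤ A := tsum_nonneg fun k => by positivity
  refine ⟨C * 60 * (A + 1), by positivity, fun t u hu => ?_⟩
  have hlog : 1 / 2 ≤ Real.log (|t| + 2) := by
    have := Real.log_le_log (by norm_num) (by linarith [abs_nonneg t] : (2 : ℝ) ≤ |t| + 2)
    linarith [Real.log_two_gt_d9]
  let κ : ℂ → ℤ := fun ρ => round (ρ.im - t)
  have hκ : ∀ ρ, |ρ.im - (t + κ ρ)| ≤ 1 / 2 := fun ρ => by
    have := abs_sub_round (ρ.im - t)
    rwa [sub_sub] at this
  rw [← Finset.sum_fiberwise_of_maps_to (g := κ) (t := u.image κ)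
    (fun ρ hρ => Finset.mem_image_of_mem _ hρ)]
  have hfib : ∀ k ∈ u.image κ, ∑ ρ ∈ u with κ ρ = k,
      (analyticOrderNatAt riemannZeta₁ ρ : ℝ) * (1 + |t - ρ.im|) ^ (-(5 / 4) : ℝ) ≤
      C * 60 * Real.log (|t| + 2) * (1 + |(k : ℝ)|) ^ (-(9 / 8) : ℝ) := by
    intro k _
    have h1 := hcount (t + k) (u.filter fun ρ => κ ρ = k) (by
      intro ρ hρ
      rw [Finset.mem_filter] at hρ
      refine ⟨hu ρ hρ.1, ?_⟩
      have := hκ ρ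
      rwa [hρ.2] at this)
    have hk0 : 0 ≤ |(k : ℝ)| := abs_nonneg _
    have h2 : ∀ ρ ∈ u.filter (fun ρ => κ ρ = k),
        (analyticOrderNatAt riemannZeta₁ ρ : ℝ) * (1 + |t - ρ.im|) ^ (-(5 / 4) : ℝ) ≤
        (analyticOrderNatAt riemannZeta₁ ρ : ℝ) * (3 * (1 + |(k : ℝ)|) ^ (-(5 / 4) : ℝ)) := by
      intro ρ hρ
      rw [Finset.mem_filter] at hρ
      gcongr
      have h3 := hκ ρ
      rw [hρ.2] at h3
      have h4 : (1 + |(k : ℝ)|) / 2 ≤ 1 + |t - ρ.im| := by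
        have : |(k : ℝ)| ≤ |ρ.im - (t + k)| + |t - ρ.im| := by
          have := abs_add_le (ρ.im - (t + k)) (t - ρ.im)
          rw [show ρ.im - (t + k) + (t - ρ.im) = -(k : ℝ) by ring, abs_neg] at this
          exact this
        linarith
      calc (1 + |t - ρ.im|) ^ (-(5 / 4) : ℝ) ≤ ((1 + |(k : ℝ)|) / 2) ^ (-(5 / 4) : ℝ) :=
            Real.rpow_le_rpow_of_nonpos (by positivity) h4 (by norm_num)
        _ = 2 ^ (5 / 4 : ℝ) * (1 + |(k : ℝ)|) ^ (-(5 / 4) : ℝ) := by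
            rw [Real.div_rpow (by positivity) (by norm_num), Real.rpow_neg (by norm_num : (0:ℝ) ≤ 2)]
            rw [div_inv_eq_mul, mul_comm]
        _ ≤ 3 * (1 + |(k : ℝ)|) ^ (-(5 / 4) : ℝ) := by
            gcongr
            rw [show (5 / 4 : ℝ) = (1 / 4) * (5 : ℕ) by norm_num, Real.rpow_mul (by norm_num),
              Real.rpow_natCast]
            have : (2 : ℝ) ^ (1 / 4 : ℝ) ≤ 6 / 5 := by
              rw [show (6 / 5 : ℝ) = ((6 / 5) ^ (4 : ℝ)) ^ (1 / 4 : ℝ) by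
                rw [← Real.rpow_mul (by norm_num)]; norm_num]
              exact Real.rpow_le_rpow (by norm_num) (by norm_num) (by norm_num)
            calc ((2 : ℝ) ^ (1 / 4 : ℝ)) ^ 5 ≤ (6 / 5) ^ 5 := by gcongr
              _ ≤ 3 := by norm_num
    refine (Finset.sum_le_sum h2).trans ?_
    rw [← Finset.sum_mul, ← Nat.cast_sum]
    have h5 : Real.log (|t + k| + 2) ≤ 20 * Real.log (|t| + 2) * (1 + |(k : ℝ)|) ^ (1 / 8 : ℝ) := by
      have h6 : |t + k| + 2 ≤ (|t| + 2) * (1 + |(k : ℝ)|) := by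
        have := abs_add_le t k
        nlinarith [abs_nonneg t]
      have h7 := Real.log_le_log (by positivity) h6
      rw [Real.log_mul (by positivity) (by positivity)] at h7
      have h8 := Real.log_le_rpow_div (x := 1 + |(k : ℝ)|) (ε := 1 / 8) (by positivity) (by norm_num)
      have h9 : (1 : ℝ) ≤ (1 + |(k : ℝ)|) ^ (1 / 8 : ℝ) :=
        Real.one_le_rpow (by linarith) (by norm_num)
      nlinarith
    calc _ ≤ (C * (20 * Real.log (|t| + 2) * (1 + |(k : ℝ)|) ^ (1 / 8 : ℝ))) *
          (3 * (1 + |(k : ℝ)|) ^ (-(5 / 4) : ℝ)) := by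
          gcongr
          exact h1.trans (by gcongr)
      _ = C * 60 * Real.log (|t| + 2) *
          ((1 + |(k : ℝ)|) ^ (1 / 8 : ℝ) * (1 + |(k : ℝ)|) ^ (-(5 / 4) : ℝ)) := by ring
      _ = _ := by
          rw [← Real.rpow_add (by positivity)]; norm_num
  refine (Finset.sum_le_sum hfib).trans ?_
  rw [← Finset.mul_sum]
  have h6 : ∑ k ∈ u.image κ, (1 + |(k : ℝ)|) ^ (-(9 / 8) : ℝ) ≤ A :=
    hsummable.sum_le_tsum _ fun k _ => by positivity
  have : 0 ≤ C * 60 * Real.log (|t| + 2) := by positivity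
  nlinarith

/-- Continuous functions supported on `[0, ∞)` and bounded by `K * exp y`. -/
structure IsExpBounded (K : ℝ) (f : ℝ → ℂ) : Prop where
  cont : Continuous f
  zero : ∀ y ≤ 0, f y = 0
  bound : ∀ y, ‖f y‖ ≤ K * Real.exp y

/-- The Laplace transform on the half line. -/
noncomputable def laplace (f : ℝ → ℂ) (z : ℂ) : ℂ := ∫ y in Set.Ioi (0 : ℝ), Complex.exp (-z * y) * f y

namespace IsExpBounded

variable {K K' : ℝ} {f g : ℝ → ℂ}

lemma norm_exp_mul_le (hf : IsExpBounded K f) {z : ℂ} (hz : z.re = 2) (y : ℝ) :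
    ‖Complex.exp (-z * y) * f y‖ ≤ K * Real.exp (-y) := by
  rw [norm_mul, Complex.norm_exp]
  have h1 : (-z * y).re = -y - y := by simp [hz]; ring
  rw [h1]
  calc Real.exp (-y - y) * ‖f y‖ ≤ Real.exp (-y - y) * (K * Real.exp y) := by
        gcongr; exact hf.bound y
    _ = K * (Real.exp (-y - y) * Real.exp y) := by ring
    _ = K * Real.exp (-y) := by rw [← Real.exp_add]; ring_nf

lemma integrableOn (hf : IsExpBounded K f) {z : ℂ} (hz : z.re = 2) :
    IntegrableOn (fun y : ℝ => Complex.exp (-z * y) * f y) (Set.Ioi 0) := by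
  refine Integrable.mono' ((integrableOn_exp_neg_Ioi 0).const_mul K) ?_ ?_
  · have := hf.cont
    exact Continuous.aestronglyMeasurable (by fun_prop)
  · exact Eventually.of_forall fun y => hf.norm_exp_mul_le hz y

lemma add (hf : IsExpBounded K f) (hg : IsExpBounded K' g) :
    IsExpBounded (K + K') (fun y => f y + g y) where
  cont := hf.cont.add hg.cont
  zero y hy := by simp [hf.zero y hy, hg.zero y hy]
  bound y := by
    rw [add_mul]
    exact (norm_add_le _ _).trans (add_le_add (hf.bound y) (hg.bound y))

lemma const_mul (hf : IsExpBounded K f) (c : ℂ) : IsExpBounded (‖c‖ * K) (fun y => c * f y) where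
  cont := hf.cont.const_mul c
  zero y hy := by simp [hf.zero y hy]
  bound y := by
    rw [norm_mul, mul_assoc]
    gcongr
    exact hf.bound y

lemma laplace_add (hf : IsExpBounded K f) (hg : IsExpBounded K' g) {z : ℂ} (hz : z.re = 2) :
    laplace (fun y => f y + g y) z = laplace f z + laplace g z := by
  rw [laplace, laplace, laplace, ← integral_add (hf.integrableOn hz) (hg.integrableOn hz)]
  simp only [mul_add]

lemma summable {ι : Type*} {K : ι → ℝ} {f : ι → ℝ → ℂ} (hf : ∀ i, IsExpBounded (K i) (f i))
    (hK : Summable K) (y : ℝ) : Summable fun i => f i y :=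
  Summable.of_norm_bounded (hK.mul_right (Real.exp y)) fun i => (hf i).bound y

lemma tsum {ι : Type*} {K : ι → ℝ} {f : ι → ℝ → ℂ} (hf : ∀ i, IsExpBounded (K i) (f i))
    (hK : Summable K) : IsExpBounded (∑' i, K i) (fun y => ∑' i, f i y) where
  cont := by
    have h : Continuous fun y : ℝ => ∑' i, Complex.exp (-y) * f i y := by
      refine continuous_tsum (fun i => ?_) hK fun i y => ?_
      · have := (hf i).cont
        fun_prop
      · rw [norm_mul, Complex.norm_exp]
        simp only [Complex.neg_re, Complex.ofReal_re]
        calc Real.exp (-y) * ‖f i y‖ ≤ Real.exp (-y) * (K i * Real.exp y) := by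
              gcongr; exact (hf i).bound y
          _ = K i * (Real.exp (-y) * Real.exp y) := by ring
          _ = K i := by rw [← Real.exp_add]; simp
    have h2 : (fun y => ∑' i, f i y) = fun y : ℝ => Complex.exp y * ∑' i, Complex.exp (-y) * f i y := by
      ext y
      rw [tsum_mul_left, ← mul_assoc, ← Complex.exp_add]
      simp
    rw [h2]
    fun_prop
  zero y hy := by simp [fun i => (hf i).zero y hy]
  bound y := by
    rw [← tsum_mul_right]
    exact tsum_of_norm_bounded (hK.mul_right _).hasSum fun i => (hf i).bound y

lemma hasSum_laplace {ι : Type*} [Countable ι] {K : ι → ℝ} {f : ι → ℝ → ℂ}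
    (hf : ∀ i, IsExpBounded (K i) (f i)) (hK : Summable K) {z : ℂ} (hz : z.re = 2) :
    HasSum (fun i => laplace (f i) z) (laplace (fun y => ∑' i, f i y) z) := by
  have h := hasSum_integral_of_summable_integral_norm
    (μ := volume.restrict (Set.Ioi (0 : ℝ))) (F := fun i (y : ℝ) => Complex.exp (-z * y) * f i y)
    (fun i => (hf i).integrableOn hz) ?_
  · simp only [tsum_mul_left] at h
    exact h
  · refine Summable.of_nonneg_of_le (fun i => integral_nonneg fun y => norm_nonneg _) (fun i => ?_) hK
    calc ∫ y in Set.Ioi (0 : ℝ), ‖Complex.exp (-z * y) * f i y‖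
        ≤ ∫ y in Set.Ioi (0 : ℝ), K i * Real.exp (-y) :=
          integral_mono ((hf i).integrableOn hz).norm ((integrableOn_exp_neg_Ioi 0).const_mul _)
            fun y => (hf i).norm_exp_mul_le hz y
      _ = K i := by rw [integral_const_mul, integral_exp_neg_Ioi_zero, mul_one]

open scoped FourierTransform in
lemma eq_zero_of_laplace (hf : IsExpBounded K f) (h : ∀ z : ℂ, z.re = 2 → laplace f z = 0)
    (y : ℝ) : f y = 0 := by
  set G : ℝ → ℂ := fun y => Complex.exp (-2 * y) * f y with hG
  have hcont : Continuous G := by have := hf.cont; fun_prop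
  have hsupp : ∀ z : ℂ, ∫ y : ℝ, Complex.exp (-z * y) * f y = laplace f z := by
    intro z
    rw [laplace, ← integral_indicator measurableSet_Ioi]
    congr 1
    ext y
    by_cases hy : y ∈ Set.Ioi (0 : ℝ)
    · rw [Set.indicator_of_mem hy]
    · rw [Set.indicator_of_notMem hy, hf.zero y (by simpa using hy), mul_zero]
  have h_int : Integrable G := by
    rw [← integrableOn_univ, ← Set.Iic_union_Ioi (a := (0 : ℝ))]
    refine IntegrableOn.union ?_ (by simpa [hG] using hf.integrableOn (z := 2) (by simp))
    refine (integrableOn_zero).congr_fun (fun y hy => ?_) measurableSet_Iic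
    simp [hG, hf.zero y hy]
  have hF : 𝓕 G = 0 := by
    ext v
    rw [Real.fourier_real_eq_integral_exp_smul]
    have := hsupp (2 + 2 * Real.pi * v * Complex.I)
    rw [h _ (by simp)] at this
    rw [Pi.zero_apply, ← this]
    congr 1
    ext y
    rw [smul_eq_mul, hG, ← mul_assoc, ← Complex.exp_add]
    congr 2
    push_cast
    ring
  have hinv := hcont.fourierInv_fourier_eq h_int (by rw [hF]; exact integrable_zero _ _ _)
  have h0 : G y = 0 := by
    rw [← hinv, hF, Real.fourierInv_eq]
    simp
  simpa [hG] using h0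

end IsExpBounded

lemma integral_exp_neg_mul_Ioi {z : ℂ} (hz : 0 < z.re) (c : ℝ) :
    ∫ y in Set.Ioi c, Complex.exp (-z * y) = Complex.exp (-z * c) / z := by
  rw [integral_exp_mul_complex_Ioi (by simpa using hz)]
  rw [neg_div_neg_eq]

lemma integrableOn_exp_neg_mul_Ioi {z : ℂ} (hz : 0 < z.re) (c : ℝ) :
    IntegrableOn (fun y : ℝ => Complex.exp (-z * y)) (Set.Ioi c) :=
  integrableOn_exp_mul_complex_Ioi (by simpa using hz) c

lemma isExpBounded_max_sub {l : ℝ} (hl : 0 ≤ l) :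
    IsExpBounded (Real.exp (-l)) (fun y => ((max (y - l) 0 : ℝ) : ℂ)) where
  cont := by fun_prop
  zero y hy := by rw [max_eq_right (by linarith)]; simp
  bound y := by
    rw [Complex.norm_real, Real.norm_of_nonneg (le_max_right _ _), ← Real.exp_add, neg_add_eq_sub]
    exact max_le (by linarith [Real.add_one_le_exp (y - l)]) (Real.exp_pos _).le

lemma laplace_max_sub {l : ℝ} (hl : 0 ≤ l) {z : ℂ} (hz : z.re = 2) :
    laplace (fun y => ((max (y - l) 0 : ℝ) : ℂ)) z = Complex.exp (-l * z) / z ^ 2 := by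
  have h1 : laplace (fun y => ((max (y - l) 0 : ℝ) : ℂ)) z
      = ∫ y in Set.Ioi l, Complex.exp (-z * y) * (y - l : ℝ) := by
    rw [laplace]
    rw [← Set.Ioc_union_Ioi_eq_Ioi hl, setIntegral_union (Set.Ioc_disjoint_Ioi le_rfl) measurableSet_Ioi]
    · rw [setIntegral_eq_zero_of_forall_eq_zero, zero_add]
      · refine setIntegral_congr_fun measurableSet_Ioi fun y hy => ?_
        rw [max_eq_left (by linarith [Set.mem_Ioi.1 hy])]
      · intro y hy
        rw [max_eq_right (by linarith [hy.2])]
        simp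
    · exact ((isExpBounded_max_sub hl).integrableOn hz).mono_set Set.Ioc_subset_Ioi_self
    · exact ((isExpBounded_max_sub hl).integrableOn hz).mono_set (Set.Ioi_subset_Ioi hl)
  rw [h1]
  have hz0 : z ≠ 0 := by rintro rfl; simp at hz
  have h_int : IntegrableOn (fun y : ℝ => Complex.exp (-z * y) * (y - l : ℝ)) (Set.Ioi l) := by
    refine (((isExpBounded_max_sub hl).integrableOn hz).mono_set (Set.Ioi_subset_Ioi hl)).congr_fun
      (fun y hy => ?_) measurableSet_Ioi
    simp only
    rw [max_eq_left (by linarith [Set.mem_Ioi.1 hy])]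
  have hder : ∀ y ∈ Set.Ici l, HasDerivAt (fun y : ℝ => Complex.exp (-z * y) * (-(y - l : ℝ) / z - 1 / z ^ 2))
      (Complex.exp (-z * y) * (y - l : ℝ)) y := by
    intro y _
    have h1 : HasDerivAt (fun y : ℝ => Complex.exp (-z * y)) (Complex.exp (-z * y) * (-z * 1)) y :=
      ((Complex.ofRealCLM.hasDerivAt (x := y)).const_mul (-z)).cexp
    have h2 : HasDerivAt (fun y : ℝ => -((y - l : ℝ) : ℂ) / z - 1 / z ^ 2) (-1 / z) y := by
      have := ((((hasDerivAt_id y).sub_const l).ofReal_comp).neg.div_const z).sub_const (1 / z ^ 2)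
      simpa using this
    refine (h1.mul h2).congr_deriv ?_
    field_simp
    ring
  have hlim : Tendsto (fun y : ℝ => Complex.exp (-z * y) * (-(y - l : ℝ) / z - 1 / z ^ 2)) atTop (nhds 0) := by
    have h3 : Tendsto (fun y : ℝ => (1 / ‖z‖ + 1 / ‖z‖ ^ 2) * Real.exp (-y)) atTop (nhds 0) := by
      have := (Real.tendsto_exp_neg_atTop_nhds_zero).const_mul (1 / ‖z‖ + 1 / ‖z‖ ^ 2)
      rwa [mul_zero] at this
    refine squeeze_zero_norm' ?_ h3
    filter_upwards [eventually_ge_atTop l, eventually_ge_atTop 0] with y hy hy0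
    have hz1 : 0 < ‖z‖ := norm_pos_iff.2 hz0
    rw [norm_mul, Complex.norm_exp]
    have h4 : (-z * y).re = -y - y := by simp [hz]; ring
    have h5 : ‖-((y - l : ℝ) : ℂ) / z - 1 / z ^ 2‖ ≤ Real.exp y * (1 / ‖z‖ + 1 / ‖z‖ ^ 2) := by
      refine (norm_sub_le _ _).trans ?_
      rw [norm_div, norm_neg, Complex.norm_real, Real.norm_of_nonneg (by linarith), norm_div, norm_one,
        norm_pow, mul_add]
      refine add_le_add ?_ ?_
      · rw [div_eq_mul_one_div]
        gcongr
        linarith [Real.add_one_le_exp y]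
      · exact le_mul_of_one_le_left (by positivity) (Real.one_le_exp hy0)
    rw [h4]
    calc Real.exp (-y - y) * ‖-((y - l : ℝ) : ℂ) / z - 1 / z ^ 2‖
        ≤ Real.exp (-y - y) * (Real.exp y * (1 / ‖z‖ + 1 / ‖z‖ ^ 2)) := by gcongr
      _ = (1 / ‖z‖ + 1 / ‖z‖ ^ 2) * (Real.exp (-y - y) * Real.exp y) := by ring
      _ = _ := by rw [← Real.exp_add]; ring_nf
  rw [integral_Ioi_of_hasDerivAt_of_tendsto' hder h_int hlim]
  simp only [sub_self, Complex.ofReal_zero]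
  rw [show -z * (l : ℂ) = -l * z by ring]
  field_simp
  ring

lemma isExpBounded_one_sub_exp {w : ℂ} (hw : -1 ≤ w.re) :
    IsExpBounded 2 (fun y => 1 - Complex.exp (-w * (max y 0 : ℝ))) where
  cont := by fun_prop
  zero y hy := by rw [max_eq_right hy]; simp
  bound y := by
    rcases le_total y 0 with hy | hy
    · rw [max_eq_right hy]; simp; positivity
    · rw [max_eq_left hy]
      refine (norm_sub_le _ _).trans ?_
      rw [norm_one, Complex.norm_exp]
      have : (-w * y).re ≤ y := by simp; nlinarith
      have := Real.exp_le_exp.2 this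
      have := Real.one_le_exp hy
      linarith

lemma laplace_one_sub_exp {w : ℂ} (hw : -1 ≤ w.re) {z : ℂ} (hz : z.re = 2) :
    laplace (fun y => 1 - Complex.exp (-w * (max y 0 : ℝ))) z = w / (z * (z + w)) := by
  have h1 : (z + w).re > 0 := by simp [hz]; linarith
  have h2 : z.re > 0 := by rw [hz]; norm_num
  have hz0 : z ≠ 0 := by rintro rfl; simp at h2
  have hw0 : z + w ≠ 0 := by intro h; rw [h] at h1; simp at h1
  calc laplace (fun y => 1 - Complex.exp (-w * (max y 0 : ℝ))) z
      = ∫ y in Set.Ioi (0 : ℝ), (Complex.exp (-z * y) - Complex.exp (-(z + w) * y)) := by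
        refine setIntegral_congr_fun measurableSet_Ioi fun y hy => ?_
        simp only
        rw [max_eq_left (le_of_lt hy), mul_sub, mul_one, ← Complex.exp_add]
        ring_nf
    _ = 1 / z - 1 / (z + w) := by
        rw [integral_sub (integrableOn_exp_neg_mul_Ioi h2 0) (integrableOn_exp_neg_mul_Ioi h1 0),
          integral_exp_neg_mul_Ioi h2, integral_exp_neg_mul_Ioi h1]
        simp
    _ = _ := by field_simp; ring

/-- A Selberg-type identity: two functions with equal Laplace transforms agree. -/
lemma tsum_mul_max_sub_eq {ι : Type*} [Countable ι] {b : ℕ → ℂ} {l : ℕ → ℝ} (hl : ∀ n, 0 ≤ l n)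
    (hb : Summable fun n => ‖b n‖ * Real.exp (-l n)) {w : ι → ℂ} (hw : ∀ i, 0 < (w i).re)
    {m : ι → ℝ} (hm0 : ∀ i, 0 ≤ m i) (hm : Summable fun i => m i / ‖w i‖ ^ 2) {c h : ℂ} (hc : c ≠ 0)
    (hc1 : -1 ≤ c.re)
    (hlap : ∀ z : ℂ, z.re = 2 → ∑' n, b n * Complex.exp (-l n * z) =
      1 / (z + c) - h + ∑' i, m i * (z / (w i * (w i + z)))) {y : ℝ} (hy : 0 ≤ y) :
    ∑' n, b n * (max (y - l n) 0 : ℝ) = y / c - (1 - Complex.exp (-c * y)) / c ^ 2 - h * y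
      + ∑' i, m i / w i ^ 2 * (1 - Complex.exp (-w i * y)) := by
  have hA (n : ℕ) := (isExpBounded_max_sub (hl n)).const_mul (b n)
  have hB (i : ι) := (isExpBounded_one_sub_exp (w := w i) (by linarith [hw i])).const_mul (m i / w i ^ 2)
  have hBK : Summable fun i => ‖(m i / w i ^ 2 : ℂ)‖ * 2 := by
    refine (hm.mul_right 2).congr fun i => ?_
    rw [norm_div, norm_pow, Complex.norm_real, Real.norm_of_nonneg (hm0 i)]
  have hC := (isExpBounded_max_sub le_rfl).const_mul (1 / c - h)
  have hE := (isExpBounded_one_sub_exp hc1).const_mul (-1 / c ^ 2)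
  have hBs := IsExpBounded.tsum hB hBK
  have hAs := IsExpBounded.tsum hA hb
  have hR := (hC.add hE).add hBs
  have hD := hAs.add (hR.const_mul (-1))
  have key := hD.eq_zero_of_laplace (fun z hz => ?_) y
  · simp only [max_eq_left hy, sub_zero] at key
    rw [← sub_eq_zero]
    rw [← key]
    ring
  · have hz0 : z ≠ 0 := by rintro rfl; simp at hz
    have hmul : ∀ (c : ℂ) (f : ℝ → ℂ), laplace (fun y => c * f y) z = c * laplace f z := by
      intro c f
      rw [laplace, laplace, ← integral_const_mul]
      congr 1; ext y; ring
    have hzc : z + c ≠ 0 := by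
      intro h0
      have : (z + c).re = 0 := by rw [h0]; simp
      simp [hz] at this
      linarith
    rw [hAs.laplace_add (hR.const_mul (-1)) hz, hmul, (hC.add hE).laplace_add hBs hz,
      hC.laplace_add hE hz, hmul, hmul, ← (IsExpBounded.hasSum_laplace hA hb hz).tsum_eq,
      ← (IsExpBounded.hasSum_laplace hB hBK hz).tsum_eq, laplace_max_sub le_rfl hz,
      laplace_one_sub_exp hc1 hz]
    have e1 : ∑' n, laplace (fun y => b n * (max (y - l n) 0 : ℝ)) z
        = (∑' n, b n * Complex.exp (-l n * z)) / z ^ 2 := by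
      rw [← tsum_div_const]
      congr 1; ext n
      rw [hmul, laplace_max_sub (hl n) hz, mul_div_assoc]
    have e2 : ∑' i, laplace (fun y => m i / w i ^ 2 * (1 - Complex.exp (-w i * (max y 0 : ℝ)))) z
        = (∑' i, m i * (z / (w i * (w i + z)))) / z ^ 2 := by
      rw [← tsum_div_const]
      congr 1; ext i
      rw [hmul, laplace_one_sub_exp (by linarith [hw i]) hz]
      have h1 : w i ≠ 0 := by intro h0; have := hw i; rw [h0] at this; simp at this
      have h2 : w i + z ≠ 0 := by
        intro h0
        have : (w i + z).re = 0 := by rw [h0]; simp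
        simp [hz] at this
        linarith [hw i]
      rw [add_comm z]
      field_simp
    rw [e1, e2, hlap z hz]
    simp
    field_simp
    ring

lemma riemannZeta₁_eq_mul {s : ℂ} (hs : s ≠ 1) : riemannZeta₁ s = (s - 1) * riemannZeta s := by
  rw [riemannZeta_eq_inv_sub_mul hs, ← mul_assoc, mul_inv_cancel₀ (sub_ne_zero.2 hs), one_mul]

lemma riemannZeta₁_zero_ne_zero : riemannZeta₁ 0 ≠ 0 := by
  rw [riemannZeta₁_eq_mul zero_ne_one, riemannZeta_zero]
  norm_num

lemma riemannZeta₁_eq_zero_iff {s : ℂ} : riemannZeta₁ s = 0 ↔ s ≠ 1 ∧ riemannZeta s = 0 := by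
  by_cases hs : s = 1
  · simp [hs, riemannZeta₁_one]
  · simp [riemannZeta₁_eq_mul hs, sub_eq_zero, hs]

instance : Countable {ρ : ℂ // riemannZeta₁ ρ = 0} := by
  have h : (Set.univ : Set {ρ : ℂ // riemannZeta₁ ρ = 0}) =
      ⋃ n : ℕ, {ρ : {ρ : ℂ // riemannZeta₁ ρ = 0} | ‖ρ.1‖ ≤ n} := by
    ext ρ
    simpa using exists_nat_ge ‖ρ.1‖
  rw [← Set.countable_univ_iff, h]
  exact Set.countable_iUnion fun n =>
    (finite_zeros_norm_le differentiable_riemannZeta₁ riemannZeta₁_zero_ne_zero n).countable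

lemma RiemannHypothesis.re_eq_or (hRH : RiemannHypothesis) {ρ : ℂ} (h : riemannZeta₁ ρ = 0) :
    ρ.re = 1 / 2 ∨ ρ.re ≤ -2 ∧ ρ.im = 0 := by
  obtain ⟨h1, h0⟩ := riemannZeta₁_eq_zero_iff.1 h
  by_cases ht : ∃ n : ℕ, ρ = -2 * (n + 1)
  · right
    obtain ⟨n, rfl⟩ := ht
    have : (-2 * ((n : ℂ) + 1)) = ((-2 * ((n : ℝ) + 1) : ℝ) : ℂ) := by push_cast; rfl
    rw [this, Complex.ofReal_re, Complex.ofReal_im]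
    exact ⟨by nlinarith [n.cast_nonneg (α := ℝ)], rfl⟩
  · exact Or.inl (hRH ρ h0 ht h1)

lemma logDeriv_riemannZeta₁ {s : ℂ} (hs : 1 < s.re) :
    logDeriv riemannZeta₁ s = 1 / (s - 1) - LSeries (fun n => (ArithmeticFunction.vonMangoldt n : ℂ)) s := by
  have h1 : s ≠ 1 := by rintro rfl; simp at hs
  have hz : riemannZeta s ≠ 0 := riemannZeta_ne_zero_of_one_le_re hs.le
  have e : riemannZeta₁ =ᶠ[nhds s] fun z => (z - 1) * riemannZeta z := by
    filter_upwards [isOpen_ne.mem_nhds h1] with z hz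
    exact riemannZeta₁_eq_mul hz
  rw [ArithmeticFunction.LSeries_vonMangoldt_eq_deriv_riemannZeta_div hs, logDeriv_apply, e.deriv_eq, e.eq_of_nhds]
  have hd := ((hasDerivAt_id s).sub_const 1).mul (differentiableAt_riemannZeta h1).hasDerivAt
  have : deriv (fun z => (z - 1) * riemannZeta z) s = riemannZeta s + (s - 1) * deriv riemannZeta s := by
    rw [← one_mul (riemannZeta s)]
    exact hd.deriv
  rw [this]
  have := sub_ne_zero.2 h1
  field_simp
  ring

lemma term_vonMangoldt_eq (s : ℂ) (n : ℕ) : LSeries.term (fun n => (ArithmeticFunction.vonMangoldt n : ℂ)) s n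
    = ArithmeticFunction.vonMangoldt n * Complex.exp (-Real.log n * s) := by
  rcases eq_or_ne n 0 with rfl | hn
  · simp
  · rw [LSeries.term_of_ne_zero hn, Complex.cpow_def_of_ne_zero (by exact_mod_cast hn), div_eq_mul_inv, ← Complex.exp_neg,
      Complex.natCast_log]
    simp

lemma norm_logDeriv_riemannZeta₁_three_half_le : ∃ C > 0, ∀ t : ℝ,
    ‖logDeriv riemannZeta₁ (3 / 2 + t * Complex.I)‖ ≤ C := by
  have hs0 : LSeriesSummable (fun n => (ArithmeticFunction.vonMangoldt n : ℂ)) ((3 / 2 : ℝ) : ℂ) :=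
    ArithmeticFunction.LSeriesSummable_vonMangoldt (by simp; norm_num)
  have hs1 := hs0.norm
  refine ⟨2 + ∑' n, ‖LSeries.term (fun n => (ArithmeticFunction.vonMangoldt n : ℂ)) ((3 / 2 : ℝ) : ℂ) n‖,
    by positivity, fun t => ?_⟩
  have hre : (3 / 2 + t * Complex.I : ℂ).re = 3 / 2 := by simp
  rw [logDeriv_riemannZeta₁ (by rw [hre]; norm_num)]
  refine (norm_sub_le _ _).trans (add_le_add ?_ ?_)
  · rw [norm_div, norm_one, div_le_iff₀]
    · have := Complex.abs_re_le_norm (3 / 2 + t * Complex.I - 1 : ℂ)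
      rw [Complex.sub_re, hre] at this
      norm_num at this ⊢
      linarith
    · rw [norm_pos_iff]
      intro h
      have := congrArg Complex.re h
      rw [Complex.sub_re, hre] at this
      norm_num at this
  · refine tsum_of_norm_bounded hs1.hasSum fun n => ?_
    rw [LSeries.norm_term_eq, LSeries.norm_term_eq, hre, Complex.ofReal_re]

/-- The weighted sum over all zeros of zeta at height `t`, at distance `a` from the critical line. -/
noncomputable def zetaZeroSum (a t : ℝ) : ℝ := ∑' ρ : {ρ : ℂ // riemannZeta₁ ρ = 0},
  (analyticOrderNatAt riemannZeta₁ ρ : ℝ) * (a / ‖(1 / 2 + a + t * Complex.I : ℂ) - ρ‖ ^ 2)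

section

variable {a : ℝ} {ρ : ℂ} (t : ℝ)

lemma re_sub_zero_ge (hRH : RiemannHypothesis) (h : riemannZeta₁ ρ = 0) :
    a ≤ ((1 / 2 + a + t * Complex.I : ℂ) - ρ).re := by
  have : ((1 / 2 + a + t * Complex.I : ℂ) - ρ).re = 1 / 2 + a - ρ.re := by simp
  rw [this]
  rcases hRH.re_eq_or h with h | h <;> linarith

lemma norm_sub_zero_pos (hRH : RiemannHypothesis) (ha : 0 < a) (h : riemannZeta₁ ρ = 0) :
    0 < ‖(1 / 2 + a + t * Complex.I : ℂ) - ρ‖ :=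
  ha.trans_le ((re_sub_zero_ge t hRH h).trans (Complex.re_le_norm _))

lemma summable_zetaZeroSum (hRH : RiemannHypothesis) (ha : 0 < a) :
    Summable fun ρ : {ρ : ℂ // riemannZeta₁ ρ = 0} =>
      (analyticOrderNatAt riemannZeta₁ ρ : ℝ) / ‖(1 / 2 + a + t * Complex.I : ℂ) - ρ‖ ^ 2 := by
  obtain ⟨C, hC, hgr⟩ := riemannZeta₁_growth
  have h := summable_order_div differentiable_riemannZeta₁ riemannZeta₁_zero_ne_zero hC hgr
  set s : ℂ := 1 / 2 + a + t * Complex.I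
  set K : ℝ := 2 + (1 + 2 * ‖s‖ ^ 2) / a ^ 2 with hK
  refine Summable.of_nonneg_of_le (fun ρ => by positivity) (fun ρ => ?_) (h.mul_left K)
  have hd := norm_sub_zero_pos t hRH ha ρ.2
  have hda : a ≤ ‖s - ρ‖ := (re_sub_zero_ge t hRH ρ.2).trans (Complex.re_le_norm _)
  rw [← mul_div_assoc, div_le_div_iff₀ (by positivity) (by positivity)]
  have h1 : 1 + ‖ρ.1‖ ^ 2 ≤ K * ‖s - ρ‖ ^ 2 := by
    have h2 : ‖ρ.1‖ ≤ ‖s - ρ‖ + ‖s‖ := by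
      rw [norm_sub_rev]
      simpa using norm_add_le (ρ.1 - s) s
    have h3 : 1 + 2 * ‖s‖ ^ 2 ≤ (1 + 2 * ‖s‖ ^ 2) / a ^ 2 * ‖s - ρ‖ ^ 2 := by
      rw [div_mul_eq_mul_div, le_div_iff₀ (by positivity)]
      gcongr
    have h4 : ‖ρ.1‖ ^ 2 ≤ 2 * ‖s - ρ‖ ^ 2 + 2 * ‖s‖ ^ 2 := by
      nlinarith [sq_nonneg (‖s - ρ‖ - ‖s‖), norm_nonneg ρ.1]
    rw [hK, add_mul]
    linarith
  calc _ ≤ (analyticOrderNatAt riemannZeta₁ ρ : ℝ) * (K * ‖s - ρ‖ ^ 2) := by gcongr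
    _ = _ := by ring

lemma riemannZeta₁_ne_zero_of_half_lt (hRH : RiemannHypothesis) {s : ℂ} (hs : 1 / 2 < s.re) :
    riemannZeta₁ s ≠ 0 := by
  intro h
  rcases hRH.re_eq_or h with h | h <;> linarith

lemma hasSum_zeta_logDeriv_sub (hRH : RiemannHypothesis) {z s : ℂ} (hz : 1 / 2 < z.re) (hs : 1 / 2 < s.re) :
    HasSum (fun ρ : {ρ : ℂ // riemannZeta₁ ρ = 0} => (analyticOrderNatAt riemannZeta₁ ρ : ℂ) *
      (1 / (z - ρ) - 1 / (s - ρ))) (logDeriv riemannZeta₁ z - logDeriv riemannZeta₁ s) := by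
  obtain ⟨C, hC, hgr⟩ := riemannZeta₁_growth
  exact hasSum_logDeriv_sub differentiable_riemannZeta₁ riemannZeta₁_zero_ne_zero hC hgr
    (riemannZeta₁_ne_zero_of_half_lt hRH hz) (riemannZeta₁_ne_zero_of_half_lt hRH hs)

lemma zeta_selberg_identity (hRH : RiemannHypothesis) (ha : 0 < a) (ha1 : a < 1 / 4) {y : ℝ} (hy : 0 ≤ y) :
    letI s : ℂ := 1 / 2 + a + t * Complex.I
    ∑' n : ℕ, (ArithmeticFunction.vonMangoldt n * Complex.exp (-Real.log n * s)) * (max (y - Real.log n) 0 : ℝ) =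
      y / (s - 1) - (1 - Complex.exp (-(s - 1) * y)) / (s - 1) ^ 2 - logDeriv riemannZeta₁ s * y
      + ∑' ρ : {ρ : ℂ // riemannZeta₁ ρ = 0}, (analyticOrderNatAt riemannZeta₁ ρ : ℝ) / (s - ρ) ^ 2 *
        (1 - Complex.exp (-(s - ρ) * y)) := by
  set s : ℂ := 1 / 2 + a + t * Complex.I with hs
  have hsre : s.re = 1 / 2 + a := by simp [hs]
  have hw (ρ : {ρ : ℂ // riemannZeta₁ ρ = 0}) : 0 < (s - ρ).re :=
    ha.trans_le (re_sub_zero_ge t hRH ρ.2)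
  refine tsum_mul_max_sub_eq (fun n => Real.log_natCast_nonneg n) ?_ hw (fun ρ => by positivity)
    (summable_zetaZeroSum t hRH ha) ?_ ?_ ?_ hy
  · have h0 : LSeriesSummable (fun n => (ArithmeticFunction.vonMangoldt n : ℂ)) (s + 1) :=
      ArithmeticFunction.LSeriesSummable_vonMangoldt (by simp [hsre]; linarith)
    refine h0.norm.congr fun n => ?_
    rw [term_vonMangoldt_eq, mul_add, Complex.exp_add, ← mul_assoc, norm_mul _ (Complex.exp (_ * 1))]
    congr 1
    rw [Complex.norm_exp, mul_one, ← Complex.ofReal_neg, Complex.ofReal_re]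
  · intro h
    have := congrArg Complex.re h
    simp [hsre] at this
    linarith
  · simp [hsre]
    linarith
  · intro z hz
    have hre : 1 < (s + z).re := by simp [hsre, hz]; linarith
    have h1 := hasSum_zeta_logDeriv_sub hRH (z := s + z) (s := s) (by linarith) (by rw [hsre]; linarith)
    have h2 := logDeriv_riemannZeta₁ hre
    have h3 : ∑' n : ℕ, ArithmeticFunction.vonMangoldt n * Complex.exp (-Real.log n * s) *
        Complex.exp (-Real.log n * z) = LSeries (fun n => (ArithmeticFunction.vonMangoldt n : ℂ)) (s + z) := by
      refine tsum_congr fun n => ?_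
      rw [term_vonMangoldt_eq, mul_assoc, ← Complex.exp_add, ← mul_add]
    have h4 : ∑' ρ : {ρ : ℂ // riemannZeta₁ ρ = 0}, ((analyticOrderNatAt riemannZeta₁ ρ : ℝ) : ℂ) *
        (z / ((s - ρ) * (s - ρ + z))) = -(logDeriv riemannZeta₁ (s + z) - logDeriv riemannZeta₁ s) := by
      rw [← h1.neg.tsum_eq]
      refine tsum_congr fun ρ => ?_
      have h5 : s - ρ ≠ 0 := fun h => by have := hw ρ; rw [h] at this; simp at this
      have h6 : s - ρ + z ≠ 0 := by
        intro h
        have := congrArg Complex.re h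
        rw [Complex.add_re, hz] at this
        have := hw ρ
        simp at *
        linarith
      rw [show s + z - ρ = s - ρ + z by ring]
      field_simp
      push_cast
      ring
    rw [h3, h4, h2]
    rw [show s + z - 1 = z + (s - 1) by ring]
    ring

end

lemma exists_tsum_critical_le : ∃ C > 0, ∀ t : ℝ,
    (Summable fun ρ : {ρ : ℂ // riemannZeta₁ ρ = 0} => (analyticOrderNatAt riemannZeta₁ ρ : ℝ) *
      (if ρ.1.re = 1 / 2 then (1 + |t - ρ.1.im|) ^ (-(5 / 4) : ℝ) else 0)) ∧
    ∑' ρ : {ρ : ℂ // riemannZeta₁ ρ = 0}, (analyticOrderNatAt riemannZeta₁ ρ : ℝ) *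
      (if ρ.1.re = 1 / 2 then (1 + |t - ρ.1.im|) ^ (-(5 / 4) : ℝ) else 0) ≤ C * Real.log (|t| + 2) := by
  obtain ⟨C, hC, h⟩ := exists_sum_order_rpow_le
  have key (t : ℝ) (u : Finset {ρ : ℂ // riemannZeta₁ ρ = 0}) :
      ∑ ρ ∈ u, (analyticOrderNatAt riemannZeta₁ ρ : ℝ) *
      (if ρ.1.re = 1 / 2 then (1 + |t - ρ.1.im|) ^ (-(5 / 4) : ℝ) else 0) ≤ C * Real.log (|t| + 2) := by
    have := h t ((u.filter fun ρ => ρ.1.re = 1 / 2).map (Function.Embedding.subtype _)) (by simp +contextual)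
    rw [Finset.sum_map, Finset.sum_filter] at this
    refine le_trans (le_of_eq (Finset.sum_congr rfl fun ρ _ => ?_)) this
    simp
  have hn (t : ℝ) (ρ : {ρ : ℂ // riemannZeta₁ ρ = 0}) : 0 ≤ (analyticOrderNatAt riemannZeta₁ ρ : ℝ) *
      (if ρ.1.re = 1 / 2 then (1 + |t - ρ.1.im|) ^ (-(5 / 4) : ℝ) else 0) := by
    split_ifs <;> positivity
  refine ⟨C, hC, fun t => ?_⟩
  have hs := summable_of_sum_le (hn t) (key t)
  exact ⟨hs, hs.tsum_le_of_sum_le (key t)⟩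

lemma re_inv_sub_inv_ge (hRH : RiemannHypothesis) {a : ℝ} (ha : 0 < a) (ha1 : a < 1 / 4) (t : ℝ) {ρ : ℂ}
    (h : riemannZeta₁ ρ = 0) :
    a / ‖(1 / 2 + a + t * Complex.I : ℂ) - ρ‖ ^ 2 - (2 * (if ρ.re = 1 / 2 then (1 + |t - ρ.im|) ^ (-(5 / 4) : ℝ) else 0)
      + 4 / (1 + ‖ρ‖ ^ 2)) ≤
      (1 / ((1 / 2 + a + t * Complex.I : ℂ) - ρ) - 1 / ((3 / 2 + t * Complex.I : ℂ) - ρ)).re := by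
  have hpos := norm_sub_zero_pos t hRH ha h
  set w : ℂ := (1 / 2 + a + t * Complex.I : ℂ) - ρ with hw
  set w' : ℂ := (3 / 2 + t * Complex.I : ℂ) - ρ with hw'
  have hwre : w.re = 1 / 2 + a - ρ.re := by simp [hw]
  have hwre' : w'.re = 3 / 2 - ρ.re := by simp [hw']
  have hwim : w.im = t - ρ.im := by simp [hw]
  have hwim' : w'.im = t - ρ.im := by simp [hw']
  rcases hRH.re_eq_or h with h1 | ⟨h1, h2⟩
  · rw [if_pos h1]
    have e1 : (1 / w).re = a / ‖w‖ ^ 2 := by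
      rw [one_div, Complex.inv_re, hwre, h1, Complex.normSq_eq_norm_sq]; ring
    have e2 : (1 / w').re = 1 / (1 + (t - ρ.im) ^ 2) := by
      rw [one_div, Complex.inv_re, hwre', h1, Complex.normSq_apply, hwre', hwim', h1]; ring
    rw [Complex.sub_re, e1, e2]
    have h3 : 1 / (1 + (t - ρ.im) ^ 2) ≤ 2 * (1 + |t - ρ.im|) ^ (-(5 / 4) : ℝ) := by
      rw [Real.rpow_neg (by positivity), ← div_eq_mul_inv, div_le_div_iff₀ (by positivity) (by positivity), one_mul]
      calc (1 + |t - ρ.im|) ^ (5 / 4 : ℝ) ≤ (1 + |t - ρ.im|) ^ (2 : ℝ) := by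
            apply Real.rpow_le_rpow_of_exponent_le _ (by norm_num)
            linarith [abs_nonneg (t - ρ.im)]
        _ = (1 + |t - ρ.im|) ^ 2 := by norm_cast
        _ ≤ 2 * (1 + (t - ρ.im) ^ 2) := by
            rw [← sq_abs (t - ρ.im)]
            nlinarith [sq_nonneg (1 - |t - ρ.im|)]
    have : 0 ≤ 4 / (1 + ‖ρ‖ ^ 2) := by positivity
    linarith
  · rw [if_neg (by linarith)]
    have hρ : ‖ρ‖ = -ρ.re := by
      have : ρ = (ρ.re : ℂ) := Complex.ext rfl (by simp [h2])
      rw [this, Complex.norm_real, Real.norm_of_nonpos (by linarith)]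
      simp
    have n1 : ‖ρ‖ ≤ ‖w‖ := le_trans (by rw [hwre, hρ]; linarith) (Complex.re_le_norm w)
    have n2 : ‖ρ‖ ≤ ‖w'‖ := le_trans (by rw [hwre', hρ]; linarith) (Complex.re_le_norm w')
    have n3 : 2 ≤ ‖ρ‖ := by linarith
    have n4 : 0 < ‖w'‖ := by linarith
    have e : 1 / w - 1 / w' = ((1 - a : ℝ) : ℂ) / (w * w') := by
      have i1 := norm_pos_iff.1 hpos
      have i2 := norm_pos_iff.1 n4
      field_simp
      rw [hw, hw']
      push_cast
      ring
    have b1 : ‖1 / w - 1 / w'‖ ≤ 1 / ‖ρ‖ ^ 2 := by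
      rw [e, norm_div, norm_mul, Complex.norm_real, Real.norm_of_nonneg (by linarith), sq]
      gcongr
      linarith
    have b2 : a / ‖w‖ ^ 2 ≤ 1 / ‖ρ‖ ^ 2 := by
      gcongr
      linarith
    have b3 : 1 / ‖ρ‖ ^ 2 ≤ 2 / (1 + ‖ρ‖ ^ 2) := by
      rw [div_le_div_iff₀ (by positivity) (by positivity)]
      nlinarith
    have b4 := (abs_le.1 ((Complex.abs_re_le_norm _).trans b1)).1
    rw [show 4 / (1 + ‖ρ‖ ^ 2) = 2 / (1 + ‖ρ‖ ^ 2) + 2 / (1 + ‖ρ‖ ^ 2) by ring]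
    linarith

lemma zetaZeroSum_le_re_logDeriv (hRH : RiemannHypothesis) : ∃ C > 0, ∀ a : ℝ, 0 < a → a < 1 / 4 → ∀ t : ℝ,
    zetaZeroSum a t ≤ (logDeriv riemannZeta₁ (1 / 2 + a + t * Complex.I)).re + C * Real.log (|t| + 2) := by
  obtain ⟨C, hC, hgr⟩ := riemannZeta₁_growth
  have hs := summable_order_div differentiable_riemannZeta₁ riemannZeta₁_zero_ne_zero hC hgr
  obtain ⟨C1, hC1, h1⟩ := exists_tsum_critical_le
  obtain ⟨C2, hC2, h2⟩ := norm_logDeriv_riemannZeta₁_three_half_le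
  set S := ∑' ρ : {ρ : ℂ // riemannZeta₁ ρ = 0}, (analyticOrderNatAt riemannZeta₁ ρ : ℝ) / (1 + ‖ρ.1‖ ^ 2) with hS
  have hS0 : 0 ≤ S := tsum_nonneg fun ρ => by positivity
  refine ⟨2 * C1 + (4 * S + C2) / Real.log 2, by positivity, fun a ha ha1 t => ?_⟩
  have hh := hasSum_zeta_logDeriv_sub hRH (z := 1 / 2 + a + t * Complex.I) (s := 3 / 2 + t * Complex.I)
    (by simp; linarith) (by simp; norm_num)
  have hre := Complex.hasSum_re hh
  have hF := summable_zetaZeroSum t hRH ha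
  have hF' : HasSum (fun ρ : {ρ : ℂ // riemannZeta₁ ρ = 0} => (analyticOrderNatAt riemannZeta₁ ρ : ℝ) *
      (a / ‖(1 / 2 + a + t * Complex.I : ℂ) - ρ‖ ^ 2)) (zetaZeroSum a t) :=
    Summable.hasSum ((hF.mul_left a).congr fun ρ => by ring)
  have hlow := hasSum_le (fun ρ => ?_) (hF'.sub (((h1 t).1.hasSum.mul_left 2).add (hs.hasSum.mul_left 4))) hre
  · rw [Complex.sub_re] at hlow
    have h3 := (abs_le.1 ((Complex.abs_re_le_norm _).trans (h2 t))).1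
    have h4 : 4 * S + C2 ≤ (4 * S + C2) / Real.log 2 * Real.log (|t| + 2) := by
      rw [div_mul_eq_mul_div, le_div_iff₀ (Real.log_pos one_lt_two)]
      gcongr
      linarith [abs_nonneg t]
    have h5 := (h1 t).2
    rw [← hS] at hlow
    rw [add_mul]
    linarith
  · have := re_inv_sub_inv_ge hRH ha ha1 t ρ.2
    have h6 := mul_le_mul_of_nonneg_left this (Nat.cast_nonneg (α := ℝ) (analyticOrderNatAt riemannZeta₁ ρ))
    rw [← Complex.ofReal_natCast, Complex.re_ofReal_mul]
    refine le_trans (le_of_eq ?_) h6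
    ring

/-- The coefficients of the Dirichlet polynomial majorizing `zetaZeroSum`. -/
noncomputable def selbergCoeff (Y : ℝ) (n : ℕ) : ℝ :=
  ArithmeticFunction.vonMangoldt n * Real.exp (-Real.log n * (1 / 2 + Y⁻¹)) *
    ((max (2 * Y - Real.log n) 0 - max (Y - Real.log n) 0) / Y)

lemma abs_selbergCoeff_le {Y : ℝ} (hY : 0 < Y) (n : ℕ) :
    |selbergCoeff Y n| ≤ ArithmeticFunction.vonMangoldt n * Real.exp (-Real.log n * (1 / 2)) := by
  have hl := Real.log_natCast_nonneg n
  have h0 := ArithmeticFunction.vonMangoldt_nonneg (n := n)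
  have h1 : |(max (2 * Y - Real.log n) 0 - max (Y - Real.log n) 0) / Y| ≤ 1 := by
    rw [abs_div, abs_of_pos hY, div_le_one hY]
    refine (abs_max_sub_max_le_abs _ _ _).trans ?_
    rw [show 2 * Y - Real.log n - (Y - Real.log n) = Y by ring, abs_of_pos hY]
  rw [selbergCoeff, abs_mul, abs_mul, abs_of_nonneg h0, abs_of_pos (Real.exp_pos _)]
  calc _ ≤ ArithmeticFunction.vonMangoldt n * Real.exp (-Real.log n * (1 / 2 + Y⁻¹)) * 1 := by gcongr
    _ ≤ _ := by
      rw [mul_one]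
      have : 0 < Y⁻¹ := by positivity
      refine mul_le_mul_of_nonneg_left (Real.exp_le_exp.2 ?_) h0
      nlinarith

lemma tsum_selberg_eq {Y : ℝ} (hY : 0 < Y) (t : ℝ)
    (hs : ∀ y, Summable fun n : ℕ => (ArithmeticFunction.vonMangoldt n * Complex.exp (-Real.log n * (1 / 2 + (Y⁻¹ : ℝ) + t * Complex.I))) *
        (max (y - Real.log n) 0 : ℝ)) :
    ((∑' n : ℕ, (ArithmeticFunction.vonMangoldt n * Complex.exp (-Real.log n * (1 / 2 + (Y⁻¹ : ℝ) + t * Complex.I))) *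
        (max (2 * Y - Real.log n) 0 : ℝ)) -
      ∑' n : ℕ, (ArithmeticFunction.vonMangoldt n * Complex.exp (-Real.log n * (1 / 2 + (Y⁻¹ : ℝ) + t * Complex.I))) *
        (max (Y - Real.log n) 0 : ℝ)) = Y * ∑ n ∈ range (⌊Real.exp (2 * Y)⌋₊ + 1),
      (selbergCoeff Y n : ℂ) * Complex.exp (-(Real.log n * t : ℝ) * Complex.I) := by
  rw [← (hs _).tsum_sub (hs _), tsum_eq_sum (s := range (⌊Real.exp (2 * Y)⌋₊ + 1)), Finset.mul_sum]
  · refine Finset.sum_congr rfl fun n _ => ?_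
    have e : Complex.exp (-Real.log n * (1 / 2 + (Y⁻¹ : ℝ) + t * Complex.I)) =
        (Real.exp (-Real.log n * (1 / 2 + Y⁻¹)) : ℂ) * Complex.exp (-(Real.log n * t : ℝ) * Complex.I) := by
      rw [Complex.ofReal_exp, ← Complex.exp_add]
      congr 1
      push_cast
      ring
    rw [e, selbergCoeff]
    have : (Y : ℂ) ≠ 0 := by exact_mod_cast hY.ne'
    push_cast
    field_simp
  · intro n hn
    have h1 : ⌊Real.exp (2 * Y)⌋₊ < n := by simpa [Nat.add_one_le_iff] using hn
    have h2 := (Nat.floor_lt (Real.exp_pos _).le).1 h1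
    have h3 : 2 * Y ≤ Real.log n := (Real.le_log_iff_exp_le ((Real.exp_pos _).trans h2)).2 h2.le
    rw [max_eq_right (by linarith), max_eq_right (by linarith)]
    simp

lemma zetaZeroSum_le (hRH : RiemannHypothesis) : ∃ C > 0, ∀ Y : ℝ, 5 ≤ Y → ∀ t : ℝ,
    zetaZeroSum Y⁻¹ t ≤ C * (‖∑ n ∈ range (⌊Real.exp (2 * Y)⌋₊ + 1),
      (selbergCoeff Y n : ℂ) * Complex.exp (-(Real.log n * t : ℝ) * Complex.I)‖ +
      Real.exp Y / (1 + t ^ 2) + Real.log (|t| + 2)) := by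
  obtain ⟨C1, hC1, h1⟩ := zetaZeroSum_le_re_logDeriv hRH
  refine ⟨5 / 2 * (33 + 4 / Real.log 2 + C1), by positivity, fun Y hY t => ?_⟩
  have hY0 : 0 < Y := by linarith
  set a := Y⁻¹ with ha
  have ha0 : 0 < a := by positivity
  have ha1 : a < 1 / 4 := by rw [ha, inv_lt_comm₀ hY0 (by norm_num)]; linarith
  have haY : a * Y = 1 := inv_mul_cancel₀ hY0.ne'
  have h2 := h1 a ha0 ha1 t
  set P := ∑ n ∈ range (⌊Real.exp (2 * Y)⌋₊ + 1),
      (selbergCoeff Y n : ℂ) * Complex.exp (-(Real.log n * t : ℝ) * Complex.I) with hP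
  have hI := zeta_selberg_identity t hRH ha0 ha1 (y := 2 * Y) (by positivity)
  have hI' := zeta_selberg_identity t hRH ha0 ha1 (y := Y) (by positivity)
  have hsum (y : ℝ) : Summable fun n : ℕ => (ArithmeticFunction.vonMangoldt n * Complex.exp (-Real.log n * (1 / 2 + a + t * Complex.I))) *
        (max (y - Real.log n) 0 : ℝ) := by
    refine summable_of_hasFiniteSupport ((Finset.range (⌊Real.exp y⌋₊ + 1)).finite_toSet.subset ?_)
    intro n hn
    by_contra hc
    apply hn
    have h1 : ⌊Real.exp y⌋₊ < n := by simpa [Nat.add_one_le_iff] using hc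
    have h2 := (Nat.floor_lt (Real.exp_pos _).le).1 h1
    have h3 : y ≤ Real.log n := (Real.le_log_iff_exp_le ((Real.exp_pos _).trans h2)).2 h2.le
    simp only
    rw [max_eq_right (by linarith)]
    simp
  have hD := tsum_selberg_eq hY0 t hsum
  rw [← hP] at hD
  rw [hI, hI'] at hD
  have hF := summable_zetaZeroSum t hRH ha0
  set s : ℂ := 1 / 2 + a + t * Complex.I with hs
  set m : {ρ : ℂ // riemannZeta₁ ρ = 0} → ℝ := fun ρ => (analyticOrderNatAt riemannZeta₁ ρ : ℝ) with hm
  have hw (ρ : {ρ : ℂ // riemannZeta₁ ρ = 0}) : a ≤ (s - ρ).re := re_sub_zero_ge t hRH ρ.2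
  have hexp (k : ℝ) (hk : 0 ≤ k) (ρ : {ρ : ℂ // riemannZeta₁ ρ = 0}) :
      ‖Complex.exp (-(s - ρ) * (k * Y : ℝ))‖ ≤ Real.exp (-k) := by
    rw [Complex.norm_exp]
    apply Real.exp_le_exp.2
    have : (-(s - ρ) * (k * Y : ℝ)).re = -((s - ρ).re * (k * Y)) := by
      rw [neg_mul, Complex.neg_re, Complex.re_mul_ofReal]
    rw [this, neg_le_neg_iff]
    calc k = a * (k * Y) := by rw [mul_left_comm, haY, mul_one]
      _ ≤ _ := by gcongr; exact hw ρ
  have hZsum (k : ℝ) (hk : 0 ≤ k) : Summable fun ρ : {ρ : ℂ // riemannZeta₁ ρ = 0} =>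
      (m ρ : ℂ) / (s - ρ) ^ 2 * (1 - Complex.exp (-(s - ρ) * (k * Y : ℝ))) := by
    refine Summable.of_norm_bounded (hF.mul_right 2) fun ρ => ?_
    rw [norm_mul, norm_div, norm_pow, Complex.norm_real, Real.norm_of_nonneg (by positivity)]
    gcongr
    refine (norm_sub_le _ _).trans ?_
    have := hexp k hk ρ
    have := Real.exp_le_one_iff.2 (neg_nonpos.2 hk)
    rw [norm_one]
    linarith
  have hdiff : ‖(∑' ρ, (m ρ : ℂ) / (s - ρ) ^ 2 * (1 - Complex.exp (-(s - ρ) * (2 * Y : ℝ)))) -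
      ∑' ρ, (m ρ : ℂ) / (s - ρ) ^ 2 * (1 - Complex.exp (-(s - ρ) * (Y : ℝ)))‖ ≤ 3 / 5 * (Y * zetaZeroSum a t) := by
    have hZ1 := hZsum 1 zero_le_one
    rw [one_mul] at hZ1
    rw [← (hZsum 2 zero_le_two).tsum_sub hZ1]
    have hZ : HasSum (fun ρ => 3 / 5 * (m ρ / ‖s - ρ‖ ^ 2)) (3 / 5 * (Y * zetaZeroSum a t)) := by
      have : zetaZeroSum a t = a * ∑' ρ, m ρ / ‖s - ρ‖ ^ 2 := by
        rw [zetaZeroSum, ← tsum_mul_left]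
        exact tsum_congr fun ρ => by ring
      rw [this, ← mul_assoc Y, mul_comm Y, haY, one_mul]
      exact hF.hasSum.mul_left _
    refine tsum_of_norm_bounded hZ fun ρ => ?_
    rw [← mul_sub, norm_mul, norm_div, norm_pow, Complex.norm_real, Real.norm_of_nonneg (by positivity), mul_comm]
    gcongr
    have e1 := hexp 1 zero_le_one ρ
    rw [one_mul] at e1
    have e2 := hexp 2 zero_le_two ρ
    have e3 : Real.exp (-1) ≤ 2 / 5 := by
      rw [Real.exp_neg, inv_le_comm₀ (Real.exp_pos _) (by norm_num)]
      linarith [Real.exp_one_gt_d9]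
    have e4 : Real.exp (-2) ≤ 4 / 25 := by
      rw [show (-2 : ℝ) = -1 + -1 by norm_num, Real.exp_add]
      nlinarith [Real.exp_pos (-1)]
    rw [sub_sub_sub_cancel_left]
    refine (norm_sub_le _ _).trans ?_
    linarith
  have hc : 1 / 16 * (1 + t ^ 2) ≤ ‖s - 1‖ ^ 2 := by
    rw [← Complex.normSq_eq_norm_sq, Complex.normSq_apply]
    have r1 : (s - 1).re = a - 1 / 2 := by simp [hs]; ring
    have r2 : (s - 1).im = t := by simp [hs]
    rw [r1, r2]
    nlinarith [sq_nonneg t]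
  have hc2 : 1 / 4 ≤ ‖s - 1‖ := by
    nlinarith [norm_nonneg (s - 1), sq_nonneg t]
  have hc0 : 0 < ‖s - 1‖ := by linarith
  have hec (y : ℝ) (hy : 0 ≤ y) (hy2 : y ≤ 2 * Y) : ‖Complex.exp (-(s - 1) * y)‖ ≤ Real.exp Y := by
    rw [Complex.norm_exp]
    apply Real.exp_le_exp.2
    have r : (-(s - 1)).re = 1 / 2 - a := by simp [hs]; ring
    rw [Complex.re_mul_ofReal, r]
    nlinarith
  have hpole : ‖(Complex.exp (-(s - 1) * (2 * Y : ℝ)) - Complex.exp (-(s - 1) * Y)) / (s - 1) ^ 2‖ ≤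
      32 * (Real.exp Y / (1 + t ^ 2)) := by
    rw [norm_div, norm_pow, ← mul_div_assoc, div_le_div_iff₀ (by positivity) (by positivity)]
    have e1 := hec Y hY0.le (by linarith)
    have e2 := hec (2 * Y) (by linarith) le_rfl
    have e3 := (norm_sub_le (Complex.exp (-(s - 1) * (2 * Y : ℝ))) (Complex.exp (-(s - 1) * Y))).trans (add_le_add e2 e1)
    calc _ ≤ (Real.exp Y + Real.exp Y) * (1 + t ^ 2) := by gcongr
      _ = 32 * Real.exp Y * (1 / 16 * (1 + t ^ 2)) := by ring
      _ ≤ _ := by gcongr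
  have hH : (Y : ℂ) * logDeriv riemannZeta₁ s = Y / (s - 1)
      + (Complex.exp (-(s - 1) * (2 * Y : ℝ)) - Complex.exp (-(s - 1) * Y)) / (s - 1) ^ 2
      + ((∑' ρ, (m ρ : ℂ) / (s - ρ) ^ 2 * (1 - Complex.exp (-(s - ρ) * (2 * Y : ℝ)))) -
        ∑' ρ, (m ρ : ℂ) / (s - ρ) ^ 2 * (1 - Complex.exp (-(s - ρ) * (Y : ℝ)))) - Y * P := by
    rw [← hD]
    simp only [hm]
    push_cast
    ring
  have hn : ‖(Y : ℂ) * logDeriv riemannZeta₁ s‖ ≤ Y * 4 + 32 * (Real.exp Y / (1 + t ^ 2)) +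
      3 / 5 * (Y * zetaZeroSum a t) + Y * ‖P‖ := by
    rw [hH]
    refine (norm_sub_le _ _).trans (add_le_add ((norm_add_le _ _).trans (add_le_add
      ((norm_add_le _ _).trans (add_le_add ?_ hpole)) hdiff)) ?_)
    · rw [norm_div, Complex.norm_real, Real.norm_of_nonneg hY0.le, div_le_iff₀ hc0]
      nlinarith
    · rw [norm_mul, Complex.norm_real, Real.norm_of_nonneg hY0.le]
  have hre : Y * (logDeriv riemannZeta₁ s).re ≤ ‖(Y : ℂ) * logDeriv riemannZeta₁ s‖ := by
    rw [← Complex.re_ofReal_mul]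
    exact Complex.re_le_norm _
  set E := Real.exp Y / (1 + t ^ 2) with hE
  have hE0 : 0 ≤ E := by positivity
  have h7 : (logDeriv riemannZeta₁ s).re ≤ 4 + 32 * E + 3 / 5 * zetaZeroSum a t + ‖P‖ := by
    refine le_of_mul_le_mul_left (hre.trans (hn.trans ?_)) hY0
    nlinarith
  have h8 : 4 ≤ 4 / Real.log 2 * Real.log (|t| + 2) := by
    rw [div_mul_eq_mul_div, le_div_iff₀ (Real.log_pos one_lt_two)]
    gcongr
    linarith [abs_nonneg t]
  have h9 : 0 ≤ Real.log (|t| + 2) := Real.log_nonneg (by linarith [abs_nonneg t])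
  have h10 : 0 ≤ ‖P‖ := norm_nonneg P
  have h11 : 0 < 4 / Real.log 2 := by positivity
  have h12 : zetaZeroSum a t ≤ 5 / 2 * (32 * E + ‖P‖ + (4 / Real.log 2 + C1) * Real.log (|t| + 2)) := by linarith
  refine h12.trans ?_
  rw [mul_assoc]
  gcongr
  have p1 := mul_nonneg h11.le hE0
  have p2 := mul_nonneg h11.le h10
  have p3 := mul_nonneg hC1.le hE0
  have p4 := mul_nonneg hC1.le h10
  linarith

lemma sum_vonMangoldt_div_le (N : ℕ) :
    ∑ n ∈ Ioc 0 N, ArithmeticFunction.vonMangoldt n / n ≤ 2 * Real.log N := by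
  rcases Nat.eq_zero_or_pos N with rfl | hN
  · simp
  have h := ArithmeticFunction.sum_Ioc_mul_zeta_eq_sum ArithmeticFunction.vonMangoldt N
  rw [ArithmeticFunction.vonMangoldt_mul_zeta] at h
  have h1 : ∑ n ∈ Ioc 0 N, ArithmeticFunction.log n ≤ N * Real.log N := by
    calc ∑ n ∈ Ioc 0 N, ArithmeticFunction.log n ≤ ∑ n ∈ Ioc 0 N, Real.log N := by
          refine Finset.sum_le_sum fun n hn => ?_
          rw [ArithmeticFunction.log_apply]
          exact Real.log_le_log (by exact_mod_cast (Finset.mem_Ioc.1 hn).1) (by exact_mod_cast (Finset.mem_Ioc.1 hn).2)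
      _ = _ := by simp
  have h2 : ∑ n ∈ Ioc 0 N, ArithmeticFunction.vonMangoldt n * (N / (2 * n)) ≤ N * Real.log N := by
    refine le_trans ?_ h1
    rw [h]
    refine Finset.sum_le_sum fun n hn => ?_
    obtain ⟨hn0, hnN⟩ := Finset.mem_Ioc.1 hn
    refine mul_le_mul_of_nonneg_left ?_ ArithmeticFunction.vonMangoldt_nonneg
    have h3 : 1 ≤ N / n := (Nat.one_le_div_iff hn0).2 hnN
    have h4 : N < (N / n + 1) * n := by rw [mul_comm]; exact Nat.lt_mul_div_succ N hn0
    have h5 : (N : ℝ) < ((N / n : ℕ) + 1) * n := by exact_mod_cast h4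
    have h6 : (1 : ℝ) ≤ (N / n : ℕ) := by exact_mod_cast h3
    have h7 : (0 : ℝ) < n := by exact_mod_cast hn0
    rw [div_le_iff₀ (by positivity)]
    nlinarith
  have hN' : (0 : ℝ) < N := by exact_mod_cast hN
  have h8 : ∑ n ∈ Ioc 0 N, ArithmeticFunction.vonMangoldt n * (N / (2 * n)) =
      N / 2 * ∑ n ∈ Ioc 0 N, ArithmeticFunction.vonMangoldt n / n := by
    rw [Finset.mul_sum]
    refine Finset.sum_congr rfl fun n hn => ?_
    have : (n : ℝ) ≠ 0 := by exact_mod_cast (Finset.mem_Ioc.1 hn).1.ne'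
    field_simp
  rw [h8] at h2
  refine le_of_mul_le_mul_left (h2.trans (le_of_eq ?_)) (half_pos hN')
  ring

lemma sum_selbergCoeff_sq_le {Y : ℝ} (hY : 0 < Y) (N : ℕ) :
    ∑ n ∈ range (N + 1), selbergCoeff Y n ^ 2 ≤ 2 * Real.log N ^ 2 := by
  rcases Nat.eq_zero_or_pos N with rfl | hN
  · simp [selbergCoeff]
  have h0 : ∑ n ∈ range (N + 1), selbergCoeff Y n ^ 2 = ∑ n ∈ Ioc 0 N, selbergCoeff Y n ^ 2 := by
    symm
    apply Finset.sum_subset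
    · intro n hn
      rw [Finset.mem_range]
      exact Nat.lt_succ_of_le (Finset.mem_Ioc.1 hn).2
    · intro n hn hn'
      have : n = 0 := by
        by_contra h
        exact hn' (Finset.mem_Ioc.2 ⟨Nat.pos_of_ne_zero h, Nat.lt_succ_iff.1 (Finset.mem_range.1 hn)⟩)
      simp [this, selbergCoeff]
  rw [h0]
  calc ∑ n ∈ Ioc 0 N, selbergCoeff Y n ^ 2
      ≤ ∑ n ∈ Ioc 0 N, Real.log N * (ArithmeticFunction.vonMangoldt n / n) := by
        refine Finset.sum_le_sum fun n hn => ?_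
        obtain ⟨hn0, hnN⟩ := Finset.mem_Ioc.1 hn
        have hn0' : (0 : ℝ) < n := by exact_mod_cast hn0
        have h1 := abs_selbergCoeff_le hY n
        have hv := ArithmeticFunction.vonMangoldt_nonneg (n := n)
        have hv2 : ArithmeticFunction.vonMangoldt n ≤ Real.log N :=
          ArithmeticFunction.vonMangoldt_le_log.trans (Real.log_le_log hn0' (by exact_mod_cast hnN))
        have he : Real.exp (-Real.log n * (1 / 2)) ^ 2 = 1 / n := by
          rw [← Real.exp_nat_mul, show ((2 : ℕ) : ℝ) * (-Real.log n * (1 / 2)) = -Real.log n by push_cast; ring,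
            Real.exp_neg, Real.exp_log hn0', one_div]
        calc selbergCoeff Y n ^ 2 = |selbergCoeff Y n| ^ 2 := (sq_abs _).symm
          _ ≤ (ArithmeticFunction.vonMangoldt n * Real.exp (-Real.log n * (1 / 2))) ^ 2 := by gcongr
          _ = ArithmeticFunction.vonMangoldt n * (ArithmeticFunction.vonMangoldt n / n) := by
              rw [mul_pow, he]; ring
          _ ≤ _ := by gcongr
    _ = Real.log N * ∑ n ∈ Ioc 0 N, ArithmeticFunction.vonMangoldt n / n := by rw [Finset.mul_sum]
    _ ≤ Real.log N * (2 * Real.log N) :=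
        mul_le_mul_of_nonneg_left (sum_vonMangoldt_div_le N) (Real.log_natCast_nonneg N)
    _ = _ := by ring

lemma norm_sq_sum_mul_exp (s : Finset ℕ) (q l : ℕ → ℝ) (t : ℝ) :
    ‖∑ n ∈ s, (q n : ℂ) * Complex.exp (-(l n * t : ℝ) * Complex.I)‖ ^ 2 =
      ∑ m ∈ s, ∑ n ∈ s, q m * q n * Real.cos ((l m - l n) * t) := by
  have hre : (∑ n ∈ s, (q n : ℂ) * Complex.exp (-(l n * t : ℝ) * Complex.I)).re = ∑ n ∈ s, q n * Real.cos (l n * t) := by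
    rw [Complex.re_sum]
    refine Finset.sum_congr rfl fun n _ => ?_
    rw [Complex.re_ofReal_mul, ← Complex.ofReal_neg, Complex.exp_ofReal_mul_I_re, Real.cos_neg]
  have him : (∑ n ∈ s, (q n : ℂ) * Complex.exp (-(l n * t : ℝ) * Complex.I)).im = -∑ n ∈ s, q n * Real.sin (l n * t) := by
    rw [Complex.im_sum, ← Finset.sum_neg_distrib]
    refine Finset.sum_congr rfl fun n _ => ?_
    rw [Complex.im_ofReal_mul, ← Complex.ofReal_neg, Complex.exp_ofReal_mul_I_im, Real.sin_neg, mul_neg]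
  rw [← Complex.normSq_eq_norm_sq, Complex.normSq_apply, hre, him, neg_mul_neg, Finset.sum_mul_sum, Finset.sum_mul_sum,
    ← Finset.sum_add_distrib]
  refine Finset.sum_congr rfl fun m _ => ?_
  rw [← Finset.sum_add_distrib]
  refine Finset.sum_congr rfl fun n _ => ?_
  rw [sub_mul, Real.cos_sub]
  ring

lemma abs_integral_cos_mul_le {d : ℝ} (hd : d ≠ 0) (V : ℝ) :
    |∫ t in -V..V, Real.cos (d * t)| ≤ 2 / |d| := by
  rw [intervalIntegral.integral_comp_mul_left _ hd, integral_cos, smul_eq_mul, abs_mul, abs_inv, mul_comm, ← div_eq_mul_inv]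
  gcongr
  refine (abs_sub _ _).trans ?_
  linarith [Real.abs_sin_le_one (d * V), Real.abs_sin_le_one (d * -V)]

lemma inv_abs_log_sub_log_le {m n M : ℕ} (hm : 0 < m) (hn : 0 < n) (hmM : m ≤ M) (hnM : n ≤ M) (h : m ≠ n) :
    1 / |Real.log m - Real.log n| ≤ M := by
  wlog hlt : n < m generalizing m n
  · rw [abs_sub_comm]
    exact this hn hm hnM hmM h.symm (by omega)
  have hm' : (0 : ℝ) < m := by exact_mod_cast hm
  have hn' : (0 : ℝ) < n := by exact_mod_cast hn
  have hlt' : (n : ℝ) + 1 ≤ m := by exact_mod_cast hlt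
  have h1 : 1 / (m : ℝ) ≤ Real.log m - Real.log n := by
    have := Real.log_le_sub_one_of_pos (div_pos hn' hm')
    rw [Real.log_div hn'.ne' hm'.ne'] at this
    have h2 : (n : ℝ) / m ≤ 1 - 1 / m := by
      rw [div_le_iff₀ hm', sub_mul, div_mul_cancel₀ _ hm'.ne']
      linarith
    linarith
  have h3 : 0 < 1 / (m : ℝ) := by positivity
  rw [abs_of_pos (h3.trans_le h1)]
  calc 1 / (Real.log m - Real.log n) ≤ 1 / (1 / (m : ℝ)) := by gcongr
    _ = m := one_div_one_div _
    _ ≤ M := by exact_mod_cast hmM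

lemma integral_norm_sq_dirichlet_le (M : ℕ) {q : ℕ → ℝ} (hq : q 0 = 0) {V : ℝ} (hV : 0 ≤ V) :
    ∫ t in -V..V, ‖∑ n ∈ range (M + 1), (q n : ℂ) * Complex.exp (-(Real.log n * t : ℝ) * Complex.I)‖ ^ 2 ≤
      (2 * V + 2 * (M + 1) ^ 2) * ∑ n ∈ range (M + 1), q n ^ 2 := by
  simp only [norm_sq_sum_mul_exp]
  have hi (m n : ℕ) : IntervalIntegrable (fun t => q m * q n * Real.cos ((Real.log m - Real.log n) * t)) volume (-V) V :=
    Continuous.intervalIntegrable (by fun_prop) _ _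
  rw [intervalIntegral.integral_finsetSum fun m _ =>
    Continuous.intervalIntegrable (by fun_prop) _ _]
  simp only [intervalIntegral.integral_finsetSum fun n (_ : n ∈ range (M + 1)) => hi _ n]
  have hb (m n : ℕ) (hm : m ∈ range (M + 1)) (hn : n ∈ range (M + 1)) :
      ∫ t in -V..V, q m * q n * Real.cos ((Real.log m - Real.log n) * t) ≤
        (if m = n then 2 * V * q m ^ 2 else 0) + 2 * M * (|q m| * |q n|) := by
    rw [intervalIntegral.integral_const_mul]
    by_cases hmn : m = n
    · subst hmn
      simp only [sub_self, zero_mul, Real.cos_zero, intervalIntegral.integral_const, smul_eq_mul, mul_one, if_true]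
      have : 0 ≤ 2 * M * (|q m| * |q m|) := by positivity
      linarith
    · rw [if_neg hmn, zero_add]
      rcases Nat.eq_zero_or_pos m with rfl | hm0
      · simp [hq]
      rcases Nat.eq_zero_or_pos n with rfl | hn0
      · simp [hq]
      have h1 := inv_abs_log_sub_log_le hm0 hn0 (Nat.lt_succ_iff.1 (Finset.mem_range.1 hm))
        (Nat.lt_succ_iff.1 (Finset.mem_range.1 hn)) hmn
      have hd : Real.log m - Real.log n ≠ 0 := by
        rw [sub_ne_zero]
        intro h
        exact hmn (by exact_mod_cast Real.log_injOn_pos (by simpa using hm0) (by simpa using hn0) h)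
      have h2 := abs_integral_cos_mul_le hd V
      rw [div_eq_mul_one_div] at h2
      refine (le_abs_self _).trans ?_
      rw [abs_mul, abs_mul]
      calc _ ≤ |q m| * |q n| * (2 * M) := by
            gcongr
            exact h2.trans (by gcongr)
        _ = _ := by ring
  calc _ ≤ ∑ m ∈ range (M + 1), ∑ n ∈ range (M + 1), ((if m = n then 2 * V * q m ^ 2 else 0) + 2 * M * (|q m| * |q n|)) :=
        Finset.sum_le_sum fun m hm => Finset.sum_le_sum fun n hn => hb m n hm hn
    _ = 2 * V * (∑ n ∈ range (M + 1), q n ^ 2) + 2 * M * (∑ n ∈ range (M + 1), |q n|) ^ 2 := by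
        simp only [Finset.sum_add_distrib]
        congr 1
        · rw [Finset.mul_sum]
          refine Finset.sum_congr rfl fun m hm => ?_
          rw [Finset.sum_ite_eq, if_pos hm]
        · rw [sq, Finset.sum_mul_sum, Finset.mul_sum]
          simp only [Finset.mul_sum]
    _ ≤ 2 * V * (∑ n ∈ range (M + 1), q n ^ 2) + 2 * (M + 1) * ((M + 1) * ∑ n ∈ range (M + 1), q n ^ 2) := by
        have := sq_sum_le_card_mul_sum_sq (s := range (M + 1)) (f := fun n => |q n|)
        simp only [sq_abs, Finset.card_range] at this
        push_cast at this
        gcongr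
        linarith
    _ = _ := by ring

lemma integral_norm_sq_selberg_le {T : ℝ} (hT : Real.exp 20 ≤ T) :
    ∫ t in -(2 * T)..(2 * T), ‖∑ n ∈ range (⌊Real.exp (2 * (Real.log T / 4))⌋₊ + 1),
      (selbergCoeff (Real.log T / 4) n : ℂ) * Complex.exp (-(Real.log n * t : ℝ) * Complex.I)‖ ^ 2 ≤
      24 * (T * Real.log T ^ 2) := by
  have hT0 : 0 < T := (Real.exp_pos _).trans_le hT
  have hT1 : 1 ≤ T := (Real.one_le_exp (by norm_num)).trans hT
  have hl : 20 ≤ Real.log T := (Real.le_log_iff_exp_le hT0).2 hT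
  set E := Real.exp (2 * (Real.log T / 4)) with hE
  have hE2 : E ^ 2 = T := by
    rw [hE, ← Real.exp_nat_mul, show ((2 : ℕ) : ℝ) * (2 * (Real.log T / 4)) = Real.log T by push_cast; ring, Real.exp_log hT0]
  have hE1 : 1 ≤ E := Real.one_le_exp (by linarith)
  have h1 := integral_norm_sq_dirichlet_le ⌊E⌋₊ (q := selbergCoeff (Real.log T / 4)) (by simp [selbergCoeff])
    (V := 2 * T) (by positivity)
  have h2 := sum_selbergCoeff_sq_le (Y := Real.log T / 4) (by linarith) ⌊E⌋₊
  have h3 : (⌊E⌋₊ : ℝ) ≤ E := Nat.floor_le (by positivity)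
  have h3' : (1 : ℝ) ≤ ⌊E⌋₊ := by exact_mod_cast Nat.one_le_floor_iff _ |>.2 hE1
  have h4 : Real.log ⌊E⌋₊ ≤ Real.log T :=
    Real.log_le_log (by linarith) (h3.trans (by nlinarith))
  have h5 : 0 ≤ Real.log (⌊E⌋₊ : ℝ) := Real.log_natCast_nonneg _
  calc _ ≤ _ := h1
    _ ≤ (2 * (2 * T) + 2 * (4 * T)) * (2 * Real.log T ^ 2) := by
      gcongr
      · rw [← hE2]; nlinarith
      · exact h2.trans (by gcongr)
    _ = _ := by ring

lemma exists_zetaZeroSum_majorant (hRH : RiemannHypothesis) : ∃ C > 0, ∀ T : ℝ, Real.exp 20 ≤ T →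
    ∃ G : ℝ → ℝ, Continuous G ∧ (∀ t, zetaZeroSum (4 / Real.log T) t ≤ G t) ∧
      ∫ t in -(2 * T)..(2 * T), G t ^ 2 ≤ C * (T * Real.log T ^ 2) := by
  obtain ⟨C, hC, h⟩ := zetaZeroSum_le hRH
  refine ⟨C ^ 2 * (3 * 44), by positivity, fun T hT => ?_⟩
  have hT0 : 0 < T := (Real.exp_pos _).trans_le hT
  have hT2 : 2 ≤ T := by linarith [Real.add_one_le_exp (20 : ℝ)]
  have hl : 20 ≤ Real.log T := (Real.le_log_iff_exp_le hT0).2 hT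
  set Y := Real.log T / 4 with hY
  have hY5 : 5 ≤ Y := by linarith
  set P : ℝ → ℝ := fun t => ‖∑ n ∈ range (⌊Real.exp (2 * Y)⌋₊ + 1),
      (selbergCoeff Y n : ℂ) * Complex.exp (-(Real.log n * t : ℝ) * Complex.I)‖ with hP
  set B : ℝ → ℝ := fun t => Real.exp Y / (1 + t ^ 2) with hB
  have hPc : Continuous P := by fun_prop
  have hBc : Continuous B := continuous_const.div (by fun_prop) fun t => by positivity
  have hLc : Continuous fun t : ℝ => Real.log (|t| + 2) :=
    Continuous.log (by fun_prop) fun t => by positivity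
  refine ⟨fun t => C * (P t + B t + Real.log (|t| + 2)), by fun_prop, fun t => ?_, ?_⟩
  · rw [show 4 / Real.log T = Y⁻¹ by rw [hY, inv_div]]
    exact h Y hY5 t
  have hii {f : ℝ → ℝ} (hf : Continuous f) : IntervalIntegrable f volume (-(2 * T)) (2 * T) := hf.intervalIntegrable _ _
  have hle : -(2 * T) ≤ 2 * T := by linarith
  have e2 : ∫ t in -(2 * T)..(2 * T), B t ^ 2 ≤ 4 * T := by
    calc ∫ t in -(2 * T)..(2 * T), B t ^ 2 ≤ ∫ t in -(2 * T)..(2 * T), Real.exp Y ^ 2 * (1 / (1 + t ^ 2)) := by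
          refine intervalIntegral.integral_mono_on hle (hii (by fun_prop))
            (hii (continuous_const.mul (continuous_const.div (by fun_prop) fun t => by positivity))) fun t _ => ?_
          rw [hB]
          simp only
          rw [div_pow, ← div_eq_mul_one_div]
          gcongr
          nlinarith [sq_nonneg t]
      _ = Real.exp Y ^ 2 * (Real.arctan (2 * T) - Real.arctan (-(2 * T))) := by
          rw [intervalIntegral.integral_const_mul, integral_one_div_one_add_sq]
      _ ≤ T * 4 := by
          have h1 : Real.exp Y ^ 2 ≤ T := by
            rw [← Real.exp_nat_mul]
            calc Real.exp ((2 : ℕ) * Y) ≤ Real.exp (Real.log T) := by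
                  gcongr
                  rw [hY]; push_cast; linarith
              _ = T := Real.exp_log hT0
          have h2 : Real.arctan (2 * T) - Real.arctan (-(2 * T)) ≤ 4 := by
            linarith [Real.arctan_lt_pi_div_two (2 * T), Real.neg_pi_div_two_lt_arctan (-(2 * T)), Real.pi_lt_four]
          have h3 : 0 ≤ Real.arctan (2 * T) - Real.arctan (-(2 * T)) := by
            rw [Real.arctan_neg, sub_neg_eq_add]
            have := Real.arctan_nonneg.2 (show 0 ≤ 2 * T by positivity)
            linarith
          gcongr
      _ = _ := by ring
  have e3 : ∫ t in -(2 * T)..(2 * T), Real.log (|t| + 2) ^ 2 ≤ 4 * T * (2 * Real.log T) ^ 2 := by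
    calc _ ≤ ∫ t in -(2 * T)..(2 * T), (2 * Real.log T) ^ 2 := by
          refine intervalIntegral.integral_mono_on hle (hii (by fun_prop)) (hii (by fun_prop)) fun t ht => ?_
          have h1 : |t| ≤ 2 * T := abs_le.2 ht
          have h2 : 0 ≤ Real.log (|t| + 2) := Real.log_nonneg (by linarith [abs_nonneg t])
          have h3 : Real.log (|t| + 2) ≤ 2 * Real.log T := by
            rw [show 2 * Real.log T = ((2 : ℕ) : ℝ) * Real.log T by norm_num, ← Real.log_pow]
            apply Real.log_le_log (by positivity)
            have : 4 ≤ T := by linarith [Real.add_one_le_exp (20 : ℝ)]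
            nlinarith
          gcongr
      _ = _ := by rw [intervalIntegral.integral_const, smul_eq_mul]; ring
  have e1 := integral_norm_sq_selberg_le hT
  calc ∫ t in -(2 * T)..(2 * T), (C * (P t + B t + Real.log (|t| + 2))) ^ 2
      ≤ ∫ t in -(2 * T)..(2 * T), C ^ 2 * (3 * (P t ^ 2 + B t ^ 2 + Real.log (|t| + 2) ^ 2)) := by
        refine intervalIntegral.integral_mono_on hle (hii (by fun_prop)) (hii (by fun_prop)) fun t _ => ?_
        rw [mul_pow]
        gcongr
        nlinarith [sq_nonneg (P t - B t), sq_nonneg (P t - Real.log (|t| + 2)), sq_nonneg (B t - Real.log (|t| + 2))]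
    _ = C ^ 2 * (3 * ((∫ t in -(2 * T)..(2 * T), P t ^ 2) + (∫ t in -(2 * T)..(2 * T), B t ^ 2) +
          ∫ t in -(2 * T)..(2 * T), Real.log (|t| + 2) ^ 2)) := by
        rw [intervalIntegral.integral_const_mul, intervalIntegral.integral_const_mul,
          intervalIntegral.integral_add (hii (by fun_prop)) (hii (by fun_prop)),
          intervalIntegral.integral_add (hii (by fun_prop)) (hii (by fun_prop))]
    _ ≤ C ^ 2 * (3 * (24 * (T * Real.log T ^ 2) + 4 * T + 4 * T * (2 * Real.log T) ^ 2)) := by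
        gcongr
    _ ≤ C ^ 2 * (3 * (44 * (T * Real.log T ^ 2))) := by
        gcongr
        have : T * 1 ≤ T * Real.log T ^ 2 := by gcongr; nlinarith
        linarith
    _ = _ := by ring

lemma one_le_analyticOrderNatAt_riemannZeta₁ {ρ : ℂ} (h : riemannZeta₁ ρ = 0) :
    1 ≤ analyticOrderNatAt riemannZeta₁ ρ := by
  have hA : AnalyticOnNhd ℂ riemannZeta₁ Set.univ :=
    differentiable_riemannZeta₁.differentiableOn.analyticOnNhd isOpen_univ
  have h1 : analyticOrderAt riemannZeta₁ ρ ≠ ⊤ := by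
    have h0 : analyticOrderAt riemannZeta₁ 0 ≠ ⊤ := by
      rw [(hA 0 trivial).analyticOrderAt_eq_zero.2 riemannZeta₁_zero_ne_zero]
      exact ENat.zero_ne_top
    exact hA.analyticOrderAt_ne_top_of_isPreconnected isPreconnected_univ (Set.mem_univ 0) (Set.mem_univ ρ) h0
  have h2 : analyticOrderAt riemannZeta₁ ρ ≠ 0 := analyticOrderAt_ne_zero.2 ⟨hA ρ trivial, h⟩
  rw [Nat.one_le_iff_ne_zero, analyticOrderNatAt, Ne, ENat.toNat_eq_zero]
  tauto

lemma sum_poisson_le_zetaZeroSum (hRH : RiemannHypothesis) {a : ℝ} (ha : 0 < a) (t : ℝ) {A : Finset ℂ}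
    (hA : ∀ ρ ∈ A, riemannZeta₁ ρ = 0 ∧ ρ.re = 1 / 2) :
    ∑ ρ ∈ A, a / (a ^ 2 + (t - ρ.im) ^ 2) ≤ zetaZeroSum a t := by
  have hs : Summable fun ρ : {ρ : ℂ // riemannZeta₁ ρ = 0} => (analyticOrderNatAt riemannZeta₁ ρ : ℝ) *
      (a / ‖(1 / 2 + a + t * Complex.I : ℂ) - ρ‖ ^ 2) := by
    refine ((summable_zetaZeroSum t hRH ha).mul_left a).congr fun ρ => by ring
  have h1 := hs.sum_le_tsum (A.subtype fun ρ => riemannZeta₁ ρ = 0) fun ρ _ => by positivity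
  refine le_trans ?_ h1
  rw [Finset.sum_subtype_eq_sum_filter (fun ρ : ℂ => (analyticOrderNatAt riemannZeta₁ ρ : ℝ) *
      (a / ‖(1 / 2 + a + t * Complex.I : ℂ) - ρ‖ ^ 2)), Finset.filter_true_of_mem fun ρ hρ => (hA ρ hρ).1]
  refine Finset.sum_le_sum fun ρ hρ => ?_
  have e : ‖(1 / 2 + a + t * Complex.I : ℂ) - ρ‖ ^ 2 = a ^ 2 + (t - ρ.im) ^ 2 := by
    rw [← Complex.normSq_eq_norm_sq, Complex.normSq_apply]
    simp [(hA ρ hρ).2]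
    ring
  rw [e]
  have : (1 : ℝ) ≤ analyticOrderNatAt riemannZeta₁ ρ := by
    exact_mod_cast one_le_analyticOrderNatAt_riemannZeta₁ (hA ρ hρ).1
  exact le_mul_of_one_le_left (by positivity) this

lemma one_div_le_integral_poisson {a : ℝ} (ha : 0 < a) (d γ b c : ℝ) (hb : b ≤ γ) (hc : γ + a ≤ c) :
    1 / (1 + (d * (4 / a)) ^ 2) ≤
      6 * a * ∫ t in b..c, a / (a ^ 2 + (t - γ) ^ 2) * (a / (a ^ 2 + (t - γ + d) ^ 2)) := by
  have hcont : Continuous fun t : ℝ => a / (a ^ 2 + (t - γ) ^ 2) * (a / (a ^ 2 + (t - γ + d) ^ 2)) := by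
    fun_prop (disch := intro x; positivity)
  have h1 : ∫ t in γ..(γ + a), 1 / (6 * a ^ 2 * (1 + (d * (4 / a)) ^ 2)) ≤
      ∫ t in b..c, a / (a ^ 2 + (t - γ) ^ 2) * (a / (a ^ 2 + (t - γ + d) ^ 2)) := by
    calc _ ≤ ∫ t in γ..(γ + a), a / (a ^ 2 + (t - γ) ^ 2) * (a / (a ^ 2 + (t - γ + d) ^ 2)) := by
          refine intervalIntegral.integral_mono_on (by linarith) (by simp)
            (hcont.intervalIntegrable _ _) fun t ht => ?_
          have hx0 : 0 ≤ t - γ := by linarith [ht.1]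
          have hx1 : t - γ ≤ a := by linarith [ht.2]
          set x := t - γ
          have hxx : x ^ 2 ≤ a ^ 2 := by gcongr
          rw [div_mul_div_comm, div_le_div_iff₀ (by positivity) (by positivity)]
          have e : a * a * (6 * a ^ 2 * (1 + (d * (4 / a)) ^ 2)) = 6 * a ^ 2 * (a ^ 2 + 16 * d ^ 2) := by
            field_simp
            ring
          rw [e, one_mul]
          calc _ ≤ (a ^ 2 + a ^ 2) * (a ^ 2 + (2 * a ^ 2 + 2 * d ^ 2)) := by
                gcongr
                nlinarith [sq_nonneg (x - d)]
            _ ≤ _ := by nlinarith [mul_nonneg (sq_nonneg a) (sq_nonneg d)]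
      _ ≤ _ := by
          refine intervalIntegral.integral_mono_interval hb (by linarith) hc ?_ (hcont.intervalIntegrable _ _)
          exact Eventually.of_forall fun t => by simp only [Pi.zero_apply]; positivity
  rw [intervalIntegral.integral_const, smul_eq_mul] at h1
  calc 1 / (1 + (d * (4 / a)) ^ 2) = 6 * a * ((γ + a - γ) * (1 / (6 * a ^ 2 * (1 + (d * (4 / a)) ^ 2)))) := by
        field_simp
        ring
    _ ≤ _ := by gcongr

/-- An upper bound for sums over pairs of zeros, at the scale of the mean spacing. -/
lemma exists_sum_pairs_le (hRH : RiemannHypothesis) : ∃ C > 0, ∀ T, Real.exp 20 ≤ T → ∀ Δ : ℝ,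
    |Δ| ≤ 2 * Real.log T → ∀ A : Finset ℂ,
    (∀ ρ ∈ A, riemannZeta₁ ρ = 0 ∧ ρ.re = 1 / 2 ∧ ρ.im ∈ Set.Ioc 0 T) →
    ∑ ρ ∈ A, ∑ ρ' ∈ A, 1 / (1 + ((ρ.im - ρ'.im - Δ) * Real.log T) ^ 2) ≤ C * (T * Real.log T) := by
  obtain ⟨C, hC, hG⟩ := exists_zetaZeroSum_majorant hRH
  refine ⟨24 * C, by positivity, fun T hT Δ hΔ A hA => ?_⟩
  obtain ⟨G, hGc, hGle, hGint⟩ := hG T hT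
  have hT0 : 0 < T := (Real.exp_pos _).trans_le hT
  have hl : 20 ≤ Real.log T := (Real.le_log_iff_exp_le hT0).2 hT
  have hTl : 1 + 2 * Real.log T ≤ T := by
    have h1 := Real.quadratic_le_exp_of_nonneg (show 0 ≤ Real.log T by linarith)
    rw [Real.exp_log hT0] at h1
    nlinarith
  set l := Real.log T
  set a := 4 / l with ha
  have ha0 : 0 < a := by positivity
  have ha1 : a ≤ 1 := by rw [ha, div_le_one (by linarith)]; linarith
  have hl' : 4 / a = l := by rw [ha]; field_simp
  set S : ℝ → ℝ := fun t => ∑ ρ ∈ A, a / (a ^ 2 + (t - ρ.im) ^ 2) with hS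
  have hS0 : ∀ t, 0 ≤ S t := fun t => Finset.sum_nonneg fun ρ _ => by positivity
  have hSG : ∀ t, S t ≤ G t := fun t =>
    (sum_poisson_le_zetaZeroSum hRH ha0 t fun ρ hρ => ⟨(hA ρ hρ).1, (hA ρ hρ).2.1⟩).trans (hGle t)
  have hSc : Continuous S := by
    refine continuous_finsetSum _ fun ρ _ => ?_
    fun_prop (disch := intro x; positivity)
  have hsq : ∀ b c : ℝ, -(2 * T) ≤ b → b ≤ c → c ≤ 2 * T → ∫ t in b..c, G t ^ 2 ≤ C * (T * l ^ 2) := fun b c h1 h2 h3 =>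
    (intervalIntegral.integral_mono_interval h1 h2 h3 (Eventually.of_forall fun t => sq_nonneg (G t))
      ((hGc.pow 2).intervalIntegrable _ _)).trans hGint
  have hΔ' := abs_le.1 hΔ
  calc ∑ ρ ∈ A, ∑ ρ' ∈ A, 1 / (1 + ((ρ.im - ρ'.im - Δ) * l) ^ 2)
      ≤ ∑ ρ ∈ A, ∑ ρ' ∈ A, 6 * a * ∫ t in (0 : ℝ)..(T + 1), a / (a ^ 2 + (t - ρ.im) ^ 2) *
          (a / (a ^ 2 + (t - Δ - ρ'.im) ^ 2)) := by
        refine Finset.sum_le_sum fun ρ hρ => Finset.sum_le_sum fun ρ' hρ' => ?_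
        have h := one_div_le_integral_poisson ha0 (ρ.im - ρ'.im - Δ) ρ.im 0 (T + 1) (hA ρ hρ).2.2.1.le
          (by linarith [(hA ρ hρ).2.2.2])
        rw [hl'] at h
        refine h.trans_eq ?_
        congr 2
        ext t
        congr 4
        ring
    _ = 6 * a * ∫ t in (0 : ℝ)..(T + 1), S t * S (t - Δ) := by
        have hc : ∀ ρ ρ' : ℂ, Continuous fun t : ℝ => a / (a ^ 2 + (t - ρ.im) ^ 2) *
          (a / (a ^ 2 + (t - Δ - ρ'.im) ^ 2)) := fun ρ ρ' => by
            fun_prop (disch := intro x; positivity)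
        simp only [hS, Finset.sum_mul_sum]
        rw [intervalIntegral.integral_finsetSum fun ρ _ =>
          (continuous_finsetSum _ fun ρ' _ => hc ρ ρ').intervalIntegrable _ _, Finset.mul_sum]
        refine Finset.sum_congr rfl fun ρ _ => ?_
        rw [intervalIntegral.integral_finsetSum fun ρ' _ => (hc ρ ρ').intervalIntegrable _ _, Finset.mul_sum]
    _ ≤ 6 * a * ∫ t in (0 : ℝ)..(T + 1), (1 / 2) * (G t ^ 2 + G (t - Δ) ^ 2) := by
        gcongr
        refine intervalIntegral.integral_mono_on (by linarith)
          ((hSc.mul (hSc.comp (continuous_sub_right Δ))).intervalIntegrable _ _)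
          ((by fun_prop : Continuous fun t => (1 / 2) * (G t ^ 2 + G (t - Δ) ^ 2)).intervalIntegrable _ _) fun t _ => ?_
        have h1 : S t * S (t - Δ) ≤ G t * G (t - Δ) :=
          mul_le_mul (hSG _) (hSG _) (hS0 _) ((hS0 _).trans (hSG _))
        nlinarith [sq_nonneg (G t - G (t - Δ))]
    _ = 6 * a * ((1 / 2) * ((∫ t in (0 : ℝ)..(T + 1), G t ^ 2) + ∫ t in (0 - Δ)..(T + 1 - Δ), G t ^ 2)) := by
        rw [intervalIntegral.integral_const_mul, intervalIntegral.integral_add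
          ((by fun_prop : Continuous fun t => G t ^ 2).intervalIntegrable _ _)
          ((by fun_prop : Continuous fun t => G (t - Δ) ^ 2).intervalIntegrable _ _),
          intervalIntegral.integral_comp_sub_right (fun t => G t ^ 2)]
    _ ≤ 6 * a * ((1 / 2) * (C * (T * l ^ 2) + C * (T * l ^ 2))) := by
        gcongr
        · exact hsq _ _ (by linarith) (by linarith) (by linarith)
        · exact hsq _ _ (by linarith) (by linarith) (by linarith)
    _ = _ := by rw [ha]; field_simp; ring

lemma integrable_one_div_sq_add_sq {u : ℝ} (hu : 0 < u) : Integrable fun v : ℝ => 1 / (u ^ 2 + v ^ 2) := by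
  refine ((integrable_inv_one_add_sq.comp_div hu.ne').const_mul (1 / u ^ 2)).congr
    (Eventually.of_forall fun v => ?_)
  simp only
  field_simp

lemma integral_cos_mul_div_sq_add_sq {u : ℝ} (hu : 0 < u) (b : ℝ) :
    ∫ v : ℝ, Real.cos (b * v) / (u ^ 2 + v ^ 2) = Real.pi / u * Real.exp (-(u * |b|)) := by
  set f : ℝ → ℂ := fun x => (Real.exp (-(u * |x|)) : ℂ) with hf
  have hfc : Continuous f := by fun_prop
  have e1 : ∀ w : ℝ, Set.EqOn (fun x : ℝ => Complex.exp (((-2 * Real.pi * x * w : ℝ) : ℂ) * Complex.I) • f x)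
      (fun x : ℝ => Complex.exp ((u - 2 * Real.pi * w * Complex.I) * x)) (Set.Iic 0) := fun w x hx => by
    simp only [hf, smul_eq_mul, abs_of_nonpos (show x ≤ 0 from hx), Complex.ofReal_exp, ← Complex.exp_add]
    congr 1
    push_cast
    ring
  have e2 : ∀ w : ℝ, Set.EqOn (fun x : ℝ => Complex.exp (((-2 * Real.pi * x * w : ℝ) : ℂ) * Complex.I) • f x)
      (fun x : ℝ => Complex.exp ((-u - 2 * Real.pi * w * Complex.I) * x)) (Set.Ioi 0) := fun w x hx => by
    simp only [hf, smul_eq_mul, abs_of_pos (show 0 < x from hx), Complex.ofReal_exp, ← Complex.exp_add]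
    congr 1
    push_cast
    ring
  have r1 : ∀ w : ℝ, 0 < (u - 2 * Real.pi * w * Complex.I : ℂ).re := fun w => by simpa using hu
  have r2 : ∀ w : ℝ, (-u - 2 * Real.pi * w * Complex.I : ℂ).re < 0 := fun w => by simpa using hu
  have i1 : ∀ w, IntegrableOn (fun x : ℝ => Complex.exp (((-2 * Real.pi * x * w : ℝ) : ℂ) * Complex.I) • f x)
      (Set.Iic 0) := fun w =>
    (integrableOn_congr_fun (e1 w) measurableSet_Iic).2 (integrableOn_exp_mul_complex_Iic (r1 w) 0)
  have i2 : ∀ w, IntegrableOn (fun x : ℝ => Complex.exp (((-2 * Real.pi * x * w : ℝ) : ℂ) * Complex.I) • f x)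
      (Set.Ioi 0) := fun w =>
    (integrableOn_congr_fun (e2 w) measurableSet_Ioi).2 (integrableOn_exp_mul_complex_Ioi (r2 w) 0)
  have hfi : Integrable f := by
    have := (i1 0).union (i2 0)
    rw [Set.Iic_union_Ioi, integrableOn_univ] at this
    simpa using this
  have hF : FourierTransform.fourier f = fun w => ((2 * u / (u ^ 2 + (2 * Real.pi * w) ^ 2) : ℝ) : ℂ) := by
    ext w
    rw [Real.fourier_real_eq_integral_exp_smul, ← intervalIntegral.integral_Iic_add_Ioi (i1 w) (i2 w),
      setIntegral_congr_fun measurableSet_Iic (e1 w), setIntegral_congr_fun measurableSet_Ioi (e2 w),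
      integral_exp_mul_complex_Iic (r1 w), integral_exp_mul_complex_Ioi (r2 w)]
    have n1 : (u - 2 * Real.pi * w * Complex.I : ℂ) ≠ 0 := fun h => by
      have := r1 w; rw [h] at this; simp at this
    have n2 : (-u - 2 * Real.pi * w * Complex.I : ℂ) ≠ 0 := fun h => by
      have := r2 w; rw [h] at this; simp at this
    have n3 : (u ^ 2 + (2 * Real.pi * w) ^ 2 : ℂ) ≠ 0 := by
      have : u ^ 2 + (2 * Real.pi * w) ^ 2 ≠ 0 := by positivity
      exact_mod_cast this
    push_cast
    rw [mul_zero, mul_zero, Complex.exp_zero, div_add_div _ _ n1 n2, div_eq_div_iff (mul_ne_zero n1 n2) n3]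
    linear_combination (-2 * u * (2 * Real.pi * w : ℂ) ^ 2) * Complex.I_sq
  have hFi : Integrable (FourierTransform.fourier f) := by
    rw [hF]
    refine Integrable.ofReal ?_
    refine (((integrable_one_div_sq_add_sq hu).comp_mul_left' (R := 2 * Real.pi) (by positivity)).const_mul (2 * u)).congr
      (Eventually.of_forall fun v => mul_one_div _ _)
  have h := congrFun (hfc.fourierInv_fourier_eq hfi hFi) b
  rw [Real.fourierInv_eq', hF] at h
  have h2 : ∫ v : ℝ, (Real.cos (b * (2 * Real.pi * v)) * (2 * u / (u ^ 2 + (2 * Real.pi * v) ^ 2))) =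
      Real.exp (-(u * |b|)) := by
    have h3 := congrArg Complex.re h
    rw [hf, Complex.ofReal_re] at h3
    rw [← h3, ← RCLike.re_eq_complex_re, ← integral_re]
    · refine integral_congr_ae (Eventually.of_forall fun v => ?_)
      simp only [smul_eq_mul, RCLike.re_eq_complex_re, Complex.re_mul_ofReal, Complex.exp_ofReal_mul_I_re]
      simp
      left
      ring_nf
    · rw [hF] at hFi
      refine hFi.bdd_mul (c := 1) (by fun_prop) (Eventually.of_forall fun v => ?_)
      rw [Complex.norm_exp_ofReal_mul_I]
  rw [Measure.integral_comp_mul_left (fun v => Real.cos (b * v) * (2 * u / (u ^ 2 + v ^ 2)))] at h2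
  have h4 : ∫ v : ℝ, Real.cos (b * v) * (2 * u / (u ^ 2 + v ^ 2)) =
      2 * u * ∫ v : ℝ, Real.cos (b * v) / (u ^ 2 + v ^ 2) := by
    rw [← integral_const_mul]
    congr 1
    ext v
    ring
  rw [h4, smul_eq_mul, abs_of_pos (by positivity)] at h2
  rw [← h2]
  field_simp

lemma div_sinh_nonneg {u : ℝ} (hu : 0 < u) : 0 ≤ u / Real.sinh u :=
  div_nonneg hu.le (Real.sinh_pos_iff.2 hu).le

lemma div_sinh_le_one {u : ℝ} (hu : 0 < u) : u / Real.sinh u ≤ 1 :=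
  (div_le_one (Real.sinh_pos_iff.2 hu)).2 (Real.self_le_sinh_iff.2 hu.le)

lemma div_sinh_le_exp {u : ℝ} (hu : 0 < u) : u / Real.sinh u ≤ 2 * Real.exp (-(1 / 2) * u) := by
  have h1 : u / 2 ≤ Real.sinh (u / 2) := Real.self_le_sinh_iff.2 (by linarith)
  have h2 : Real.exp (u / 2) / 2 ≤ Real.cosh (u / 2) := by
    rw [Real.cosh_eq]; linarith [Real.exp_pos (-(u / 2))]
  have h3 : Real.sinh u = 2 * Real.sinh (u / 2) * Real.cosh (u / 2) := by
    rw [← Real.sinh_two_mul]; ring_nf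
  rw [div_le_iff₀ (Real.sinh_pos_iff.2 hu), h3]
  calc u = 2 * Real.exp (-(1 / 2) * u) * (2 * (u / 2) * (Real.exp (u / 2) / 2)) := by
        have : Real.exp (-(1 / 2) * u) * Real.exp (u / 2) = 1 := by
          rw [← Real.exp_add, Real.exp_eq_one_iff]; ring
        linear_combination (-u) * this
    _ ≤ _ := by gcongr

lemma integrableOn_div_sinh : IntegrableOn (fun u : ℝ => u / Real.sinh u) (Set.Ioi 0) := by
  refine Integrable.mono' ((integrableOn_exp_mul_Ioi (a := -(1 / 2)) (by norm_num) 0).const_mul 2)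
    (by fun_prop : Measurable fun u : ℝ => u / Real.sinh u).aestronglyMeasurable ?_
  filter_upwards [ae_restrict_mem measurableSet_Ioi] with u hu
  rw [Real.norm_of_nonneg (div_sinh_nonneg hu)]
  exact div_sinh_le_exp hu

lemma integral_div_sinh_le : ∫ u in Set.Ioi (0 : ℝ), u / Real.sinh u ≤ 4 := by
  calc _ ≤ ∫ u in Set.Ioi (0 : ℝ), 2 * Real.exp (-(1 / 2) * u) :=
        setIntegral_mono_on integrableOn_div_sinh
          ((integrableOn_exp_mul_Ioi (a := -(1 / 2)) (by norm_num) 0).const_mul 2) measurableSet_Ioi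
          fun u hu => div_sinh_le_exp hu
    _ = 4 := by
        rw [integral_const_mul, integral_exp_mul_Ioi (by norm_num)]
        norm_num

/-- The integral factor of `hfun`. -/
noncomputable def hfunInt (v : ℝ) : ℝ := ∫ u in Set.Ioi (0 : ℝ), u / ((u ^ 2 + v ^ 2) * Real.sinh u)

lemma hfun_eq (v : ℝ) : hfun v = Real.sin v * hfunInt v := rfl

lemma div_mul_sinh_eq (u v : ℝ) : u / ((u ^ 2 + v ^ 2) * Real.sinh u) = u / Real.sinh u * (1 / (u ^ 2 + v ^ 2)) := by
  rw [div_mul_div_comm, mul_one, mul_comm (Real.sinh u)]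

lemma div_mul_sinh_nonneg {u : ℝ} (hu : 0 < u) (v : ℝ) : 0 ≤ u / ((u ^ 2 + v ^ 2) * Real.sinh u) := by
  rw [div_mul_sinh_eq]
  exact mul_nonneg (div_sinh_nonneg hu) (by positivity)

lemma div_mul_sinh_le {u v : ℝ} (hu : 0 < u) (hv : v ≠ 0) :
    u / ((u ^ 2 + v ^ 2) * Real.sinh u) ≤ u / Real.sinh u * (1 / v ^ 2) := by
  rw [div_mul_sinh_eq]
  have := div_sinh_nonneg hu
  gcongr
  nlinarith [sq_nonneg u]

lemma measurable_div_mul_sinh :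
    Measurable fun p : ℝ × ℝ => p.2 / ((p.2 ^ 2 + p.1 ^ 2) * Real.sinh p.2) := by fun_prop

lemma integrableOn_div_mul_sinh {v : ℝ} (hv : v ≠ 0) :
    IntegrableOn (fun u => u / ((u ^ 2 + v ^ 2) * Real.sinh u)) (Set.Ioi 0) := by
  refine Integrable.mono' (integrableOn_div_sinh.mul_const (1 / v ^ 2))
    (measurable_div_mul_sinh.comp (measurable_const.prodMk measurable_id)).aestronglyMeasurable ?_
  filter_upwards [ae_restrict_mem measurableSet_Ioi] with u hu
  rw [Real.norm_of_nonneg (div_mul_sinh_nonneg hu v)]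
  exact div_mul_sinh_le hu hv

lemma hfunInt_nonneg (v : ℝ) : 0 ≤ hfunInt v :=
  setIntegral_nonneg measurableSet_Ioi fun _ hu => div_mul_sinh_nonneg hu v

lemma hfunInt_neg (v : ℝ) : hfunInt (-v) = hfunInt v := by simp [hfunInt]

lemma hfun_neg (v : ℝ) : hfun (-v) = -hfun v := by
  rw [hfun_eq, hfun_eq, hfunInt_neg, Real.sin_neg, neg_mul]

lemma hfunInt_le_div_sq {v : ℝ} (hv : v ≠ 0) : hfunInt v ≤ 4 / v ^ 2 := by
  calc hfunInt v ≤ ∫ u in Set.Ioi (0 : ℝ), u / Real.sinh u * (1 / v ^ 2) :=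
        setIntegral_mono_on (integrableOn_div_mul_sinh hv) (integrableOn_div_sinh.mul_const _) measurableSet_Ioi
          fun u hu => div_mul_sinh_le hu hv
    _ ≤ 4 * (1 / v ^ 2) := by
        rw [integral_mul_const]
        gcongr
        exact integral_div_sinh_le
    _ = _ := by ring

lemma hfunInt_le_pi_div {v : ℝ} (hv : 0 < v) : hfunInt v ≤ Real.pi / v := by
  have hi := integrable_one_div_sq_add_sq hv
  have e := integral_cos_mul_div_sq_add_sq hv 0
  simp only [zero_mul, Real.cos_zero, abs_zero, mul_zero, neg_zero, Real.exp_zero, mul_one] at e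
  calc hfunInt v ≤ ∫ u in Set.Ioi (0 : ℝ), 1 / (v ^ 2 + u ^ 2) := by
        refine setIntegral_mono_on (integrableOn_div_mul_sinh hv.ne') hi.integrableOn measurableSet_Ioi
          fun u hu => ?_
        rw [div_mul_sinh_eq, add_comm]
        exact mul_le_of_le_one_left (by positivity) (div_sinh_le_one hu)
    _ ≤ ∫ u, 1 / (v ^ 2 + u ^ 2) := setIntegral_le_integral hi (Eventually.of_forall fun u => by
        simp only [Pi.zero_apply]; positivity)
    _ = _ := e

lemma abs_hfun_le (v : ℝ) : |hfun v| ≤ 8 / (1 + v ^ 2) := by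
  wlog hv : 0 < v generalizing v
  · rcases (not_lt.1 hv).eq_or_lt with h | h
    · simp [h, hfun_eq]
    · have := this (-v) (by linarith)
      rwa [hfun_neg, abs_neg, neg_sq] at this
  have h1 : |hfun v| = |Real.sin v| * hfunInt v := by
    rw [hfun_eq, abs_mul, abs_of_nonneg (hfunInt_nonneg v)]
  rcases le_total v 1 with h | h
  · calc |hfun v| ≤ v * (Real.pi / v) := by
          rw [h1]
          gcongr
          · exact hfunInt_nonneg v
          · simpa [abs_of_pos hv] using Real.abs_sin_le_abs (x := v)
          · exact hfunInt_le_pi_div hv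
      _ = Real.pi := by field_simp
      _ ≤ 4 := Real.pi_le_four
      _ ≤ _ := by rw [le_div_iff₀ (by positivity)]; nlinarith
  · calc |hfun v| ≤ 1 * (4 / v ^ 2) := by
          rw [h1]
          gcongr
          · exact hfunInt_nonneg v
          · exact Real.abs_sin_le_one v
          · exact hfunInt_le_div_sq hv.ne'
      _ ≤ _ := by rw [one_mul, div_le_div_iff₀ (by positivity) (by positivity)]; nlinarith

lemma measurable_hfun : Measurable hfun := by
  have h : StronglyMeasurable hfunInt :=
    StronglyMeasurable.integral_prod_right (f := fun v u => u / ((u ^ 2 + v ^ 2) * Real.sinh u))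
      measurable_div_mul_sinh.stronglyMeasurable
  exact Real.measurable_sin.mul h.measurable

lemma continuousAt_hfun {v : ℝ} (hv : v ≠ 0) : ContinuousAt hfun v := by
  refine Real.continuous_sin.continuousAt.mul ?_
  have hnear : ∀ᶠ w in nhds v, v ^ 2 / 4 < w ^ 2 := by
    have : ContinuousAt (fun w : ℝ => w ^ 2) v := by fun_prop
    exact this.eventually (lt_mem_nhds (by have := sq_pos_of_ne_zero hv; linarith))
  refine continuousAt_of_dominated (bound := fun u => u / Real.sinh u * (1 / (v ^ 2 / 4))) ?_ ?_
    (integrableOn_div_sinh.mul_const _) ?_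
  · exact Eventually.of_forall fun w =>
      (measurable_div_mul_sinh.comp (measurable_const.prodMk measurable_id)).aestronglyMeasurable
  · filter_upwards [hnear] with w hw
    filter_upwards [ae_restrict_mem measurableSet_Ioi] with u hu
    rw [Real.norm_of_nonneg (div_mul_sinh_nonneg hu w)]
    have hw0 : w ≠ 0 := by rintro rfl; nlinarith [sq_nonneg v]
    refine (div_mul_sinh_le hu hw0).trans ?_
    have := div_sinh_nonneg hu
    have := sq_pos_of_ne_zero hv
    gcongr
  · filter_upwards [ae_restrict_mem measurableSet_Ioi] with u hu
    have h1 : (u ^ 2 + v ^ 2) * Real.sinh u ≠ 0 := by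
      have := Real.sinh_pos_iff.2 hu
      have : 0 < u := hu
      positivity
    fun_prop (disch := exact h1)

lemma integrable_hfun : Integrable hfun := by
  refine Integrable.mono' (integrable_inv_one_add_sq.const_mul 8) measurable_hfun.aestronglyMeasurable
    (Eventually.of_forall fun v => ?_)
  rw [Real.norm_eq_abs, ← div_eq_mul_inv]
  exact abs_hfun_le v

lemma integral_hfun_mul_sin (ξ : ℝ) : ∫ v, hfun v * Real.sin (ξ * v) =
    Real.pi / 2 * ∫ u in Set.Ioi (0 : ℝ), (Real.exp (-(u * |1 - ξ|)) - Real.exp (-(u * |1 + ξ|))) / Real.sinh u := by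
  have h_int : Integrable (Function.uncurry fun v u : ℝ =>
      Real.sin v * Real.sin (ξ * v) * (u / ((u ^ 2 + v ^ 2) * Real.sinh u)))
      (volume.prod (volume.restrict (Set.Ioi 0))) := by
    refine Integrable.mono' ((integrable_inv_one_add_sq.const_mul (2 * (1 + |ξ|))).mul_prod integrableOn_div_sinh) ?_ ?_
    · refine Measurable.aestronglyMeasurable ?_
      have := measurable_div_mul_sinh
      unfold Function.uncurry
      fun_prop
    · have h0 : ∀ᵐ p : ℝ × ℝ ∂(volume.prod (volume.restrict (Set.Ioi 0))), p.2 ∈ Set.Ioi (0 : ℝ) :=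
        Measure.quasiMeasurePreserving_snd.ae (ae_restrict_mem measurableSet_Ioi)
      filter_upwards [h0] with p hp
      obtain ⟨v, u⟩ := p
      have hu : 0 < u := hp
      simp only [Function.uncurry_apply_pair, norm_mul, Real.norm_eq_abs]
      rw [div_mul_sinh_eq, abs_mul, abs_of_nonneg (div_sinh_nonneg hu), abs_of_nonneg (by positivity : 0 ≤ 1 / (u ^ 2 + v ^ 2))]
      rw [mul_comm (u / Real.sinh u), ← mul_assoc]
      refine mul_le_mul_of_nonneg_right ?_ (div_sinh_nonneg hu)
      have s1 : |Real.sin v| * |Real.sin (ξ * v)| ≤ 1 :=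
        mul_le_one₀ (Real.abs_sin_le_one _) (abs_nonneg _) (Real.abs_sin_le_one _)
      have s2 : |Real.sin v| * |Real.sin (ξ * v)| ≤ |ξ| * v ^ 2 := by
        calc _ ≤ |v| * |ξ * v| := mul_le_mul Real.abs_sin_le_abs Real.abs_sin_le_abs (abs_nonneg _) (abs_nonneg _)
          _ = _ := by rw [abs_mul, ← sq_abs v]; ring
      rw [mul_one_div, ← div_eq_mul_inv, div_le_div_iff₀ (by positivity) (by positivity)]
      have hm := abs_nonneg ξ
      set m := |Real.sin v| * |Real.sin (ξ * v)|
      have hm0 : 0 ≤ m := by positivity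
      have : m * (1 + v ^ 2) ≤ (1 + |ξ|) * v ^ 2 := by nlinarith
      nlinarith [mul_nonneg hm (sq_nonneg v), sq_nonneg v, sq_nonneg u, mul_nonneg hm (sq_nonneg u)]
  have e1 : ∫ v, hfun v * Real.sin (ξ * v) = ∫ v, ∫ u in Set.Ioi (0 : ℝ),
      Real.sin v * Real.sin (ξ * v) * (u / ((u ^ 2 + v ^ 2) * Real.sinh u)) := by
    congr 1
    ext v
    rw [integral_const_mul, hfun_eq, hfunInt]
    ring
  rw [e1, integral_integral_swap h_int, ← integral_const_mul]
  refine setIntegral_congr_fun measurableSet_Ioi fun u hu => ?_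
  have hu0 : 0 < u := hu
  have hc : ∀ b, Integrable fun v : ℝ => Real.cos (b * v) / (u ^ 2 + v ^ 2) := fun b => by
    refine ((integrable_one_div_sq_add_sq hu0).bdd_mul (c := 1) (f := fun v => Real.cos (b * v))
      (by fun_prop) (Eventually.of_forall fun v => ?_)).congr (Eventually.of_forall fun v => mul_one_div _ _)
    exact Real.abs_cos_le_one _
  calc ∫ v, Real.sin v * Real.sin (ξ * v) * (u / ((u ^ 2 + v ^ 2) * Real.sinh u))
      = ∫ v, u / (2 * Real.sinh u) * (Real.cos ((1 - ξ) * v) / (u ^ 2 + v ^ 2) -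
          Real.cos ((1 + ξ) * v) / (u ^ 2 + v ^ 2)) := by
        congr 1
        ext v
        rw [sub_mul 1 ξ v, add_mul 1 ξ v, one_mul, Real.cos_sub, Real.cos_add]
        have := (Real.sinh_pos_iff.2 hu0).ne'
        field_simp
        ring
    _ = _ := by
        rw [integral_const_mul, integral_sub (hc _) (hc _), integral_cos_mul_div_sq_add_sq hu0,
          integral_cos_mul_div_sq_add_sq hu0]
        have := (Real.sinh_pos_iff.2 hu0).ne'
        field_simp

lemma integral_exp_sub_exp_div_sinh_of_one_le {ξ : ℝ} (hξ : 1 ≤ ξ) :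
    ∫ u in Set.Ioi (0 : ℝ), (Real.exp (-(u * |1 - ξ|)) - Real.exp (-(u * |1 + ξ|))) / Real.sinh u = 2 / ξ := by
  calc _ = ∫ u in Set.Ioi (0 : ℝ), 2 * Real.exp (-ξ * u) := by
        refine setIntegral_congr_fun measurableSet_Ioi fun u hu => ?_
        have := (Real.sinh_pos_iff.2 hu).ne'
        rw [abs_of_nonpos (by linarith), abs_of_pos (by linarith), div_eq_iff this, Real.sinh_eq,
          show -(u * -(1 - ξ)) = -ξ * u + u by ring, show -(u * (1 + ξ)) = -ξ * u + -u by ring, Real.exp_add,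
          Real.exp_add]
        ring
    _ = _ := by
        rw [integral_const_mul, integral_exp_mul_Ioi (by linarith)]
        simp
        ring

lemma integral_exp_sub_exp_div_sinh_of_lt_one {ξ : ℝ} (h0 : 0 < ξ) (h1 : ξ < 1) :
    ∫ u in Set.Ioi (0 : ℝ), (Real.exp (-(u * |1 - ξ|)) - Real.exp (-(u * |1 + ξ|))) / Real.sinh u =
      2 / ξ - Real.pi * Real.cot (Real.pi * ξ / 2) := by
  set F : ℕ → ℝ → ℝ := fun n u => 2 * (Real.exp (-(2 * n + 2 - ξ) * u) - Real.exp (-(2 * n + 2 + ξ) * u)) with hF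
  have hn : ∀ n : ℕ, 0 < 2 * (n : ℝ) + 2 - ξ := fun n => by have := n.cast_nonneg (α := ℝ); linarith
  have hn' : ∀ n : ℕ, 0 < 2 * (n : ℝ) + 2 + ξ := fun n => by positivity
  have i1 : ∀ n : ℕ, IntegrableOn (fun u : ℝ => Real.exp (-(2 * n + 2 - ξ) * u)) (Set.Ioi 0) := fun n =>
    integrableOn_exp_mul_Ioi (by linarith [hn n]) 0
  have i2 : ∀ n : ℕ, IntegrableOn (fun u : ℝ => Real.exp (-(2 * n + 2 + ξ) * u)) (Set.Ioi 0) := fun n =>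
    integrableOn_exp_mul_Ioi (by linarith [hn' n]) 0
  have hFi : ∀ n, IntegrableOn (F n) (Set.Ioi 0) := fun n => ((i1 n).sub (i2 n)).const_mul 2
  have hFint : ∀ n, ∫ u in Set.Ioi (0 : ℝ), F n u = 2 * (1 / (2 * n + 2 - ξ) - 1 / (2 * n + 2 + ξ)) := fun n => by
    rw [integral_const_mul, integral_sub (i1 n) (i2 n), integral_exp_mul_Ioi (by linarith [hn n]),
      integral_exp_mul_Ioi (by linarith [hn' n])]
    simp only [mul_zero, Real.exp_zero, neg_div_neg_eq]
  have hF0 : ∀ n, ∀ u ∈ Set.Ioi (0 : ℝ), 0 ≤ F n u := fun n u hu => by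
    have : Real.exp (-(2 * n + 2 + ξ) * u) ≤ Real.exp (-(2 * n + 2 - ξ) * u) := by
      apply Real.exp_le_exp.2
      nlinarith [show 0 < u from hu]
    simp only [hF]
    linarith
  have hFn : ∀ n, ∫ u in Set.Ioi (0 : ℝ), ‖F n u‖ = 2 * (1 / (2 * n + 2 - ξ) - 1 / (2 * n + 2 + ξ)) := fun n => by
    rw [← hFint]
    exact setIntegral_congr_fun measurableSet_Ioi fun u hu => Real.norm_of_nonneg (hF0 n u hu)
  have hx : ((ξ / 2 : ℝ) : ℂ) ∈ Complex.integerComplement := by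
    rintro ⟨m, hm⟩
    have hm' : (m : ℝ) = ξ / 2 := by exact_mod_cast hm
    have m0 : (0 : ℝ) < m := by linarith
    have m1 : (m : ℝ) < 1 := by linarith
    norm_cast at m0 m1
    lia
  have hterm : ∀ n : ℕ, (1 / (((ξ / 2 : ℝ) : ℂ) - (n + 1)) + 1 / (((ξ / 2 : ℝ) : ℂ) + (n + 1))) =
      ((-(2 * (1 / (2 * n + 2 - ξ) - 1 / (2 * n + 2 + ξ))) : ℝ) : ℂ) := fun n => by
    have h3 := (hn n).ne'
    have h4 := (hn' n).ne'
    have h5 : ξ / 2 - (n + 1) ≠ 0 := fun h => h3 (by linarith)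
    have h6 : ξ / 2 + (n + 1) ≠ 0 := by positivity
    have : 1 / (ξ / 2 - (n + 1)) + 1 / (ξ / 2 + (n + 1)) =
        -(2 * (1 / (2 * n + 2 - ξ) - 1 / (2 * n + 2 + ξ))) := by
      rw [show 2 * (n : ℝ) + 2 - ξ = -2 * (ξ / 2 - (n + 1)) by ring,
        show 2 * (n : ℝ) + 2 + ξ = 2 * (ξ / 2 + (n + 1)) by ring]
      field_simp
      ring
    rw [← this]
    push_cast
    rfl
  have hsum : HasSum (fun n : ℕ => 2 * (1 / (2 * (n : ℝ) + 2 - ξ) - 1 / (2 * n + 2 + ξ)))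
      (2 / ξ - Real.pi * Real.cot (Real.pi * ξ / 2)) := by
    have hs := (Summable.hasSum (f := fun n : ℕ => (1 / (((ξ / 2 : ℝ) : ℂ) - (n + 1)) + 1 / (((ξ / 2 : ℝ) : ℂ) + (n + 1))))
      (summable_cotTerm hx))
    rw [← cot_series_rep' hx] at hs
    simp_rw [hterm] at hs
    have e : (Real.pi : ℂ) * Complex.cot (Real.pi * ((ξ / 2 : ℝ) : ℂ)) - 1 / ((ξ / 2 : ℝ) : ℂ) =
        ((Real.pi * Real.cot (Real.pi * (ξ / 2)) - 1 / (ξ / 2) : ℝ) : ℂ) := by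
      push_cast
      rfl
    rw [e, Complex.hasSum_ofReal] at hs
    have := hs.neg
    simp only [neg_neg] at this
    convert! this using 1
    rw [mul_div_assoc]
    field_simp
    ring
  have h := hasSum_integral_of_summable_integral_norm hFi (by simp_rw [hFn]; exact hsum.summable)
  simp_rw [hFint] at h
  rw [← hsum.unique h |>.symm]
  refine setIntegral_congr_fun measurableSet_Ioi fun u hu => ?_
  have hu0 : 0 < u := hu
  have hs := (Real.sinh_pos_iff.2 hu0).ne'
  set r := Real.exp (-2 * u) with hr
  have hr1 : r < 1 := by rw [hr, ← Real.exp_zero]; exact Real.exp_lt_exp.2 (by linarith)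
  have hgeo := (hasSum_geometric_of_lt_one (Real.exp_pos _).le hr1).mul_left
    (2 * Real.exp (-u) * (Real.exp (-(u * (1 - ξ))) - Real.exp (-(u * (1 + ξ)))))
  have eF : ∀ n, F n u = 2 * Real.exp (-u) * (Real.exp (-(u * (1 - ξ))) - Real.exp (-(u * (1 + ξ)))) * r ^ n := fun n => by
    simp only [hF, hr]
    have a1 : Real.exp (-(2 * n + 2 - ξ) * u) =
        Real.exp (-u) * Real.exp (-(u * (1 - ξ))) * Real.exp (n * (-2 * u)) := by
      rw [← Real.exp_add, ← Real.exp_add]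
      ring_nf
    have a2 : Real.exp (-(2 * n + 2 + ξ) * u) =
        Real.exp (-u) * Real.exp (-(u * (1 + ξ))) * Real.exp (n * (-2 * u)) := by
      rw [← Real.exp_add, ← Real.exp_add]
      ring_nf
    rw [← Real.exp_nat_mul, a1, a2]
    ring
  rw [← hr] at hgeo
  simp_rw [eF, hgeo.tsum_eq, abs_of_pos (by linarith : 0 < 1 - ξ), abs_of_pos (by linarith : 0 < 1 + ξ)]
  have e2 : Real.sinh u * (2 * Real.exp (-u)) = 1 - r := by
    have : Real.exp u * Real.exp (-u) = 1 := by rw [← Real.exp_add]; simp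
    have h' : Real.exp (-u) * Real.exp (-u) = r := by rw [← Real.exp_add, hr]; ring_nf
    rw [Real.sinh_eq]
    linear_combination this - h'
  have : 1 - r ≠ 0 := by linarith
  rw [div_eq_iff hs]
  field_simp
  rw [← e2]
  ring

lemma sq_integral_hfun_mul_sin {ξ : ℝ} (hξ : 0 < ξ) :
    (∫ v, hfun v * Real.sin (ξ * v)) ^ 2 = kker (ξ / (2 * Real.pi)) := by
  have hpi := Real.pi_pos
  have hle : |ξ / (2 * Real.pi)| ≤ 1 / (2 * Real.pi) ↔ ξ ≤ 1 := by
    rw [abs_of_pos (by positivity), div_le_div_iff_of_pos_right (by positivity)]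
  rw [integral_hfun_mul_sin, kker]
  simp only [hle]
  have ha : Real.pi ^ 2 * (ξ / (2 * Real.pi)) = Real.pi * ξ / 2 := by field_simp
  rw [ha]
  rcases lt_trichotomy ξ 1 with h | h | h
  · rw [if_pos h.le, integral_exp_sub_exp_div_sinh_of_lt_one hξ h]
    field_simp
  · rw [if_pos h.le, integral_exp_sub_exp_div_sinh_of_one_le h.ge, h, mul_one, Real.cot_eq_cos_div_sin, Real.cos_pi_div_two]
    field_simp
    norm_num
  · rw [if_neg h.not_ge, integral_exp_sub_exp_div_sinh_of_one_le h.le]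
    field_simp
    norm_num

lemma exists_sq_integral_hfun_mul_sin_le : ∃ C > 0, ∀ ξ : ℝ, (∫ v, hfun v * Real.sin (ξ * v)) ^ 2 ≤ C * (1 + ξ ^ 2)⁻¹ := by
  set I := ∫ v, |hfun v|
  have hI : 0 ≤ I := integral_nonneg fun v => abs_nonneg _
  have h1 : ∀ ξ, (∫ v, hfun v * Real.sin (ξ * v)) ^ 2 ≤ I ^ 2 := fun ξ => by
    rw [← sq_abs]
    gcongr
    refine (abs_integral_le_integral_abs).trans (integral_mono_of_nonneg (Eventually.of_forall fun v => abs_nonneg _)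
      integrable_hfun.abs (Eventually.of_forall fun v => ?_))
    simp only [abs_mul]
    exact mul_le_of_le_one_right (abs_nonneg _) (Real.abs_sin_le_one _)
  refine ⟨2 * (I ^ 2 + Real.pi ^ 2), by positivity, fun ξ => ?_⟩
  wlog hξ : 0 ≤ ξ generalizing ξ
  · have := this (-ξ) (by linarith)
    simpa [integral_neg] using this
  rw [← div_eq_mul_inv, le_div_iff₀ (by positivity)]
  rcases le_total ξ 1 with h | h
  · have := h1 ξ
    have h2 : 1 + ξ ^ 2 ≤ 2 := by nlinarith
    calc _ ≤ I ^ 2 * 2 := by gcongr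
      _ ≤ _ := by nlinarith [Real.pi_pos]
  · rw [integral_hfun_mul_sin, integral_exp_sub_exp_div_sinh_of_one_le h]
    have h3 : (Real.pi / 2 * (2 / ξ)) ^ 2 * (1 + ξ ^ 2) = Real.pi ^ 2 * (1 / ξ ^ 2 + 1) := by field_simp
    have h4 : 1 / ξ ^ 2 ≤ 1 := by rw [div_le_one (by positivity)]; nlinarith
    rw [h3]
    nlinarith [Real.pi_pos, sq_nonneg I, sq_nonneg Real.pi]

lemma continuous_integral_hfun_mul_sin : Continuous fun ξ : ℝ => ∫ v, hfun v * Real.sin (ξ * v) := by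
  refine continuous_of_dominated (bound := fun v => |hfun v|)
    (fun ξ => (measurable_hfun.mul (by fun_prop)).aestronglyMeasurable) (fun ξ => Eventually.of_forall fun v => ?_)
    integrable_hfun.abs (Eventually.of_forall fun v => by fun_prop)
  rw [Real.norm_eq_abs, abs_mul]
  exact mul_le_of_le_one_right (abs_nonneg _) (Real.abs_sin_le_one _)

lemma integrable_sq_integral_hfun_mul_sin : Integrable fun ξ : ℝ => (∫ v, hfun v * Real.sin (ξ * v)) ^ 2 := by
  obtain ⟨C, _, hC⟩ := exists_sq_integral_hfun_mul_sin_le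
  refine Integrable.mono' (integrable_inv_one_add_sq.const_mul C)
    (continuous_integral_hfun_mul_sin.pow 2).aestronglyMeasurable (Eventually.of_forall fun ξ => ?_)
  rw [Real.norm_of_nonneg (sq_nonneg _)]
  exact hC ξ

lemma integrableOn_kker : IntegrableOn (fun ξ => kker (ξ / (2 * Real.pi))) (Set.Ioi 0) :=
  (integrableOn_congr_fun (fun _ hξ => sq_integral_hfun_mul_sin hξ) measurableSet_Ioi).1
    integrable_sq_integral_hfun_mul_sin.integrableOn

/-- The autocorrelation of `hfun`. -/
noncomputable def hcorr (d : ℝ) : ℝ := ∫ v, hfun v * hfun (v + d)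

lemma integrable_hfun_mul_hfun (d e : ℝ) : Integrable fun v => hfun (v + d) * hfun (v + e) := by
  refine (integrable_hfun.comp_add_right d).mul_bdd (c := 8)
    (measurable_hfun.comp (measurable_add_const e)).aestronglyMeasurable (Eventually.of_forall fun v => ?_)
  refine (abs_hfun_le _).trans (div_le_self (by norm_num) ?_)
  nlinarith [sq_nonneg (v + e)]

lemma abs_hcorr_le (d : ℝ) : |hcorr d| ≤ 256 * Real.pi / (1 + d ^ 2) := by
  have hi := integrable_inv_one_add_sq
  have hi' := hi.comp_add_right d
  calc |hcorr d| ≤ ∫ v, |hfun v * hfun (v + d)| := abs_integral_le_integral_abs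
    _ ≤ ∫ v, 128 / (1 + d ^ 2) * ((1 + v ^ 2)⁻¹ + (1 + (v + d) ^ 2)⁻¹) := by
        refine integral_mono (by simpa using (integrable_hfun_mul_hfun 0 d).abs)
          ((hi.add hi').const_mul _) fun v => ?_
        simp only [abs_mul]
        calc _ ≤ 8 / (1 + v ^ 2) * (8 / (1 + (v + d) ^ 2)) :=
              mul_le_mul (abs_hfun_le _) (abs_hfun_le _) (abs_nonneg _) (by positivity)
          _ ≤ _ := by
              have : 0 < 1 + v ^ 2 := by positivity
              have : 0 < 1 + (v + d) ^ 2 := by positivity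
              rw [inv_eq_one_div, inv_eq_one_div, div_add_div _ _ (by positivity) (by positivity), div_mul_div_comm,
                div_mul_div_comm, div_le_div_iff₀ (by positivity) (by positivity)]
              have h : (1 + d ^ 2) * 64 ≤ 128 * (1 * (1 + (v + d) ^ 2) + (1 + v ^ 2) * 1) := by
                nlinarith [sq_nonneg (2 * v + d)]
              have := mul_le_mul_of_nonneg_left h (by positivity : 0 ≤ (1 + v ^ 2) * (1 + (v + d) ^ 2))
              linarith
    _ = _ := by
        rw [integral_const_mul, integral_add hi hi', integral_add_right_eq_self (fun v : ℝ => (1 + v ^ 2)⁻¹),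
          integral_univ_inv_one_add_sq]
        ring

lemma continuous_hcorr : Continuous hcorr := by
  refine continuous_iff_continuousAt.2 fun d => ?_
  refine continuousAt_of_dominated (bound := fun v => |hfun v| * 8)
    (Eventually.of_forall fun e => by simpa using (integrable_hfun_mul_hfun 0 e).aestronglyMeasurable)
    (Eventually.of_forall fun e => Eventually.of_forall fun v => ?_) (integrable_hfun.abs.mul_const 8) ?_
  · rw [Real.norm_eq_abs, abs_mul]
    gcongr
    refine (abs_hfun_le _).trans (div_le_self (by norm_num) ?_)
    nlinarith [sq_nonneg (v + e)]
  · have h : ∀ᵐ v : ℝ, v ≠ -d := by simp [ae_iff, measure_singleton]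
    filter_upwards [h] with v hv
    have hv' : v + d ≠ 0 := fun h => hv (by linarith)
    exact continuousAt_const.mul (ContinuousAt.comp (f := fun e => v + e) (continuousAt_hfun hv') (by fun_prop))

lemma integrable_hcorr : Integrable hcorr := by
  refine Integrable.mono' (integrable_inv_one_add_sq.const_mul (256 * Real.pi))
    continuous_hcorr.aestronglyMeasurable (Eventually.of_forall fun v => ?_)
  rw [Real.norm_eq_abs, ← div_eq_mul_inv]
  exact abs_hcorr_le v

lemma fourier_hfun (w : ℝ) : FourierTransform.fourier (fun v => (hfun v : ℂ)) w =
    -Complex.I * ((∫ v, hfun v * Real.sin (2 * Real.pi * w * v) : ℝ) : ℂ) := by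
  have hcos : Integrable fun v => hfun v * Real.cos (2 * Real.pi * w * v) :=
    integrable_hfun.mul_bdd (c := 1) (by fun_prop) (Eventually.of_forall fun v => Real.abs_cos_le_one _)
  have hsin : Integrable fun v => hfun v * Real.sin (2 * Real.pi * w * v) :=
    integrable_hfun.mul_bdd (c := 1) (by fun_prop) (Eventually.of_forall fun v => Real.abs_sin_le_one _)
  have hzero : ∫ v, hfun v * Real.cos (2 * Real.pi * w * v) = 0 := by
    have h := integral_neg_eq_self (fun v => hfun v * Real.cos (2 * Real.pi * w * v)) volume
    simp only [hfun_neg, mul_neg, Real.cos_neg, neg_mul, integral_neg] at h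
    linarith
  rw [Real.fourier_real_eq_integral_exp_smul]
  calc _ = ∫ v, (((hfun v * Real.cos (2 * Real.pi * w * v) : ℝ) : ℂ) +
          -Complex.I * ((hfun v * Real.sin (2 * Real.pi * w * v) : ℝ) : ℂ)) := by
        congr 1
        ext v
        rw [Complex.exp_mul_I, smul_eq_mul, ← Complex.ofReal_cos, ← Complex.ofReal_sin,
          show -2 * Real.pi * v * w = -(2 * Real.pi * w * v) by ring, Real.cos_neg, Real.sin_neg]
        push_cast
        ring
    _ = _ := by
        rw [integral_add hcos.ofReal (hsin.ofReal.const_mul _), integral_const_mul, integral_complex_ofReal,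
          integral_complex_ofReal, hzero]
        simp

lemma hcorr_eq (d : ℝ) : hcorr d =
    1 / Real.pi * ∫ ξ in Set.Ioi (0 : ℝ), kker (ξ / (2 * Real.pi)) * Real.cos (d * ξ) := by
  set S : ℝ → ℝ := fun ξ => ∫ v, hfun v * Real.sin (ξ * v) with hS
  set f : ℝ → ℂ := fun v => (hfun v : ℂ) with hf
  have hfi : Integrable f := integrable_hfun.ofReal
  have hconv : MeasureTheory.convolution f f (ContinuousLinearMap.mul ℂ ℂ) volume =
      fun x => ((-hcorr (-x) : ℝ) : ℂ) := by
    ext x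
    rw [MeasureTheory.convolution, hcorr, ← integral_neg, ← integral_complex_ofReal]
    congr 1
    ext v
    have : hfun (v + -x) = -hfun (x - v) := by rw [← hfun_neg]; ring_nf
    simp [hf, this]
  have hcc : Continuous (MeasureTheory.convolution f f (ContinuousLinearMap.mul ℂ ℂ) volume) := by
    rw [hconv]
    have := continuous_hcorr
    fun_prop
  have hci : Integrable (MeasureTheory.convolution f f (ContinuousLinearMap.mul ℂ ℂ) volume) := by
    rw [hconv]
    exact integrable_hcorr.comp_neg.neg.ofReal
  have hF : FourierTransform.fourier (MeasureTheory.convolution f f (ContinuousLinearMap.mul ℂ ℂ) volume) =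
      fun w => ((-(S (2 * Real.pi * w)) ^ 2 : ℝ) : ℂ) := by
    ext w
    rw [Real.fourier_mul_convolution_eq hfi hfi, fourier_hfun]
    push_cast
    linear_combination (S (2 * Real.pi * w) : ℂ) ^ 2 * Complex.I_sq
  have hSi : Integrable fun w => S (2 * Real.pi * w) ^ 2 :=
    integrable_sq_integral_hfun_mul_sin.comp_mul_left' (by positivity)
  have hFi : Integrable (FourierTransform.fourier
      (MeasureTheory.convolution f f (ContinuousLinearMap.mul ℂ ℂ) volume)) := by
    rw [hF]
    exact hSi.neg.ofReal
  have h := congrFun (hcc.fourierInv_fourier_eq hci hFi) (-d)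
  rw [Real.fourierInv_eq', hF, hconv] at h
  beta_reduce at h
  rw [neg_neg] at h
  have h2 := congrArg Complex.re h
  rw [Complex.ofReal_re, ← RCLike.re_eq_complex_re, ← integral_re] at h2
  · have h3 : hcorr d = ∫ w, Real.cos (d * (2 * Real.pi * w)) * S (2 * Real.pi * w) ^ 2 := by
      rw [← neg_neg (hcorr d), ← h2, ← integral_neg]
      congr 1
      ext w
      simp only [smul_eq_mul, RCLike.re_eq_complex_re, Complex.re_mul_ofReal, Complex.exp_ofReal_mul_I_re]
      rw [show (2 * Real.pi * inner ℝ w (-d)) = -(d * (2 * Real.pi * w)) by simp; ring, Real.cos_neg]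
      ring
    rw [h3, Measure.integral_comp_mul_left (fun ξ => Real.cos (d * ξ) * S ξ ^ 2)]
    have h4 : ∀ ξ, Real.cos (d * ξ) * S ξ ^ 2 = Real.cos (d * |ξ|) * S |ξ| ^ 2 := fun ξ => by
      rcases abs_choice ξ with h | h
      · rw [h]
      · have : S (-ξ) = -S ξ := by simp [hS, integral_neg]
        rw [h, this, mul_neg, Real.cos_neg, neg_sq]
    rw [integral_congr_ae (Eventually.of_forall h4)]
    rw [integral_comp_abs (f := fun ξ => Real.cos (d * ξ) * S ξ ^ 2), abs_of_pos (by positivity), smul_eq_mul]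
    rw [setIntegral_congr_fun (g := fun ξ => kker (ξ / (2 * Real.pi)) * Real.cos (d * ξ)) measurableSet_Ioi
      fun ξ hξ => by simp only [hS]; rw [sq_integral_hfun_mul_sin hξ, mul_comm]]
    field_simp
    simp_rw [mul_comm d]
  · rw [hF] at hFi
    refine hFi.bdd_mul (c := 1) (by fun_prop) (Eventually.of_forall fun v => ?_)
    rw [Complex.norm_exp_ofReal_mul_I]

/-- The zeros of `ζ` in the open critical strip. -/
def nontrivialZeros : Set ℂ := {z | riemannZeta z = 0 ∧ 0 < z.re ∧ z.re < 1}

lemma riemannZeta₁_eq_zero_of_mem {ρ : ℂ} (h : ρ ∈ nontrivialZeros) : riemannZeta₁ ρ = 0 :=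
  riemannZeta₁_eq_zero_iff.2 ⟨fun h1 => by have := h.2.2; simp [h1] at this, h.1⟩

lemma RiemannHypothesis.re_eq_of_mem (hRH : RiemannHypothesis) {ρ : ℂ} (h : ρ ∈ nontrivialZeros) :
    ρ.re = 1 / 2 := by
  rcases hRH.re_eq_or (riemannZeta₁_eq_zero_of_mem h) with h1 | h1
  · exact h1
  · linarith [h.2.1, h1.1]

instance : Countable nontrivialZeros :=
  Function.Injective.countable (f := fun ρ : nontrivialZeros =>
    (⟨ρ.1, riemannZeta₁_eq_zero_of_mem ρ.2⟩ : {ρ : ℂ // riemannZeta₁ ρ = 0}))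
    fun a b h => by simpa [Subtype.ext_iff] using h

lemma exists_sum_rpow_le (hRH : RiemannHypothesis) : ∃ C > 0, ∀ (t : ℝ) (u : Finset ℂ),
    (∀ ρ ∈ u, ρ ∈ nontrivialZeros) →
    ∑ ρ ∈ u, (1 + |t - ρ.im|) ^ (-(5 / 4) : ℝ) ≤ C * Real.log (|t| + 2) := by
  obtain ⟨C, hC, h⟩ := exists_sum_order_rpow_le
  refine ⟨C, hC, fun t u hu => le_trans (sum_le_sum fun ρ hρ => ?_)
    (h t u fun ρ hρ => hRH.re_eq_of_mem (hu ρ hρ))⟩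
  have : (1 : ℝ) ≤ analyticOrderNatAt riemannZeta₁ ρ := by
    exact_mod_cast one_le_analyticOrderNatAt_riemannZeta₁ (riemannZeta₁_eq_zero_of_mem (hu ρ hρ))
  exact le_mul_of_one_le_left (by positivity) this

lemma one_div_one_add_sq_le_rpow (x : ℝ) :
    1 / (1 + x ^ 2) ≤ 2 * (1 + |x|) ^ (-(5 / 4) : ℝ) * (1 + |x|) ^ (-(3 / 4) : ℝ) := by
  rw [mul_assoc, ← Real.rpow_add (by positivity), show (-(5 / 4) + -(3 / 4) : ℝ) = -2 by norm_num,
    Real.rpow_neg (by positivity), Real.rpow_two, ← div_eq_mul_inv,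
    div_le_div_iff₀ (by positivity) (by positivity)]
  nlinarith [sq_nonneg (1 - |x|), sq_abs x]

lemma exists_sum_one_div_le (hRH : RiemannHypothesis) : ∃ C > 0, ∀ (t : ℝ) (u : Finset ℂ),
    (∀ ρ ∈ u, ρ ∈ nontrivialZeros) → ∑ ρ ∈ u, 1 / (1 + (t - ρ.im) ^ 2) ≤ C * Real.log (|t| + 2) := by
  obtain ⟨C, hC, h⟩ := exists_sum_rpow_le hRH
  refine ⟨2 * C, by positivity, fun t u hu => ?_⟩
  calc _ ≤ ∑ ρ ∈ u, 2 * (1 + |t - ρ.im|) ^ (-(5 / 4) : ℝ) := sum_le_sum fun ρ _ =>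
        (one_div_one_add_sq_le_rpow _).trans (mul_le_of_le_one_right (by positivity)
          (Real.rpow_le_one_of_one_le_of_nonpos (by linarith [abs_nonneg (t - ρ.im)]) (by norm_num)))
    _ ≤ _ := by
        rw [← mul_sum, mul_assoc]
        exact mul_le_mul_of_nonneg_left (h t u hu) (by norm_num)

lemma abs_hfun_mul_le {L : ℝ} (hL : 1 ≤ L) (x : ℝ) : |hfun (x * L)| ≤ 8 * (1 / (1 + x ^ 2)) := by
  refine (abs_hfun_le _).trans ?_
  rw [mul_one_div]
  refine div_le_div_of_nonneg_left (by norm_num) (by positivity) ?_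
  nlinarith [sq_nonneg x, mul_nonneg (sq_nonneg x) (sub_nonneg.2 (one_le_pow₀ hL (n := 2)))]

/-- The sum over zeros at distance `≫ |t - a|` from `t`. -/
lemma exists_sum_hfun_far_le (hRH : RiemannHypothesis) : ∃ C > 0, ∀ T, Real.exp 20 ≤ T →
    ∀ L, 1 ≤ L → ∀ y, |y| ≤ Real.log T → ∀ a, 0 ≤ a → a ≤ T → ∀ (t : ℝ) (u : Finset ℂ),
    (∀ ρ ∈ u, ρ ∈ nontrivialZeros) → (∀ ρ ∈ u, 1 + |t - a| ≤ 2 * (1 + |t - ρ.im|)) →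
    ∑ ρ ∈ u, |hfun ((t + y - ρ.im) * L)| ≤
      C * Real.log T ^ 2 * (1 + |t - a|) ^ (-(5 / 8) : ℝ) := by
  obtain ⟨C, hC, h⟩ := exists_sum_rpow_le hRH
  refine ⟨16 * C * (11 * 4), by positivity, fun T hT L hL y hy a ha haT t u hu hfar => ?_⟩
  set l := Real.log T with hl
  have hT0 : 0 < T := (Real.exp_pos _).trans_le hT
  have hl20 : 20 ≤ l := (Real.le_log_iff_exp_le hT0).2 hT
  have hlT : l ≤ T := (Real.log_le_sub_one_of_pos hT0).trans (by linarith)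
  set s := 1 + |t - a| with hs
  have hs1 : 1 ≤ s := by linarith [abs_nonneg (t - a)]
  have hlog : Real.log (|t + y| + 2) ≤ 11 * l * s ^ (1 / 8 : ℝ) := by
    have h1 : |t + y| + 2 ≤ s * T ^ 3 := by
      have h2 : |t + y| ≤ |t - a| + a + |y| := by
        have := abs_add_three (t - a) a y
        rwa [sub_add_cancel, abs_of_nonneg ha] at this
      have h3 : |t + y| + 2 ≤ s + (2 * T + 1) := by linarith
      have h4 : s + (2 * T + 1) ≤ s * (2 * T + 2) := by nlinarith
      have h5 : 2 * T + 2 ≤ T ^ 3 := by nlinarith [mul_pos hT0 hT0]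
      nlinarith
    have h2 : Real.log s ≤ 8 * s ^ (1 / 8 : ℝ) := by
      have := Real.log_le_rpow_div (by linarith : 0 ≤ s) (by norm_num : (0 : ℝ) < 1 / 8)
      linarith
    have h3 : 1 ≤ s ^ (1 / 8 : ℝ) := Real.one_le_rpow hs1 (by norm_num)
    calc _ ≤ Real.log (s * T ^ 3) := Real.log_le_log (by positivity) h1
      _ = Real.log s + 3 * l := by
          rw [Real.log_mul (by positivity) (by positivity), Real.log_pow]; norm_num; rfl
      _ ≤ _ := by nlinarith
  have hterm : ∀ ρ ∈ u, |hfun ((t + y - ρ.im) * L)| ≤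
      16 * (4 * l * s ^ (-(3 / 4) : ℝ)) * (1 + |t + y - ρ.im|) ^ (-(5 / 4) : ℝ) := fun ρ hρ => by
    refine (abs_hfun_mul_le hL _).trans ((mul_le_mul_of_nonneg_left (one_div_one_add_sq_le_rpow _)
      (by norm_num)).trans ?_)
    have h1 : s ≤ 4 * l * (1 + |t + y - ρ.im|) := by
      have := hfar ρ hρ
      have h2 : |t - ρ.im| ≤ |t + y - ρ.im| + l := by
        have := abs_sub (t + y - ρ.im) y
        rw [show t + y - ρ.im - y = t - ρ.im by ring] at this
        linarith
      nlinarith [abs_nonneg (t + y - ρ.im)]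
    have h3 : (1 + |t + y - ρ.im|) ^ (-(3 / 4) : ℝ) ≤ 4 * l * s ^ (-(3 / 4) : ℝ) := by
      rw [Real.rpow_neg (by positivity), Real.rpow_neg (by positivity), ← div_eq_mul_inv,
        ← one_div, div_le_div_iff₀ (by positivity) (by positivity), one_mul]
      refine (Real.rpow_le_rpow (by positivity) h1 (by norm_num)).trans ?_
      rw [Real.mul_rpow (by positivity) (by positivity)]
      refine mul_le_mul_of_nonneg_right ?_ (by positivity)
      exact (Real.rpow_le_rpow_of_exponent_le (by linarith) (by norm_num)).trans_eq (Real.rpow_one _)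
    calc _ = 16 * (1 + |t + y - ρ.im|) ^ (-(3 / 4) : ℝ) * (1 + |t + y - ρ.im|) ^ (-(5 / 4) : ℝ) := by ring
      _ ≤ _ := by gcongr
  refine (sum_le_sum hterm).trans ?_
  rw [← mul_sum]
  calc _ ≤ 16 * (4 * l * s ^ (-(3 / 4) : ℝ)) * (C * (11 * l * s ^ (1 / 8 : ℝ))) := by
        gcongr
        exact (h _ u hu).trans (by gcongr)
    _ = 16 * C * (11 * 4) * l ^ 2 * (s ^ (-(3 / 4) : ℝ) * s ^ (1 / 8 : ℝ)) := by ring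
    _ = _ := by rw [← Real.rpow_add (by positivity)]; norm_num

lemma exists_sum_hfun_le (hRH : RiemannHypothesis) : ∃ C > 0, ∀ T, Real.exp 20 ≤ T →
    ∀ L, 1 ≤ L → ∀ y, |y| ≤ Real.log T → ∀ t ∈ Set.Icc 1 T, ∀ u : Finset ℂ,
    (∀ ρ ∈ u, ρ ∈ nontrivialZeros) →
    ∑ ρ ∈ u, |hfun ((t + y - ρ.im) * L)| ≤ C * Real.log T := by
  obtain ⟨C, hC, h⟩ := exists_sum_one_div_le hRH
  refine ⟨8 * (C * 2), by positivity, fun T hT L hL y hy t ht u hu => ?_⟩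
  have hT0 : 0 < T := (Real.exp_pos _).trans_le hT
  have hl20 : 20 ≤ Real.log T := (Real.le_log_iff_exp_le hT0).2 hT
  have hlT : Real.log T ≤ T := (Real.log_le_sub_one_of_pos hT0).trans (by linarith)
  refine (sum_le_sum fun ρ _ => abs_hfun_mul_le hL _).trans ?_
  rw [← mul_sum, mul_assoc 8]
  refine mul_le_mul_of_nonneg_left ((h _ u hu).trans ?_) (by norm_num)
  rw [mul_assoc]
  refine mul_le_mul_of_nonneg_left ?_ hC.le
  rw [show (2 : ℝ) * Real.log T = Real.log (T ^ 2) by rw [Real.log_pow]; norm_num]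
  refine Real.log_le_log (by positivity) ?_
  have := abs_add_le t y
  rw [abs_of_nonneg (by linarith [ht.1] : 0 ≤ t)] at this
  nlinarith [ht.2]

lemma summable_hfun (hRH : RiemannHypothesis) {L : ℝ} (hL : 1 ≤ L) (t : ℝ) :
    Summable fun ρ : nontrivialZeros => hfun ((t - ρ.1.im) * L) := by
  obtain ⟨C, hC, h⟩ := exists_sum_one_div_le hRH
  refine Summable.of_abs (summable_of_sum_le (c := 8 * (C * Real.log (|t| + 2))) (fun _ => abs_nonneg _) fun u => ?_)
  refine (sum_le_sum fun ρ _ => abs_hfun_mul_le hL _).trans ?_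
  rw [← mul_sum]
  refine mul_le_mul_of_nonneg_left ?_ (by norm_num)
  refine le_trans (le_of_eq ?_) (h t (u.map (Function.Embedding.subtype _)) fun ρ hρ => ?_)
  · rw [sum_map]; rfl
  · obtain ⟨z, -, rfl⟩ := mem_map.1 hρ
    exact z.2

lemma measurable_tsum_hfun (hRH : RiemannHypothesis) {L : ℝ} (hL : 1 ≤ L) :
    Measurable fun t => ∑' ρ : nontrivialZeros, hfun ((t - ρ.1.im) * L) := by
  refine measurable_of_tendsto_metrizable' (atTop : Filter (Finset nontrivialZeros))
    (f := fun u t => ∑ ρ ∈ u, hfun ((t - ρ.1.im) * L)) (fun u => ?_)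
    (tendsto_pi_nhds.2 fun t => ?_)
  · refine Finset.measurable_fun_sum _ fun ρ _ => ?_
    have : Measurable fun t : ℝ => (t - ρ.1.im) * L := by fun_prop
    exact measurable_hfun.comp this
  · have h := (summable_hfun hRH hL t).hasSum
    rwa [HasSum, SummationFilter.unconditional_filter] at h

lemma exists_abs_tsum_hfun_le (hRH : RiemannHypothesis) : ∃ C > 0, ∀ T, Real.exp 20 ≤ T →
    ∀ L, 1 ≤ L → ∀ y, |y| ≤ Real.log T → ∀ t ∈ Set.Icc 1 T,
    |∑' ρ : nontrivialZeros, hfun ((t + y - ρ.1.im) * L)| ≤ C * Real.log T := by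
  obtain ⟨C, hC, h⟩ := exists_sum_hfun_le hRH
  refine ⟨C, hC, fun T hT L hL y hy t ht => ?_⟩
  refine le_of_tendsto (summable_hfun hRH hL (t + y)).hasSum.abs (Eventually.of_forall fun u => ?_)
  refine (abs_sum_le_sum_abs _ _).trans
    (le_trans (le_of_eq ?_) (h T hT L hL y hy t ht (u.map (Function.Embedding.subtype _)) fun ρ hρ => ?_))
  · rw [sum_map]; rfl
  · obtain ⟨z, -, rfl⟩ := mem_map.1 hρ
    exact z.2

lemma exists_abs_tsum_sub_sum_le (hRH : RiemannHypothesis) : ∃ C > 0, ∀ T, Real.exp 20 ≤ T →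
    ∀ A : Finset ℂ, (∀ z, z ∈ A ↔ z ∈ nontrivialZeros ∧ z.im ∈ Set.Ioc 0 T) →
    ∀ L, 1 ≤ L → ∀ y, |y| ≤ Real.log T → ∀ t ∈ Set.Icc 1 T,
    |∑' ρ : nontrivialZeros, hfun ((t + y - ρ.1.im) * L) - ∑ ρ ∈ A, hfun ((t + y - ρ.im) * L)| ≤
      C * Real.log T ^ 2 * ((1 + |t - 1|) ^ (-(5 / 8) : ℝ) + (1 + |t - T|) ^ (-(5 / 8) : ℝ)) := by
  obtain ⟨C, hC, h⟩ := exists_sum_hfun_far_le hRH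
  refine ⟨C, hC, fun T hT A hA L hL y hy t ht => ?_⟩
  have hT1 : 1 ≤ T := ht.1.trans ht.2
  have hA' : ∀ z : A, z.1 ∈ nontrivialZeros := fun z => ((hA z).1 z.2).1
  set A' : Finset nontrivialZeros := A.attach.map ⟨fun z => ⟨z.1, hA' z⟩, fun a b hab =>
    Subtype.ext (Subtype.mk.inj hab)⟩ with hA'def
  have hsumA : ∑ ρ ∈ A, hfun ((t + y - ρ.im) * L) = ∑ ρ ∈ A', hfun ((t + y - ρ.1.im) * L) := by
    rw [hA'def, sum_map, ← sum_attach]; rfl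
  have hmem : ∀ z : nontrivialZeros, z ∉ A' → z.1 ∉ A := fun z hz hzA =>
    hz (mem_map.2 ⟨⟨z.1, hzA⟩, mem_attach _ _, rfl⟩)
  rw [hsumA]
  refine le_of_tendsto ((summable_hfun hRH hL (t + y)).hasSum.sub_const _).abs
    ((eventually_ge_atTop A').mono fun u hu => ?_)
  classical
  rw [← sum_sdiff hu, add_sub_cancel_right]
  refine (abs_sum_le_sum_abs _ _).trans ?_
  set v := (u \ A').map (Function.Embedding.subtype _) with hv
  have hvmem : ∀ z ∈ v, z ∈ nontrivialZeros ∧ (z.im ≤ 0 ∨ T < z.im) := fun z hz => by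
    obtain ⟨w, hw, rfl⟩ := mem_map.1 hz
    refine ⟨w.2, ?_⟩
    have := hmem w (mem_sdiff.1 hw).2
    rw [hA] at this
    by_contra! hc
    exact this ⟨w.2, hc.1, hc.2⟩
  have hsum : ∑ ρ ∈ u \ A', |hfun ((t + y - ρ.1.im) * L)| = ∑ ρ ∈ v, |hfun ((t + y - ρ.im) * L)| := by
    rw [hv, sum_map]; rfl
  rw [hsum, ← sum_filter_add_sum_filter_not v (fun z => z.im ≤ 0), mul_add]
  refine add_le_add (h T hT L hL y hy 1 zero_le_one hT1 t _ (fun ρ hρ => (hvmem ρ (mem_filter.1 hρ).1).1)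
    fun ρ hρ => ?_) (h T hT L hL y hy T (by linarith) le_rfl t _
    (fun ρ hρ => (hvmem ρ (mem_filter.1 hρ).1).1) fun ρ hρ => ?_)
  · have := (mem_filter.1 hρ).2
    rw [abs_of_nonneg (by linarith [ht.1] : 0 ≤ t - 1)]
    have := le_abs_self (t - ρ.im)
    linarith [ht.1]
  · have h1 := mem_filter.1 hρ
    have h2 := (hvmem ρ h1.1).2.resolve_left h1.2
    rw [abs_of_nonpos (by linarith [ht.2] : t - T ≤ 0)]
    have := neg_le_abs (t - ρ.im)
    linarith [ht.2]

lemma integrable_hfun_mul_hfun_scaled {L : ℝ} (hL : 0 < L) (a b : ℝ) :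
    Integrable fun t => hfun ((t + a) * L) * hfun ((t + b) * L) := by
  refine ((integrable_hfun_mul_hfun (a * L) (b * L)).comp_mul_right' hL.ne').congr
    (Eventually.of_forall fun t => ?_)
  simp only [add_mul]

lemma integral_hfun_mul_hfun_scaled {L : ℝ} (hL : 0 < L) (a b : ℝ) :
    ∫ t, hfun ((t + a) * L) * hfun ((t + b) * L) = 1 / L * hcorr ((b - a) * L) := by
  have h1 := Measure.integral_comp_mul_right (fun v => hfun (v + a * L) * hfun (v + b * L)) L
  have h2 := integral_add_right_eq_self (fun v => hfun v * hfun (v + (b - a) * L)) (a * L) (μ := volume)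
  have h3 : ∀ v, v + a * L + (b - a) * L = v + b * L := fun v => by ring
  simp only [h3] at h2
  rw [h2, abs_of_pos (inv_pos.2 hL), smul_eq_mul, ← one_div] at h1
  rw [hcorr, ← h1]
  simp only [add_mul]

lemma sum_mul_sum_hfun (A : Finset ℂ) (L y₁ y₂ t : ℝ) :
    (∑ ρ ∈ A, hfun ((t + y₁ - ρ.im) * L)) * (∑ ρ ∈ A, hfun ((t + y₂ - ρ.im) * L)) =
    ∑ ρ ∈ A, ∑ ρ' ∈ A, hfun ((t + (y₁ - ρ.im)) * L) * hfun ((t + (y₂ - ρ'.im)) * L) := by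
  rw [sum_mul_sum]
  simp only [add_sub_assoc]

lemma integrable_sum_mul_sum_hfun {L : ℝ} (hL : 0 < L) (A : Finset ℂ) (y₁ y₂ : ℝ) :
    Integrable fun t =>
      (∑ ρ ∈ A, hfun ((t + y₁ - ρ.im) * L)) * (∑ ρ ∈ A, hfun ((t + y₂ - ρ.im) * L)) := by
  simp only [sum_mul_sum_hfun]
  exact integrable_finsetSum _ fun ρ _ => integrable_finsetSum _ fun ρ' _ =>
    integrable_hfun_mul_hfun_scaled hL _ _

lemma integral_sum_mul_sum_hfun {L : ℝ} (hL : 0 < L) (A : Finset ℂ) (y₁ y₂ : ℝ) :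
    ∫ t, (∑ ρ ∈ A, hfun ((t + y₁ - ρ.im) * L)) * (∑ ρ ∈ A, hfun ((t + y₂ - ρ.im) * L)) =
    1 / L * ∑ ρ ∈ A, ∑ ρ' ∈ A, hcorr ((ρ.im - ρ'.im - (y₁ - y₂)) * L) := by
  simp only [sum_mul_sum_hfun]
  rw [integral_finsetSum _ fun ρ _ => integrable_finsetSum _ fun ρ' _ =>
    integrable_hfun_mul_hfun_scaled hL _ _, mul_sum]
  refine sum_congr rfl fun ρ _ => ?_
  rw [integral_finsetSum _ fun ρ' _ => integrable_hfun_mul_hfun_scaled hL _ _, mul_sum]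
  refine sum_congr rfl fun ρ' _ => ?_
  rw [integral_hfun_mul_hfun_scaled hL]
  congr 2
  ring

lemma integrable_rpow_one_add_abs_sub (a : ℝ) :
    Integrable fun t : ℝ => (1 + |t - a|) ^ (-(5 / 4) : ℝ) :=
  (integrable_one_add_norm (E := ℝ) (μ := volume) (r := 5 / 4) (by simp; norm_num)).comp_sub_right a

lemma integral_rpow_one_add_abs_sub (a : ℝ) :
    ∫ t : ℝ, (1 + |t - a|) ^ (-(5 / 4) : ℝ) = ∫ t : ℝ, (1 + |t|) ^ (-(5 / 4) : ℝ) :=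
  integral_sub_right_eq_self (fun t => (1 + |t|) ^ (-(5 / 4) : ℝ)) a

lemma log_pow_four_le {T : ℝ} (hT : 1 ≤ T) : Real.log T ^ 4 ≤ (32 / 3) ^ 4 * T ^ (3 / 8 : ℝ) := by
  have h := Real.log_le_rpow_div (by linarith : 0 ≤ T) (by norm_num : (0 : ℝ) < 3 / 32)
  calc _ ≤ (T ^ (3 / 32 : ℝ) / (3 / 32)) ^ 4 := pow_le_pow_left₀ (Real.log_nonneg hT) h 4
    _ = (32 / 3) ^ 4 * (T ^ (3 / 32 : ℝ)) ^ 4 := by ring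
    _ = _ := by
        rw [← Real.rpow_natCast (T ^ (3 / 32 : ℝ)), ← Real.rpow_mul (by linarith)]
        norm_num

lemma exists_abs_integral_tsum_mul_tsum_sub_le (hRH : RiemannHypothesis) : ∃ C > 0, ∀ T, Real.exp 20 ≤ T →
    ∀ A : Finset ℂ, (∀ z, z ∈ A ↔ z ∈ nontrivialZeros ∧ z.im ∈ Set.Ioc 0 T) →
    ∀ L, 1 ≤ L → ∀ y₁ y₂, |y₁| ≤ Real.log T → |y₂| ≤ Real.log T →
    |(∫ t in (1 : ℝ)..T, (∑' ρ : nontrivialZeros, hfun ((t + y₁ - ρ.1.im) * L)) *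
        ∑' ρ : nontrivialZeros, hfun ((t + y₂ - ρ.1.im) * L)) -
      ∫ t, (∑ ρ ∈ A, hfun ((t + y₁ - ρ.im) * L)) * (∑ ρ ∈ A, hfun ((t + y₂ - ρ.im) * L))| ≤
      C * (Real.log T ^ 4 + T / Real.log T) := by
  obtain ⟨C₁, hC₁, h₁⟩ := exists_sum_hfun_le hRH
  obtain ⟨C₂, hC₂, h₂⟩ := exists_abs_tsum_hfun_le hRH
  obtain ⟨C₃, hC₃, h₃⟩ := exists_abs_tsum_sub_sum_le hRH
  obtain ⟨C₄, hC₄, h₄⟩ := exists_sum_hfun_far_le hRH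
  set I : ℝ := ∫ t : ℝ, (1 + |t|) ^ (-(5 / 4) : ℝ) with hI
  have hI0 : 0 ≤ I := integral_nonneg fun t => by positivity
  set K : ℝ := (C₁ + C₂) * C₃ * (32 / 3) ^ 4 + C₄ ^ 2 with hK
  refine ⟨K * (2 * I) + 1, by positivity, fun T hT A hA L hL y₁ y₂ hy₁ hy₂ => ?_⟩
  have hT0 : 0 < T := (Real.exp_pos _).trans_le hT
  have hT1' : 1 < T := by linarith [Real.add_one_le_exp (20 : ℝ)]
  have hT1 := hT1'.le
  have hl20 : 20 ≤ Real.log T := (Real.le_log_iff_exp_le hT0).2 hT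
  set l := Real.log T with hl
  set Z : ℝ → ℝ → ℝ := fun y t => ∑' ρ : nontrivialZeros, hfun ((t + y - ρ.1.im) * L) with hZ
  set S : ℝ → ℝ → ℝ := fun y t => ∑ ρ ∈ A, hfun ((t + y - ρ.im) * L) with hS
  set G : ℝ → ℝ := fun t => (1 + |t - 1|) ^ (-(5 / 4) : ℝ) + (1 + |t - T|) ^ (-(5 / 4) : ℝ) with hG
  have hGi : Integrable G := (integrable_rpow_one_add_abs_sub 1).add (integrable_rpow_one_add_abs_sub T)
  have hGI : ∫ t, G t = 2 * I := by
    rw [hG, integral_add (integrable_rpow_one_add_abs_sub 1) (integrable_rpow_one_add_abs_sub T),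
      integral_rpow_one_add_abs_sub, integral_rpow_one_add_abs_sub]
    ring
  have hAn : ∀ ρ ∈ A, ρ ∈ nontrivialZeros := fun ρ hρ => ((hA ρ).1 hρ).1
  have hSfar : ∀ y, |y| ≤ l → ∀ a, a = 1 ∨ a = T → ∀ t, (a = 1 → t ≤ 1) → (a = T → T ≤ t) →
      |S y t| ≤ C₄ * l ^ 2 * (1 + |t - a|) ^ (-(5 / 8) : ℝ) := fun y hy a ha t hat1 hatT => by
    refine (abs_sum_le_sum_abs _ _).trans (h₄ T hT L hL y hy a ?_ ?_ t A hAn fun ρ hρ => ?_)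
    · rcases ha with rfl | rfl <;> linarith
    · rcases ha with rfl | rfl <;> linarith
    · obtain ⟨h0, hle⟩ := ((hA ρ).1 hρ).2
      rcases ha with rfl | rfl
      · rw [abs_of_nonpos (by linarith [hat1 rfl])]
        linarith [neg_le_abs (t - ρ.im), abs_nonneg (t - ρ.im)]
      · rw [abs_of_nonneg (by linarith [hatT rfl])]
        linarith [le_abs_self (t - ρ.im), abs_nonneg (t - ρ.im)]
  have hprod : ∀ a, a = 1 ∨ a = T → ∀ t, (a = 1 → t ≤ 1) → (a = T → T ≤ t) →
      |S y₁ t * S y₂ t| ≤ C₄ ^ 2 * l ^ 4 * (1 + |t - a|) ^ (-(5 / 4) : ℝ) := fun a ha t h1 h2 => by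
    rw [abs_mul]
    refine (mul_le_mul (hSfar y₁ hy₁ a ha t h1 h2) (hSfar y₂ hy₂ a ha t h1 h2) (abs_nonneg _)
      (by positivity)).trans_eq ?_
    calc _ = C₄ ^ 2 * l ^ 4 * ((1 + |t - a|) ^ (-(5 / 8) : ℝ) * (1 + |t - a|) ^ (-(5 / 8) : ℝ)) := by ring
      _ = _ := by rw [← Real.rpow_add (by positivity)]; norm_num
  have hstretch : ∀ a, |a| ≤ T - 1 → (1 + |a|) ^ (-(5 / 8) : ℝ) ≤ T ^ (5 / 8 : ℝ) * (1 + |a|) ^ (-(5 / 4) : ℝ) :=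
    fun a ha => by
      rw [show (-(5 / 8) : ℝ) = 5 / 8 + -(5 / 4) by norm_num, Real.rpow_add (by positivity)]
      gcongr
      linarith
  have hZm : ∀ y, Measurable (Z y) := fun y =>
    (measurable_tsum_hfun hRH hL).comp (measurable_id.add_const y)
  have hZi : Integrable ((Set.Ioc 1 T).indicator fun t => Z y₁ t * Z y₂ t) := by
    rw [integrable_indicator_iff measurableSet_Ioc]
    refine Measure.integrableOn_of_bounded (M := C₂ * l * (C₂ * l)) (by simp)
      ((hZm y₁).mul (hZm y₂)).aestronglyMeasurable
      ((ae_restrict_iff' measurableSet_Ioc).2 (Eventually.of_forall fun t ht => ?_))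
    rw [norm_mul]
    exact mul_le_mul (h₂ T hT L hL y₁ hy₁ t ⟨ht.1.le, ht.2⟩) (h₂ T hT L hL y₂ hy₂ t ⟨ht.1.le, ht.2⟩)
      (norm_nonneg _) (by positivity)
  have hSi : Integrable fun t => S y₁ t * S y₂ t := integrable_sum_mul_sum_hfun (by linarith) A y₁ y₂
  rw [intervalIntegral.integral_of_le hT1, ← integral_indicator measurableSet_Ioc, ← integral_sub hZi hSi]
  set B : ℝ := (C₁ + C₂) * C₃ * (l ^ 3 * T ^ (5 / 8 : ℝ)) + C₄ ^ 2 * l ^ 4 with hB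
  have hB1 : (C₁ + C₂) * C₃ * (l ^ 3 * T ^ (5 / 8 : ℝ)) ≤ B := by rw [hB]; linarith [show 0 ≤ C₄ ^ 2 * l ^ 4 by positivity]
  have hB2 : C₄ ^ 2 * l ^ 4 ≤ B := by
    rw [hB]; linarith [show 0 ≤ (C₁ + C₂) * C₃ * (l ^ 3 * T ^ (5 / 8 : ℝ)) by positivity]
  have hB0 : 0 ≤ B := by positivity
  have hbound : ∀ t, ‖(Set.Ioc 1 T).indicator (fun t => Z y₁ t * Z y₂ t) t - S y₁ t * S y₂ t‖ ≤ B * G t := by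
    intro t
    rw [Real.norm_eq_abs]
    by_cases ht : t ∈ Set.Ioc 1 T
    · have ht' : t ∈ Set.Icc 1 T := ⟨ht.1.le, ht.2⟩
      rw [Set.indicator_of_mem ht]
      have hg : (1 + |t - 1|) ^ (-(5 / 8) : ℝ) + (1 + |t - T|) ^ (-(5 / 8) : ℝ) ≤ T ^ (5 / 8 : ℝ) * G t := by
        rw [hG, mul_add]
        refine add_le_add (hstretch _ ?_) (hstretch _ ?_)
        · rw [abs_of_nonneg] <;> linarith [ht.1, ht.2]
        · rw [abs_of_nonpos] <;> linarith [ht.1, ht.2]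
      have hd : ∀ y, |y| ≤ l → |Z y t - S y t| ≤ C₃ * l ^ 2 * (T ^ (5 / 8 : ℝ) * G t) := fun y hy =>
        (h₃ T hT A hA L hL y hy t ht').trans (by gcongr)
      have e : Z y₁ t * Z y₂ t - S y₁ t * S y₂ t =
          S y₁ t * (Z y₂ t - S y₂ t) + Z y₂ t * (Z y₁ t - S y₁ t) := by ring
      rw [e]
      refine (abs_add_le _ _).trans ?_
      rw [abs_mul, abs_mul]
      have hS1 : |S y₁ t| ≤ C₁ * l :=
        (abs_sum_le_sum_abs _ _).trans (h₁ T hT L hL y₁ hy₁ t ht' A hAn)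
      have hG0 : 0 ≤ G t := by positivity
      calc _ ≤ C₁ * l * (C₃ * l ^ 2 * (T ^ (5 / 8 : ℝ) * G t)) + C₂ * l * (C₃ * l ^ 2 * (T ^ (5 / 8 : ℝ) * G t)) := by
            refine add_le_add (mul_le_mul hS1 (hd _ hy₂) (abs_nonneg _) (by positivity))
              (mul_le_mul (h₂ T hT L hL y₂ hy₂ t ht') (hd _ hy₁) (abs_nonneg _) (by positivity))
        _ = (C₁ + C₂) * C₃ * (l ^ 3 * T ^ (5 / 8 : ℝ)) * G t := by ring
        _ ≤ _ := by gcongr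
    · rw [Set.indicator_of_notMem ht, zero_sub, abs_neg]
      rcases le_or_gt t 1 with h1 | h1
      · refine (hprod 1 (Or.inl rfl) t (fun _ => h1) fun hh => by linarith).trans ?_
        exact mul_le_mul hB2 (le_add_of_nonneg_right (by positivity)) (by positivity) hB0
      · have h2 : T ≤ t := by by_contra! hc; exact ht ⟨h1, hc.le⟩
        refine (hprod T (Or.inr rfl) t (fun hh => by linarith) fun _ => h2).trans ?_
        exact mul_le_mul hB2 (le_add_of_nonneg_left (by positivity)) (by positivity) hB0
  have hmain := norm_integral_le_of_norm_le (hGi.const_mul B) (Eventually.of_forall hbound)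
  rw [integral_const_mul, hGI, Real.norm_eq_abs] at hmain
  refine hmain.trans ?_
  have hpow : l ^ 3 * T ^ (5 / 8 : ℝ) ≤ (32 / 3) ^ 4 * (T / l) := by
    rw [← mul_div_assoc, le_div_iff₀ (by positivity)]
    calc _ = l ^ 4 * T ^ (5 / 8 : ℝ) := by ring
      _ ≤ (32 / 3) ^ 4 * T ^ (3 / 8 : ℝ) * T ^ (5 / 8 : ℝ) := by gcongr; exact log_pow_four_le hT1
      _ = _ := by rw [mul_assoc, ← Real.rpow_add hT0]; norm_num
  have hTl : 0 ≤ T / l := by positivity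
  have hBK : B ≤ K * (l ^ 4 + T / l) := by
    have h5 : 0 ≤ (C₁ + C₂) * C₃ * (32 / 3) ^ 4 := by positivity
    calc B ≤ (C₁ + C₂) * C₃ * ((32 / 3) ^ 4 * (T / l)) + C₄ ^ 2 * l ^ 4 := by
          rw [hB]
          gcongr
      _ ≤ _ := by
          rw [hK]
          nlinarith [mul_nonneg h5 (by positivity : 0 ≤ l ^ 4), mul_nonneg (sq_nonneg C₄) hTl]
  calc _ ≤ K * (l ^ 4 + T / l) * (2 * I) := by gcongr
    _ ≤ _ := by nlinarith [show 0 ≤ l ^ 4 + T / l by positivity]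

lemma exists_finset_nontrivialZeros (T : ℝ) :
    ∃ A : Finset ℂ, ∀ z, z ∈ A ↔ z ∈ nontrivialZeros ∧ z.im ∈ Set.Ioc 0 T := by
  have hfin : {z : ℂ | z ∈ nontrivialZeros ∧ z.im ∈ Set.Ioc 0 T}.Finite := by
    refine (IsCompact.inter_riemannZetaZeros_finite
      (isCompact_closedBall (0 : ℂ) (1 + |T|))).subset fun z hz => ⟨?_, hz.1.1⟩
    rw [mem_closedBall_zero_iff]
    refine (Complex.norm_le_abs_re_add_abs_im z).trans (add_le_add ?_ ?_)
    · rw [abs_of_pos hz.1.2.1]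
      exact hz.1.2.2.le
    · rw [abs_of_pos hz.2.1]
      exact hz.2.2.trans (le_abs_self T)
  exact ⟨hfin.toFinset, fun z => hfin.mem_toFinset⟩

lemma Fpair_eq {T : ℝ} (hT : 0 < T) {A : Finset ℂ}
    (hA : ∀ z, z ∈ A ↔ z ∈ nontrivialZeros ∧ z.im ∈ Set.Ioc 0 T) (u : ℝ) :
    Fpair u T = 2 * Real.pi / (T * Real.log T) * ∑ ρ ∈ A, ∑ ρ' ∈ A,
      4 / (4 + (ρ.im - ρ'.im) ^ 2) * Real.cos (u * Real.log T * (ρ.im - ρ'.im)) := by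
  have hset : zeroPairs T = ((A ×ˢ A : Finset (ℂ × ℂ)) : Set (ℂ × ℂ)) := by
    ext p
    rw [mem_coe, mem_product, hA, hA]
    simp only [zeroPairs, nontrivialZeros, Set.mem_ofPred_eq]
    tauto
  set f : ℂ × ℂ → ℂ := fun p => (T : ℂ) ^ (-(Complex.I * (u : ℂ) * ((p.1.im - p.2.im : ℝ) : ℂ))) *
    (((4 / (4 + (p.1.im - p.2.im) ^ 2) : ℝ)) : ℂ) with hf
  have h1 : ∑' p : zeroPairs T, f p = ∑ p ∈ A ×ˢ A, f p := by
    rw [tsum_congr_set_coe f hset]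
    exact Finset.tsum_subtype' _ _
  rw [Fpair]
  change _ * (∑' p : zeroPairs T, f p).re = _
  rw [h1, Complex.re_sum, sum_product]
  congr 1
  refine sum_congr rfl fun ρ _ => sum_congr rfl fun ρ' _ => ?_
  simp only [hf]
  rw [Complex.re_mul_ofReal, Complex.cpow_def_of_ne_zero (by exact_mod_cast hT.ne'), ← Complex.ofReal_log hT.le,
    show (Real.log T : ℂ) * -(Complex.I * u * ((ρ.im - ρ'.im : ℝ) : ℂ)) =
      ((-(u * Real.log T * (ρ.im - ρ'.im)) : ℝ) : ℂ) * Complex.I by push_cast; ring,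
    Complex.exp_ofReal_mul_I_re, Real.cos_neg, mul_comm]

lemma hcorr_neg (d : ℝ) : hcorr (-d) = hcorr d := by
  simp only [hcorr_eq, neg_mul, Real.cos_neg]

lemma integrableOn_kker_mul_cos (a : ℝ) :
    IntegrableOn (fun ξ => kker (ξ / (2 * Real.pi)) * Real.cos (a * ξ)) (Set.Ioi 0) := by
  refine Integrable.mul_bdd (c := 1) integrableOn_kker (by fun_prop) (Eventually.of_forall fun ξ => ?_)
  exact Real.abs_cos_le_one _

lemma integrableOn_kker_mul_cos_mul_cos (a b : ℝ) :
    IntegrableOn (fun ξ => kker (ξ / (2 * Real.pi)) * (Real.cos (a * ξ) * Real.cos (b * ξ))) (Set.Ioi 0) := by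
  refine Integrable.mul_bdd (c := 1) integrableOn_kker (by fun_prop) (Eventually.of_forall fun ξ => ?_)
  rw [norm_mul]
  exact mul_le_one₀ (Real.abs_cos_le_one _) (norm_nonneg _) (Real.abs_cos_le_one _)

lemma integral_kker_mul_cos_mul_cos (a b : ℝ) :
    ∫ ξ in Set.Ioi (0 : ℝ), kker (ξ / (2 * Real.pi)) * (Real.cos (a * ξ) * Real.cos (b * ξ)) =
      Real.pi / 2 * (hcorr (a - b) + hcorr (a + b)) := by
  rw [hcorr_eq, hcorr_eq, ← mul_add, ← integral_add (integrableOn_kker_mul_cos _) (integrableOn_kker_mul_cos _),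
    ← mul_assoc, show Real.pi / 2 * (1 / Real.pi) = 1 / 2 by field_simp, ← integral_const_mul]
  congr 1
  ext ξ
  rw [sub_mul, add_mul, Real.cos_sub, Real.cos_add]
  ring

lemma integral_kker_mul_Fpair {T β : ℝ} (hT : 1 < T) (hβ : 0 < β) {A : Finset ℂ}
    (hA : ∀ z, z ∈ A ↔ z ∈ nontrivialZeros ∧ z.im ∈ Set.Ioc 0 T) (Δ : ℝ) :
    2 * T / (2 * Real.pi ^ 2 * β) ^ 2 * ∫ u in Set.Ioi (0 : ℝ),
      kker (u / (2 * Real.pi * β)) * Fpair u T * Real.cos (u * Δ * Real.log T) =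
    (1 / Real.pi) ^ 2 * (1 / (β * Real.log T) * ∑ ρ ∈ A, ∑ ρ' ∈ A,
      4 / (4 + (ρ.im - ρ'.im) ^ 2) * hcorr ((ρ.im - ρ'.im - Δ) * (β * Real.log T))) := by
  have hl : 0 < Real.log T := Real.log_pos hT
  set l := Real.log T with hl'
  set g : ℝ → ℝ := fun u => kker (u / (2 * Real.pi * β)) * Fpair u T * Real.cos (u * Δ * l) with hg
  have hg1 : ∀ ξ, g (β * ξ) = ∑ ρ ∈ A, ∑ ρ' ∈ A, 2 * Real.pi / (T * l) * (4 / (4 + (ρ.im - ρ'.im) ^ 2)) *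
      (kker (ξ / (2 * Real.pi)) * (Real.cos ((ρ.im - ρ'.im) * (β * l) * ξ) * Real.cos (Δ * (β * l) * ξ))) := by
    intro ξ
    simp only [hg]
    rw [Fpair_eq (by linarith) hA, show β * ξ / (2 * Real.pi * β) = ξ / (2 * Real.pi) by field_simp]
    simp only [mul_sum, sum_mul]
    refine sum_congr rfl fun ρ _ => sum_congr rfl fun ρ' _ => ?_
    rw [← hl', show β * ξ * l * (ρ.im - ρ'.im) = (ρ.im - ρ'.im) * (β * l) * ξ by ring,
      show β * ξ * Δ * l = Δ * (β * l) * ξ by ring]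
    ring
  have h_int : ∀ ρ ρ' : ℂ, IntegrableOn (fun ξ => 2 * Real.pi / (T * l) * (4 / (4 + (ρ.im - ρ'.im) ^ 2)) *
      (kker (ξ / (2 * Real.pi)) * (Real.cos ((ρ.im - ρ'.im) * (β * l) * ξ) * Real.cos (Δ * (β * l) * ξ))))
      (Set.Ioi 0) := fun ρ ρ' => (integrableOn_kker_mul_cos_mul_cos _ _).const_mul _
  have hg2 : ∫ u in Set.Ioi (0 : ℝ), g u = β * ∑ ρ ∈ A, ∑ ρ' ∈ A,
      2 * Real.pi / (T * l) * (4 / (4 + (ρ.im - ρ'.im) ^ 2)) * (Real.pi / 2 *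
        (hcorr ((ρ.im - ρ'.im) * (β * l) - Δ * (β * l)) + hcorr ((ρ.im - ρ'.im) * (β * l) + Δ * (β * l)))) := by
    have h := integral_comp_mul_left_Ioi g 0 hβ
    rw [mul_zero, smul_eq_mul, inv_mul_eq_div, eq_div_iff hβ.ne', mul_comm] at h
    rw [← h]
    simp only [hg1]
    rw [integral_finsetSum _ fun ρ _ => integrable_finsetSum _ fun ρ' _ => h_int ρ ρ']
    congr 1
    refine sum_congr rfl fun ρ _ => ?_
    rw [integral_finsetSum _ fun ρ' _ => h_int ρ ρ']
    refine sum_congr rfl fun ρ' _ => ?_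
    rw [integral_const_mul, integral_kker_mul_cos_mul_cos]
  have hswap : ∑ ρ ∈ A, ∑ ρ' ∈ A, 4 / (4 + (ρ.im - ρ'.im) ^ 2) *
        hcorr ((ρ.im - ρ'.im) * (β * l) + Δ * (β * l)) =
      ∑ ρ ∈ A, ∑ ρ' ∈ A, 4 / (4 + (ρ.im - ρ'.im) ^ 2) *
        hcorr ((ρ.im - ρ'.im) * (β * l) - Δ * (β * l)) := by
    rw [sum_comm]
    refine sum_congr rfl fun ρ _ => sum_congr rfl fun ρ' _ => ?_
    rw [← hcorr_neg, show (ρ'.im - ρ.im) ^ 2 = (ρ.im - ρ'.im) ^ 2 by ring]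
    congr 2
    ring
  set W := ∑ ρ ∈ A, ∑ ρ' ∈ A, 4 / (4 + (ρ.im - ρ'.im) ^ 2) *
        hcorr ((ρ.im - ρ'.im) * (β * l) - Δ * (β * l)) with hW
  have hg3 : ∫ u in Set.Ioi (0 : ℝ), g u = β * (2 * Real.pi / (T * l) * (Real.pi / 2) * (W + W)) := by
    have hWW : W + W = ∑ ρ ∈ A, ∑ ρ' ∈ A, 4 / (4 + (ρ.im - ρ'.im) ^ 2) *
        (hcorr ((ρ.im - ρ'.im) * (β * l) - Δ * (β * l)) + hcorr ((ρ.im - ρ'.im) * (β * l) + Δ * (β * l))) := by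
      nth_rewrite 2 [← hswap]
      simp only [hW, mul_add, sum_add_distrib]
    rw [hg2, hWW]
    simp only [mul_sum]
    refine sum_congr rfl fun ρ _ => sum_congr rfl fun ρ' _ => ?_
    ring
  simp only [sub_mul _ Δ]
  rw [hg3, ← hW]
  have hT0 : T ≠ 0 := by linarith
  field_simp
  ring

lemma one_sub_weight_le (x Δ : ℝ) :
    1 - 4 / (4 + x ^ 2) ≤ 4 * (Δ ^ 2 / (1 + Δ ^ 2)) + 4 * ((x - Δ) ^ 2 / (1 + (x - Δ) ^ 2)) := by
  have key : ∀ y z : ℝ, z ^ 2 ≤ y ^ 2 → x = y + z → 1 - 4 / (4 + x ^ 2) ≤ 4 * (y ^ 2 / (1 + y ^ 2)) := by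
    intro y z hz hx
    rw [one_sub_div (by positivity), ← mul_div_assoc, div_le_div_iff₀ (by positivity) (by positivity)]
    have hx2 : x ^ 2 ≤ 4 * y ^ 2 := by rw [hx]; nlinarith [sq_nonneg (y - z)]
    nlinarith [sq_nonneg (x * y), sq_nonneg x, sq_nonneg y]
  rcases le_total (Δ ^ 2) ((x - Δ) ^ 2) with h | h
  · linarith [key (x - Δ) Δ h (by ring), show 0 ≤ 4 * (Δ ^ 2 / (1 + Δ ^ 2)) by positivity]
  · linarith [key Δ (x - Δ) h (by ring), show 0 ≤ 4 * ((x - Δ) ^ 2 / (1 + (x - Δ) ^ 2)) by positivity]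

lemma exists_sum_one_sub_weight_mul_hcorr_le (hRH : RiemannHypothesis) {β : ℝ} (hβ : 0 < β) :
    ∃ C > 0, ∀ T, Real.exp 20 ≤ T → ∀ A : Finset ℂ,
    (∀ z, z ∈ A ↔ z ∈ nontrivialZeros ∧ z.im ∈ Set.Ioc 0 T) → ∀ Δ, |Δ| ≤ 2 * Real.log T →
    1 / (β * Real.log T) * ∑ ρ ∈ A, ∑ ρ' ∈ A, (1 - 4 / (4 + (ρ.im - ρ'.im) ^ 2)) *
      |hcorr ((ρ.im - ρ'.im - Δ) * (β * Real.log T))| ≤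
      C * (T * Δ ^ 2 / (1 + Δ ^ 2) + T / Real.log T) := by
  obtain ⟨C₁, hC₁, h₁⟩ := exists_sum_pairs_le hRH
  obtain ⟨C₂, hC₂, h₂⟩ := exists_sum_one_div_le hRH
  have hpi := Real.pi_pos
  set K := 1024 * Real.pi with hK
  set C := K / β * ((1 + 1 / β ^ 2) * C₁) + K / β * (1 / β ^ 2 * (C₁ * (C₂ * 2))) with hC
  refine ⟨C, by positivity, fun T hT A hA Δ hΔ => ?_⟩
  have hT0 : 0 < T := (Real.exp_pos _).trans_le hT
  have hl20 : 20 ≤ Real.log T := (Real.le_log_iff_exp_le hT0).2 hT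
  have hlT : Real.log T ≤ T := (Real.log_le_sub_one_of_pos hT0).trans (by linarith)
  set l := Real.log T with hl
  have hAn : ∀ ρ ∈ A, ρ ∈ nontrivialZeros := fun ρ hρ => ((hA ρ).1 hρ).1
  have hA' : ∀ ρ ∈ A, riemannZeta₁ ρ = 0 ∧ ρ.re = 1 / 2 ∧ ρ.im ∈ Set.Ioc 0 T := fun ρ hρ =>
    ⟨riemannZeta₁_eq_zero_of_mem (hAn ρ hρ), hRH.re_eq_of_mem (hAn ρ hρ), ((hA ρ).1 hρ).2⟩
  have hcard : (A.card : ℝ) ≤ C₁ * (T * l) := by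
    refine le_trans ?_ (h₁ T hT 0 (by simp; linarith) A hA')
    rw [card_eq_sum_ones, Nat.cast_sum]
    refine sum_le_sum fun ρ hρ => ?_
    refine le_trans (by simp) (single_le_sum (f := fun ρ' : ℂ => 1 / (1 + ((ρ.im - ρ'.im - 0) * Real.log T) ^ 2))
      (fun _ _ => by positivity) hρ)
  have hlocal : ∑ ρ ∈ A, ∑ ρ' ∈ A, 1 / (1 + (ρ.im - ρ'.im - Δ) ^ 2) ≤ C₁ * (T * l) * (C₂ * (2 * l)) := by
    have : ∀ ρ ∈ A, ∑ ρ' ∈ A, 1 / (1 + (ρ.im - ρ'.im - Δ) ^ 2) ≤ C₂ * (2 * l) := fun ρ hρ => by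
      have h3 := h₂ (ρ.im - Δ) A hAn
      simp only [show ∀ z : ℂ, ρ.im - z.im - Δ = ρ.im - Δ - z.im from fun z => by ring]
      refine h3.trans (mul_le_mul_of_nonneg_left ?_ hC₂.le)
      rw [show 2 * l = Real.log (T ^ 2) by rw [Real.log_pow]; norm_num; rfl]
      refine Real.log_le_log (by positivity) ?_
      have h4 := abs_sub ρ.im Δ
      obtain ⟨h5, h6⟩ := ((hA ρ).1 hρ).2
      rw [abs_of_pos h5] at h4
      nlinarith
    refine (sum_le_sum this).trans ?_
    rw [sum_const, nsmul_eq_mul]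
    gcongr
  have hterm : ∀ ρ ρ' : ℂ, (1 - 4 / (4 + (ρ.im - ρ'.im) ^ 2)) * |hcorr ((ρ.im - ρ'.im - Δ) * (β * l))| ≤
      K * (Δ ^ 2 / (1 + Δ ^ 2)) * (1 + 1 / β ^ 2) * (1 / (1 + ((ρ.im - ρ'.im - Δ) * l) ^ 2)) +
      K * (1 / (β * l) ^ 2) * (1 / (1 + (ρ.im - ρ'.im - Δ) ^ 2)) := fun ρ ρ' => by
    set x := ρ.im - ρ'.im
    set d := x - Δ with hd
    have hw := one_sub_weight_le x Δ
    have hq : 0 < 1 + (d * (β * l)) ^ 2 := by positivity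
    have e1 : 1 / (1 + (d * (β * l)) ^ 2) ≤ (1 + 1 / β ^ 2) * (1 / (1 + (d * l) ^ 2)) := by
      rw [mul_one_div, div_le_div_iff₀ hq (by positivity)]
      have : (1 + 1 / β ^ 2) * (1 + (d * (β * l)) ^ 2) =
          1 + (d * l) ^ 2 + (1 / β ^ 2 + (d * (β * l)) ^ 2) := by field_simp; ring
      rw [this]
      linarith [show 0 ≤ 1 / β ^ 2 + (d * (β * l)) ^ 2 by positivity]
    have e2 : d ^ 2 / (1 + d ^ 2) * (1 / (1 + (d * (β * l)) ^ 2)) ≤ 1 / (β * l) ^ 2 * (1 / (1 + d ^ 2)) := by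
      rw [div_mul_div_comm, div_mul_div_comm, div_le_div_iff₀ (by positivity) (by positivity)]
      nlinarith [show 0 ≤ 1 + d ^ 2 by positivity]
    calc _ ≤ (4 * (Δ ^ 2 / (1 + Δ ^ 2)) + 4 * (d ^ 2 / (1 + d ^ 2))) * (256 * Real.pi / (1 + (d * (β * l)) ^ 2)) :=
          mul_le_mul hw (abs_hcorr_le _) (abs_nonneg _) (by positivity)
      _ = K * (Δ ^ 2 / (1 + Δ ^ 2)) * (1 / (1 + (d * (β * l)) ^ 2)) +
          K * (d ^ 2 / (1 + d ^ 2) * (1 / (1 + (d * (β * l)) ^ 2))) := by rw [hK]; ring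
      _ ≤ K * (Δ ^ 2 / (1 + Δ ^ 2)) * ((1 + 1 / β ^ 2) * (1 / (1 + (d * l) ^ 2))) +
          K * (1 / (β * l) ^ 2 * (1 / (1 + d ^ 2))) := by gcongr
      _ = _ := by ring
  calc _ ≤ 1 / (β * l) * ∑ ρ ∈ A, ∑ ρ' ∈ A,
        (K * (Δ ^ 2 / (1 + Δ ^ 2)) * (1 + 1 / β ^ 2) * (1 / (1 + ((ρ.im - ρ'.im - Δ) * l) ^ 2)) +
        K * (1 / (β * l) ^ 2) * (1 / (1 + (ρ.im - ρ'.im - Δ) ^ 2))) := by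
        gcongr with ρ _ ρ' _
        exact hterm ρ ρ'
    _ = 1 / (β * l) * (K * (Δ ^ 2 / (1 + Δ ^ 2)) * (1 + 1 / β ^ 2) *
          ∑ ρ ∈ A, ∑ ρ' ∈ A, 1 / (1 + ((ρ.im - ρ'.im - Δ) * l) ^ 2) +
        K * (1 / (β * l) ^ 2) * ∑ ρ ∈ A, ∑ ρ' ∈ A, 1 / (1 + (ρ.im - ρ'.im - Δ) ^ 2)) := by
        simp only [sum_add_distrib, mul_sum]
    _ ≤ 1 / (β * l) * (K * (Δ ^ 2 / (1 + Δ ^ 2)) * (1 + 1 / β ^ 2) * (C₁ * (T * l)) +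
        K * (1 / (β * l) ^ 2) * (C₁ * (T * l) * (C₂ * (2 * l)))) := by
        gcongr
        exact h₁ T hT Δ hΔ A hA'
    _ = K / β * ((1 + 1 / β ^ 2) * C₁) * (T * Δ ^ 2 / (1 + Δ ^ 2)) +
        K / β * (1 / β ^ 2 * (C₁ * (C₂ * 2))) * (T / l) := by field_simp
    _ ≤ _ := by
        rw [hC, add_mul (K / β * ((1 + 1 / β ^ 2) * C₁))]
        gcongr
        · linarith [show 0 ≤ T / l by positivity]
        · linarith [show 0 ≤ T * Δ ^ 2 / (1 + Δ ^ 2) by positivity]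

theorem statement13 (hRH : RiemannHypothesis) (β : ℝ) (hβ₀ : 0 < β) (hβ₁ : β < 1 / 2) :
    ∃ C > 0, ∀ᶠ T : ℝ in atTop, ∀ y₁ y₂ : ℝ,
      |y₁| ≤ Real.log T → |y₂| ≤ Real.log T →
      |(∫ t in (1 : ℝ)..T, Zx (T ^ β) (t + y₁) * Zx (T ^ β) (t + y₂)) -
          (2 * T / (2 * Real.pi ^ 2 * β) ^ 2) *
            ∫ u in Set.Ioi (0 : ℝ),
              kker (u / (2 * Real.pi * β)) * Fpair u T *
                Real.cos (u * (y₁ - y₂) * Real.log T)| ≤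
        C * (T * (y₁ - y₂) ^ 2 / (1 + (y₁ - y₂) ^ 2) + Real.log T ^ 4 + T / Real.log T) := by

  obtain ⟨C₁, hC₁, h₁⟩ := exists_abs_integral_tsum_mul_tsum_sub_le hRH
  obtain ⟨C₂, hC₂, h₂⟩ := exists_sum_one_sub_weight_mul_hcorr_le hRH hβ₀
  refine ⟨(1 / Real.pi) ^ 2 * (C₁ + C₂), by positivity, ?_⟩
  filter_upwards [eventually_ge_atTop (Real.exp 20),
    (Real.tendsto_log_atTop.const_mul_atTop hβ₀).eventually_ge_atTop 1] with T hT hL y₁ y₂ hy₁ hy₂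
  have hT1 : 1 < T := by linarith [Real.add_one_le_exp (20 : ℝ)]
  have hl0 : 0 < Real.log T := Real.log_pos hT1
  obtain ⟨A, hA⟩ := exists_finset_nontrivialZeros T
  have hΔ : |y₁ - y₂| ≤ 2 * Real.log T := by linarith [abs_sub y₁ y₂]
  have hZ : ∀ y t, Zx (T ^ β) (t + y) =
      1 / Real.pi * ∑' ρ : nontrivialZeros, hfun ((t + y - ρ.1.im) * (β * Real.log T)) := fun y t => by
    rw [Zx, Real.log_rpow (by linarith)]
    rfl
  have hR : ∫ t in (1 : ℝ)..T, Zx (T ^ β) (t + y₁) * Zx (T ^ β) (t + y₂) = (1 / Real.pi) ^ 2 *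
      ∫ t in (1 : ℝ)..T, (∑' ρ : nontrivialZeros, hfun ((t + y₁ - ρ.1.im) * (β * Real.log T))) *
        ∑' ρ : nontrivialZeros, hfun ((t + y₂ - ρ.1.im) * (β * Real.log T)) := by
    rw [← intervalIntegral.integral_const_mul]
    simp only [hZ]
    congr 1
    ext t
    ring
  have hd₁ := h₁ T hT A hA _ hL y₁ y₂ hy₁ hy₂
  rw [integral_sum_mul_sum_hfun (by linarith)] at hd₁
  have hd₂ := h₂ T hT A hA _ hΔ
  rw [hR, integral_kker_mul_Fpair hT1 hβ₀ hA, ← mul_sub, abs_mul, abs_of_nonneg (by positivity), mul_assoc]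
  refine mul_le_mul_of_nonneg_left ?_ (by positivity)
  set R := ∫ t in (1 : ℝ)..T, (∑' ρ : nontrivialZeros, hfun ((t + y₁ - ρ.1.im) * (β * Real.log T))) *
        ∑' ρ : nontrivialZeros, hfun ((t + y₂ - ρ.1.im) * (β * Real.log T))
  have hd₃ : |1 / (β * Real.log T) * ∑ ρ ∈ A, ∑ ρ' ∈ A,
        hcorr ((ρ.im - ρ'.im - (y₁ - y₂)) * (β * Real.log T)) -
      1 / (β * Real.log T) * ∑ ρ ∈ A, ∑ ρ' ∈ A, 4 / (4 + (ρ.im - ρ'.im) ^ 2) *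
        hcorr ((ρ.im - ρ'.im - (y₁ - y₂)) * (β * Real.log T))| ≤
      C₂ * (T * (y₁ - y₂) ^ 2 / (1 + (y₁ - y₂) ^ 2) + T / Real.log T) := by
    refine le_trans ?_ hd₂
    rw [← mul_sub, abs_mul, abs_of_nonneg (by positivity)]
    refine mul_le_mul_of_nonneg_left ?_ (by positivity)
    simp only [← sum_sub_distrib]
    refine (abs_sum_le_sum_abs _ _).trans (sum_le_sum fun ρ _ => (abs_sum_le_sum_abs _ _).trans
      (sum_le_sum fun ρ' _ => ?_))
    rw [← one_sub_mul, abs_mul, abs_of_nonneg]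
    rw [sub_nonneg, div_le_one (by positivity)]
    nlinarith [sq_nonneg (ρ.im - ρ'.im)]
  refine (abs_sub_le _ _ _).trans ((add_le_add hd₁ hd₃).trans ?_)
  have e₁ : 0 ≤ T * (y₁ - y₂) ^ 2 / (1 + (y₁ - y₂) ^ 2) := by positivity
  have e₂ : 0 ≤ Real.log T ^ 4 := by positivity
  nlinarith [mul_nonneg hC₁.le e₁, mul_nonneg hC₂.le e₂]
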